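/- arXiv:1210.5152 — 4 statements merged into one kernel-verified Lean document; each statement's English description precedes it below -/
import Mathlib

section
/- There exists an absolute constant C > 0 with the following property: for every prime power q, every finite field F_q with q elements, and every integer s ≥ 1, there exist an integer t with 0 ≤ t ≤ C·s and matrices C^{(i)} = (c^{(i)}_{j,r})_{j≥1, r≥0} over F_q for 1 ≤ i ≤ s such that (1) every row of every C^{(i)} has only finitely many nonzero entries, and (2) for every integer m > t and all integers d_1,...,d_s ≥ 0 with d_1 + ⋯ + d_s = m − t, the (m − t) × m matrix over F_q formed by the row vectors (c^{(i)}_{j,0},...,c^{(i)}_{j,m−1}) with 1 ≤ j ≤ d_i and 1 ≤ i ≤ s has rank m − t. In other words, for fixed q there exist digital (t,s)-sequences in base q with finite-row generating matrices whose quality parameter t grows at most linearly in s. -/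
open Finset

/-- Surjectivity form of the defining property of a digital `(t, s)`-sequence, together with the
finite-row condition. -/
def IsDigitalSeq {k : Type*} [Field k] {s : ℕ} (t : ℕ) (c : Fin s → ℕ → ℕ → k) : Prop :=
  (∀ i j, {r : ℕ | c i j r ≠ 0}.Finite) ∧
  ∀ (m : ℕ) (d : Fin s → ℕ), ∑ i, d i + t ≤ m → ∀ y : Fin s → ℕ → k,
    ∃ a : ℕ → k, ∀ i, ∀ j < d i, ∑ r ∈ range m, c i j r * a r = y i j

theorem IsDigitalSeq.rank_eq {k : Type*} [Field k] {s t : ℕ} {c : Fin s → ℕ → ℕ → k}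
    (h : IsDigitalSeq t c) {m : ℕ} (hm : t < m) (d : Fin s → ℕ) (hd : ∑ i, d i = m - t) :
    Matrix.rank (Matrix.of fun (p : Σ i : Fin s, Fin (d i)) (r : Fin m) =>
      c p.1 (p.2 : ℕ) (r : ℕ)) = m - t := by
  have hsurj : Function.Surjective (Matrix.mulVecLin
      (Matrix.of fun (p : Σ i : Fin s, Fin (d i)) (r : Fin m) => c p.1 (p.2 : ℕ) (r : ℕ))) := by
    intro y
    obtain ⟨a, ha⟩ := h.2 m d (by omega)
      (fun i j => if hj : j < d i then y ⟨i, ⟨j, hj⟩⟩ else 0)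
    refine ⟨fun r => a r, ?_⟩
    ext ⟨i, j⟩
    have := ha i j j.2
    simp only [j.2, dif_pos] at this
    rw [Matrix.mulVecLin_apply, ← this, Finset.sum_range]
    rfl
  rw [Matrix.rank, LinearMap.range_eq_top.2 hsurj, finrank_top, Module.finrank_fintype_fun_eq_card,
    Fintype.card_sigma]
  simpa using hd

theorem Finset.sum_range_two_mul {M : Type*} [AddCommMonoid M] (f : ℕ → M) (m : ℕ) :
    ∑ r ∈ range (2 * m), f r = ∑ r ∈ range m, (f (2 * r) + f (2 * r + 1)) := by
  induction m with
  | zero => simp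
  | succ m ih =>
    rw [show 2 * (m + 1) = 2 * m + 1 + 1 by ring, sum_range_succ, sum_range_succ, ih,
      sum_range_succ, add_assoc]

/-- Restriction of scalars along a quadratic extension. -/
theorem IsDigitalSeq.restrictScalars {F k : Type*} [Field F] [Field k] [Algebra F k]
    (b : Module.Basis (Fin 2) F k) {s t : ℕ} {c : Fin s → ℕ → ℕ → k} (h : IsDigitalSeq t c) :
    ∃ c' : Fin s → ℕ → ℕ → F, IsDigitalSeq (2 * t + s) c' := by
  refine ⟨fun i j r => b.repr (b (Fin.ofNat 2 r) * c i (j / 2) (r / 2)) (Fin.ofNat 2 j), ?_, ?_⟩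
  · intro i j
    have := (h.1 i (j / 2))
    refine ((this.image (fun r => 2 * r)).union (this.image (fun r => 2 * r + 1))).subset ?_
    intro r hr
    have hr' : c i (j / 2) (r / 2) ≠ 0 := by
      intro h0
      simp [h0] at hr
    rcases Nat.even_or_odd' r with ⟨e, rfl | rfl⟩
    · left
      exact ⟨e, by simpa using hr', rfl⟩
    · right
      exact ⟨e, by simpa [show (2 * e + 1) / 2 = e by omega] using hr', rfl⟩
  · intro m d hd y
    have hd2 : ∑ i, (d i + 1) / 2 + t ≤ m / 2 := by
      have : 2 * ∑ i, (d i + 1) / 2 ≤ ∑ i, d i + s := by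
        calc 2 * ∑ i, (d i + 1) / 2 = ∑ i, 2 * ((d i + 1) / 2) := by rw [mul_sum]
          _ ≤ ∑ i, (d i + 1) := sum_le_sum fun i _ => by omega
          _ = _ := by simp [sum_add_distrib]
      omega
    obtain ⟨a, ha⟩ := h.2 (m / 2) (fun i => (d i + 1) / 2) hd2
      (fun i j => y i (2 * j) • b 0 + y i (2 * j + 1) • b 1)
    refine ⟨fun r => if r < 2 * (m / 2) then b.repr (a (r / 2)) (Fin.ofNat 2 r) else 0, ?_⟩
    intro i j hj
    have h1 : ∀ r ∈ range (2 * (m / 2)), r < 2 * (m / 2) := fun r hr => mem_range.1 hr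
    rw [← sum_subset (range_subset_range.2 (Nat.mul_div_le m 2))
      (fun r _ hr => by simp [mem_range.not.1 hr])]
    rw [sum_congr (g := fun r => b.repr (b (Fin.ofNat 2 r) * c i (j / 2) (r / 2)) (Fin.ofNat 2 j) *
      b.repr (a (r / 2)) (Fin.ofNat 2 r)) rfl (fun r hr => by simp only [if_pos (h1 r hr)]),
      sum_range_two_mul]
    have h2 := ha i (j / 2) (by omega)
    have h3 : ∀ r ∈ range (m / 2),
        b.repr (b (Fin.ofNat 2 (2 * r)) * c i (j / 2) (2 * r / 2)) (Fin.ofNat 2 j) *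
          b.repr (a (2 * r / 2)) (Fin.ofNat 2 (2 * r)) +
        b.repr (b (Fin.ofNat 2 (2 * r + 1)) * c i (j / 2) ((2 * r + 1) / 2)) (Fin.ofNat 2 j) *
          b.repr (a ((2 * r + 1) / 2)) (Fin.ofNat 2 (2 * r + 1)) =
        b.repr (c i (j / 2) r * a r) (Fin.ofNat 2 j) := by
      intro r _
      have e0 : Fin.ofNat 2 (2 * r) = 0 := by ext; simp
      have e1 : Fin.ofNat 2 (2 * r + 1) = 1 := by ext; simp [Nat.add_mod]
      rw [e0, e1, show 2 * r / 2 = r by omega, show (2 * r + 1) / 2 = r by omega]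
      conv_rhs => rw [← b.sum_repr (a r)]
      rw [Fin.sum_univ_two, mul_add, mul_smul_comm, mul_smul_comm]
      simp only [map_add, map_smul, Finsupp.add_apply, Finsupp.smul_apply, smul_eq_mul]
      rw [mul_comm (c i (j / 2) r), mul_comm (c i (j / 2) r)]
      ring
    rw [sum_congr rfl h3, ← Finsupp.finsetSum_apply, ← map_sum, h2]
    rcases Nat.even_or_odd' j with ⟨e, rfl | rfl⟩
    · have e0 : Fin.ofNat 2 (2 * e) = 0 := by ext; simp
      rw [e0, show 2 * e / 2 = e by omega]
      simp
    · have e1 : Fin.ofNat 2 (2 * e + 1) = 1 := by ext; simp [Nat.add_mod]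
      rw [e1, show (2 * e + 1) / 2 = e by omega]
      simp

section Place

variable {k B : Type*} [Field k] [CommRing B] [IsDomain B] [IsNoetherianRing B] [Algebra k B]

theorem exists_functional_of_ne_bot (φ : B →ₐ[k] k) {I : Ideal B} (hI : I ≠ ⊥) :
    ∃ γ : B →ₗ[k] k, (∃ f ∈ I, γ f ≠ 0) ∧ ∀ f ∈ RingHom.ker φ * I, γ f = 0 := by
  have hlt : ¬ I ≤ RingHom.ker φ * I := by
    intro hle
    obtain ⟨r, hr1, hr2⟩ := Submodule.exists_sub_one_mem_and_smul_eq_zero_of_fg_of_le_smul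
      (RingHom.ker φ) I (IsNoetherian.noetherian I) (by simpa using hle)
    obtain ⟨f, hf, hf0⟩ := Submodule.exists_mem_ne_zero_of_ne_bot hI
    have h0 : r = 0 := by
      rcases mul_eq_zero.1 (hr2 f hf) with h | h
      · exact h
      · exact absurd h hf0
    rw [h0, RingHom.mem_ker] at hr1
    simp at hr1
  obtain ⟨f, hfI, hf⟩ := SetLike.not_le_iff_exists.1 hlt
  obtain ⟨γ, h1, h2⟩ := Submodule.exists_le_ker_of_notMem
    (p := (RingHom.ker φ * I).restrictScalars k) (v := f) hf
  exact ⟨γ, ⟨f, hfI, h1⟩, fun g hg => h2 hg⟩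

/-- The subideal of `I` cut out by a functional that vanishes on `ker φ * I`. -/
def Ideal.cutBy (φ : B →ₐ[k] k) (I : Ideal B) (γ : B →ₗ[k] k)
    (h : ∀ f ∈ RingHom.ker φ * I, γ f = 0) : Ideal B where
  carrier := {f | f ∈ I ∧ γ f = 0}
  add_mem' := fun ⟨h1, h2⟩ ⟨h3, h4⟩ => ⟨I.add_mem h1 h3, by rw [map_add, h2, h4, add_zero]⟩
  zero_mem' := ⟨I.zero_mem, map_zero _⟩
  smul_mem' := by
    rintro b f ⟨h1, h2⟩
    refine ⟨I.mul_mem_left _ h1, ?_⟩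
    have h3 : (b - algebraMap k B (φ b)) * f ∈ RingHom.ker φ * I :=
      Ideal.mul_mem_mul (by simp [RingHom.mem_ker]) h1
    have h4 := h _ h3
    rw [sub_mul, map_sub, ← Algebra.smul_def, map_smul, h2, smul_zero, sub_zero] at h4
    exact h4

theorem exists_functionals (φ : B →ₐ[k] k) (hφ : RingHom.ker φ ≠ ⊥) :
    ∃ γ : ℕ → B →ₗ[k] k,
      (∀ d, ∃ I : Ideal B, RingHom.ker φ ^ d ≤ I ∧ ∀ f, f ∈ I ↔ ∀ j < d, γ j f = 0) ∧
      ∀ (d : ℕ) (y : ℕ → k), ∃ b, ∀ j < d, γ j b = y j := by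
  choose! G hG1 hG2 using fun (I : Ideal B) (hI : I ≠ ⊥) => exists_functional_of_ne_bot φ hI
  have hcut : ∀ (I : Ideal B) (hI : I ≠ ⊥), Ideal.cutBy φ I (G I) (hG2 I hI) ≠ ⊥ := by
    intro I hI h0
    obtain ⟨f, hf, hf0⟩ := Submodule.exists_mem_ne_zero_of_ne_bot hI
    obtain ⟨g, hg, hg0⟩ := Submodule.exists_mem_ne_zero_of_ne_bot hφ
    have : g * f ∈ Ideal.cutBy φ I (G I) (hG2 I hI) :=
      ⟨I.mul_mem_left _ hf, hG2 I hI _ (Ideal.mul_mem_mul hg hf)⟩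
    rw [h0] at this
    exact mul_ne_zero hg0 hf0 (by simpa using this)
  let next : {I : Ideal B // I ≠ ⊥} → {I : Ideal B // I ≠ ⊥} := fun I =>
    ⟨Ideal.cutBy φ I.1 (G I.1) (hG2 I.1 I.2), hcut I.1 I.2⟩
  obtain ⟨J, hJ0, hJ⟩ : ∃ J : ℕ → {I : Ideal B // I ≠ ⊥},
      (J 0).1 = ⊤ ∧ ∀ d, J (d + 1) = next (J d) :=
    ⟨fun d => next^[d] ⟨⊤, top_ne_bot⟩, rfl, fun d => Function.iterate_succ_apply' _ _ _⟩
  have hmem : ∀ d f, f ∈ (J d).1 ↔ ∀ j < d, G (J j).1 f = 0 := by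
    intro d
    induction d with
    | zero => intro f; simp [hJ0]
    | succ d ih =>
      intro f
      rw [hJ]
      change (f ∈ (J d).1 ∧ G (J d).1 f = 0) ↔ _
      rw [ih]
      constructor
      · rintro ⟨h1, h2⟩ j hj
        rcases Nat.lt_succ_iff_lt_or_eq.1 hj with h | rfl
        · exact h1 j h
        · exact h2
      · intro h
        exact ⟨fun j hj => h j (by omega), h d (by omega)⟩
  refine ⟨fun d => G (J d).1, fun d => ⟨(J d).1, ?_, hmem d⟩, ?_⟩
  · induction d with
    | zero => simp [hJ0]
    | succ d ih =>
      rw [hJ, pow_succ']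
      intro f hf
      have hf' : f ∈ RingHom.ker φ * (J d).1 := Ideal.mul_mono_right ih hf
      have h1 : f ∈ (J d).1 := (Ideal.mul_le_right (I := RingHom.ker φ) (J := (J d).1)) hf'
      have h2 : G (J d).1 f = 0 := hG2 (J d).1 (J d).2 f hf'
      change f ∈ (J d).1 ∧ G (J d).1 f = 0
      exact ⟨h1, h2⟩
  · intro d y
    induction d with
    | zero => exact ⟨0, by simp⟩
    | succ d ih =>
      obtain ⟨b, hb⟩ := ih
      obtain ⟨f, hf, hf0⟩ := hG1 (J d).1 (J d).2
      refine ⟨b + ((y d - G (J d).1 b) / G (J d).1 f) • f, ?_⟩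
      intro j hj
      rcases Nat.lt_succ_iff_lt_or_eq.1 hj with h | rfl
      · rw [map_add, map_smul, (hmem d f).1 hf j h, smul_zero, add_zero, hb j h]
      · rw [map_add, map_smul, smul_eq_mul, div_mul_cancel₀ _ hf0]
        ring

end Place

/-- A filtration of a `k`-algebra by pole order at a rational place: `W n` consists of the functions
whose pole order is less than `n`. -/
structure IsPoleFiltration {k B : Type*} [Field k] [CommRing B] [Algebra k B]
    (W : ℕ → Submodule k B) : Prop where
  zero : W 0 = ⊥
  mono : Monotone W
  exhaustive : ∀ f, ∃ n, f ∈ W n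
  leaf : ∀ n f g, f ∈ W (n + 1) → g ∈ W (n + 1) → g ∉ W n → ∃ c : k, f - c • g ∈ W n
  mul : ∀ a b f g, f ∈ W (a + 1) → f ∉ W a → g ∈ W (b + 1) → g ∉ W b →
    f * g ∈ W (a + b + 1) ∧ f * g ∉ W (a + b)

/-- `n` is the exact pole order of some function. -/
def IsPoleNumber {k B : Type*} [Field k] [CommRing B] [Algebra k B]
    (W : ℕ → Submodule k B) (n : ℕ) : Prop := ∃ f ∈ W (n + 1), f ∉ W n

namespace IsPoleFiltration

variable {k B : Type*} [Field k] [CommRing B] [Algebra k B] {W : ℕ → Submodule k B}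

theorem exists_order (hW : IsPoleFiltration W) {f : B} (hf : f ≠ 0) {N : ℕ} (hN : f ∈ W N) :
    ∃ n < N, f ∈ W (n + 1) ∧ f ∉ W n := by
  induction N with
  | zero => rw [hW.zero] at hN; exact absurd (by simpa using hN) hf
  | succ N ih =>
    by_cases h : f ∈ W N
    · obtain ⟨n, hn, h⟩ := ih h
      exact ⟨n, by omega, h⟩
    · exact ⟨N, by omega, hN, h⟩

theorem add_mem (hW : IsPoleFiltration W) {a b : ℕ} (ha : IsPoleNumber W a)
    (hb : IsPoleNumber W b) : IsPoleNumber W (a + b) := by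
  obtain ⟨f, hf, hf'⟩ := ha
  obtain ⟨g, hg, hg'⟩ := hb
  exact ⟨f * g, hW.mul a b f g hf hf' hg hg'⟩

open Classical in
theorem isPoleNumber_of_le (hW : IsPoleFiltration W) {g : ℕ}
    (hg : ∀ m, m ≤ Nat.count (IsPoleNumber W) m + g) {m : ℕ} (hm : 2 * g ≤ m) :
    IsPoleNumber W m := by
  by_contra h
  have h1 : #{a ∈ range (m + 1) | IsPoleNumber W a} ≤
      #{a ∈ range (m + 1) | ¬ IsPoleNumber W a} := by
    refine card_le_card_of_injOn (fun a => m - a) ?_ ?_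
    · intro a ha
      simp only [coe_filter, mem_range, Set.mem_ofPred_eq] at ha ⊢
      refine ⟨by omega, fun h' => h ?_⟩
      have := hW.add_mem ha.2 h'
      rwa [show a + (m - a) = m by omega] at this
    · intro a ha b hb hab
      simp only [coe_filter, mem_range, Set.mem_ofPred_eq] at ha hb hab
      omega
  have h2 := card_filter_add_card_filter_not (s := range (m + 1)) (IsPoleNumber W)
  have h3 := hg (m + 1)
  rw [Nat.count_eq_card_filter_range] at h3
  have h4 : #{a ∈ range (m + 1) | IsPoleNumber W a} =
      #(filter (IsPoleNumber W) (range (m + 1))) := by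
    congr
  rw [card_range] at h2
  omega

theorem exists_sub_mul_mem (hW : IsPoleFiltration W) {g : ℕ}
    (hg : ∀ m, 2 * g ≤ m → IsPoleNumber W m) {P : ℕ} {f : B} (hf : f ∈ W (P + 1))
    (hf' : f ∉ W P) {n : ℕ} (hn : P + 2 * g ≤ n) (b : B) : ∃ u, b - f * u ∈ W n := by
  obtain ⟨N, hN⟩ := hW.exhaustive b
  induction N generalizing b with
  | zero => exact ⟨0, by simpa using hW.mono (Nat.zero_le n) hN⟩
  | succ N ih =>
    by_cases h : N < n
    · exact ⟨0, by simpa using hW.mono h hN⟩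
    · obtain ⟨u, hu, hu'⟩ := hg (N - P) (by omega)
      have h1 := hW.mul P (N - P) f u hf hf' hu hu'
      rw [show P + (N - P) = N by omega] at h1
      obtain ⟨c, hc⟩ := hW.leaf N b _ hN h1.1 h1.2
      obtain ⟨w, hw⟩ := ih _ hc
      refine ⟨c • u + w, ?_⟩
      convert hw using 1
      rw [mul_add, mul_smul_comm]
      ring

theorem infinite {g : ℕ}
    (hg : ∀ m, 2 * g ≤ m → IsPoleNumber W m) : (Set.ofPred (IsPoleNumber W)).Infinite :=
  Set.infinite_of_forall_exists_gt fun a =>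
    ⟨a + 2 * g + 1, hg _ (by omega), by omega⟩

open Classical in
theorem exists_sum_eq (hW : IsPoleFiltration W) {v : ℕ → B}
    (hv : ∀ r, v r ∈ W (Nat.nth (IsPoleNumber W) r + 1) ∧ v r ∉ W (Nat.nth (IsPoleNumber W) r))
    (N : ℕ) {f : B} (hf : f ∈ W N) :
    ∃ a : ℕ → k, f = ∑ r ∈ range (Nat.count (IsPoleNumber W) N), a r • v r := by
  induction N generalizing f with
  | zero => exact ⟨0, by rw [hW.zero] at hf; simpa using hf⟩
  | succ N ih =>
    by_cases hp : IsPoleNumber W N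
    · have hn : Nat.nth (IsPoleNumber W) (Nat.count (IsPoleNumber W) N) = N := Nat.nth_count hp
      have h1 := hv (Nat.count (IsPoleNumber W) N)
      rw [hn] at h1
      obtain ⟨c, hc⟩ := hW.leaf N f _ hf h1.1 h1.2
      obtain ⟨a, ha⟩ := ih hc
      refine ⟨Function.update a (Nat.count (IsPoleNumber W) N) c, ?_⟩
      rw [Nat.count_succ, if_pos hp, sum_range_succ, Function.update_self,
        sum_congr rfl (g := fun r => a r • v r), ← ha, sub_add_cancel]
      intro r hr
      rw [Function.update_of_ne (mem_range.1 hr).ne]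
    · have hf' : f ∈ W N := by
        by_contra h
        exact hp ⟨f, hf, h⟩
      rw [Nat.count_succ, if_neg hp, add_zero]
      exact ih hf'

theorem sum_eq_zero_iff (hW : IsPoleFiltration W) {ρ : ℕ → ℕ} (hρ : StrictMono ρ) {v : ℕ → B}
    (hv : ∀ r, v r ∈ W (ρ r + 1) ∧ v r ∉ W (ρ r)) (n : ℕ) (a : ℕ → k)
    (h : ∑ r ∈ range n, a r • v r = 0) : ∀ r < n, a r = 0 := by
  induction n with
  | zero => simp
  | succ n ih =>
    have h0 : a n = 0 := by
      by_contra hne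
      apply (hv n).2
      rw [sum_range_succ] at h
      rw [← Submodule.smul_mem_iff _ hne, eq_neg_of_add_eq_zero_right h]
      refine Submodule.neg_mem _ (Submodule.sum_mem _ fun r hr => Submodule.smul_mem _ _ ?_)
      exact hW.mono (hρ (mem_range.1 hr)) (hv r).1
    rw [sum_range_succ, h0, zero_smul, add_zero] at h
    intro r hr
    rcases Nat.lt_succ_iff_lt_or_eq.1 hr with hr | rfl
    · exact ih h r hr
    · exact h0

open Classical in
theorem nth_le (hW : IsPoleFiltration W) {g : ℕ}
    (hg : ∀ m, m ≤ Nat.count (IsPoleNumber W) m + g) (r : ℕ) :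
    Nat.nth (IsPoleNumber W) r ≤ r + g := by
  have h1 := hg (Nat.nth (IsPoleNumber W) r)
  rwa [Nat.count_nth_of_infinite
    (IsPoleFiltration.infinite fun m hm => hW.isPoleNumber_of_le hg hm)] at h1

open Classical in
theorem exists_ne_zero (hW : IsPoleFiltration W) {g : ℕ}
    (hg : ∀ m, m ≤ Nat.count (IsPoleNumber W) m + g) {s : ℕ} (γ : Fin s → ℕ → B →ₗ[k] k)
    (d : Fin s → ℕ) :
    ∃ f ≠ 0, f ∈ W (∑ i, d i + g + 1) ∧ ∀ i, ∀ j < d i, γ i j f = 0 := by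
  have hinf := IsPoleFiltration.infinite fun m hm => hW.isPoleNumber_of_le hg hm
  have hv : ∀ r, ∃ v, v ∈ W (Nat.nth (IsPoleNumber W) r + 1) ∧
      v ∉ W (Nat.nth (IsPoleNumber W) r) := fun r => Nat.nth_mem_of_infinite hinf r
  choose v hv using hv
  let T : (Fin (∑ i, d i + 1) → k) →ₗ[k] B := Fintype.linearCombination k fun r => v r
  let Γ : B →ₗ[k] ((Σ i : Fin s, Fin (d i)) → k) := LinearMap.pi fun p => γ p.1 p.2
  have hker : LinearMap.ker (Γ ∘ₗ T) ≠ ⊥ := by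
    apply LinearMap.ker_ne_bot_of_finrank_lt
    simp
  obtain ⟨a, ha, ha0⟩ := Submodule.exists_mem_ne_zero_of_ne_bot hker
  have hT : T a = ∑ r : Fin (∑ i, d i + 1), a r • v r := Fintype.linearCombination_apply _ _ _
  refine ⟨T a, ?_, ?_, ?_⟩
  · intro h0
    apply ha0
    ext r
    have := hW.sum_eq_zero_iff (Nat.nth_strictMono hinf) hv (∑ i, d i + 1)
      (fun r => if h : r < ∑ i, d i + 1 then a ⟨r, h⟩ else 0) ?_ r r.2
    · simp only [r.2, dif_pos] at this
      exact this
    · rw [Finset.sum_range, ← h0, hT]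
      exact sum_congr rfl fun r _ => by rw [dif_pos r.2]
  · rw [hT]
    refine Submodule.sum_mem _ fun r _ => Submodule.smul_mem _ _ (hW.mono ?_ (hv r).1)
    have := hW.nth_le hg r
    have := r.2
    omega
  · intro i j hj
    exact congrFun (LinearMap.mem_ker.1 ha) ⟨i, ⟨j, hj⟩⟩

theorem ker_ne_bot {g : ℕ}
    (hg : ∀ m, 2 * g ≤ m → IsPoleNumber W m) (φ : B →ₐ[k] k) : RingHom.ker φ ≠ ⊥ := by
  intro h
  obtain ⟨f, hf, hf'⟩ := hg (2 * g) le_rfl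
  obtain ⟨u, hu, hu'⟩ := hg (2 * g + 1) (by omega)
  have hinj : ∀ x : B, φ x = 0 → x = 0 := by
    intro x hx
    have : x ∈ RingHom.ker φ := hx
    rw [h] at this
    simpa using this
  have hf0 : φ f ≠ 0 := fun h0 => hf' (by rw [hinj f h0]; exact Submodule.zero_mem _)
  have h1 : u = (φ u / φ f) • f := by
    rw [← sub_eq_zero]
    apply hinj
    rw [map_sub, map_smul, smul_eq_mul, div_mul_cancel₀ _ hf0, sub_self]
  exact hu' (h1 ▸ Submodule.smul_mem _ _ hf)

open Classical in
/-- Rational points of a curve whose pole numbers at infinity have at most `g` gaps yield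
finite-row digital sequences. -/
theorem exists_isDigitalSeq [IsDomain B] [IsNoetherianRing B] (hW : IsPoleFiltration W) {g : ℕ}
    (hg : ∀ m, m ≤ Nat.count (IsPoleNumber W) m + g) {s : ℕ} (hs : 1 ≤ s)
    (φ : Fin s → (B →ₐ[k] k)) (hφ : Function.Injective φ) :
    ∃ c : Fin s → ℕ → ℕ → k, IsDigitalSeq (3 * g) c := by
  have hcond : ∀ m, 2 * g ≤ m → IsPoleNumber W m := fun m hm => hW.isPoleNumber_of_le hg hm
  have hinf := IsPoleFiltration.infinite hcond
  choose γ hγ1 hγ2 using fun i => exists_functionals (φ i) (ker_ne_bot hcond (φ i))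
  choose I hI1 hI2 using hγ1
  have hmax : ∀ i, (RingHom.ker (φ i)).IsMaximal := fun i =>
    RingHom.ker_isMaximal_of_surjective (φ i) fun x => ⟨algebraMap k B x, by simp⟩
  have hcop : ∀ d : Fin s → ℕ, Pairwise (Function.onFun IsCoprime fun i => I i (d i)) := by
    intro d i j hij
    have hne : RingHom.ker (φ i) ≠ RingHom.ker (φ j) := by
      intro h
      apply hij
      apply hφ
      ext b
      have : b - algebraMap k B (φ i b) ∈ RingHom.ker (φ i) := by simp [RingHom.mem_ker]
      rw [h, RingHom.mem_ker, map_sub, sub_eq_zero] at this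
      rw [this]; simp
    have h1 : IsCoprime (RingHom.ker (φ i)) (RingHom.ker (φ j)) :=
      Ideal.isCoprime_of_isMaximal hne
    have h2 : IsCoprime (RingHom.ker (φ i) ^ d i) (RingHom.ker (φ j) ^ d j) := h1.pow
    rw [Function.onFun, Ideal.isCoprime_iff_sup_eq]
    rw [Ideal.isCoprime_iff_sup_eq] at h2
    exact top_le_iff.1 (h2 ▸ sup_le_sup (hI1 i _) (hI1 j _))
  have hsurj : ∀ (m : ℕ) (d : Fin s → ℕ), ∑ i, d i + 3 * g ≤ m → ∀ y : Fin s → ℕ → k,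
      ∃ b ∈ W m, ∀ i, ∀ j < d i, γ i j b = y i j := by
    intro m d hm y
    choose x hx using fun i => hγ2 i (d i) (y i)
    obtain ⟨b, hb⟩ := Ideal.exists_forall_sub_mem_ideal (hcop d) x
    obtain ⟨f, hf0, hfW, hf⟩ := hW.exists_ne_zero hg γ d
    obtain ⟨P, hP, h1, h2⟩ := hW.exists_order hf0 hfW
    obtain ⟨u, hu⟩ := hW.exists_sub_mul_mem hcond h1 h2 (n := m) (by omega) b
    refine ⟨_, hu, fun i j hj => ?_⟩
    have h3 : f * u ∈ I i (d i) := Ideal.mul_mem_right _ _ ((hI2 i (d i) f).2 (hf i))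
    have h4 := (hI2 i (d i) _).1 (Ideal.sub_mem _ (hb i) h3) j hj
    rw [sub_right_comm, map_sub, hx i j hj, sub_eq_zero] at h4
    exact h4
  have hv : ∀ r, ∃ v, (v ∈ W (Nat.nth (IsPoleNumber W) r + 1) ∧
      v ∉ W (Nat.nth (IsPoleNumber W) r)) ∧
      (3 * g ≤ r → ∀ i, ∀ j < (r - 3 * g) / s, γ i j v = 0) := by
    intro r
    obtain ⟨u, hu, hu'⟩ := Nat.nth_mem_of_infinite hinf r
    by_cases hr : 3 * g ≤ r
    · obtain ⟨b, hb, hb'⟩ := hsurj r (fun _ => (r - 3 * g) / s) (by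
        have := Nat.mul_div_le (r - 3 * g) s
        simp
        omega) (fun i j => γ i j u)
      have hb1 : b ∈ W (Nat.nth (IsPoleNumber W) r) :=
        hW.mono ((Nat.nth_strictMono hinf).le_apply) hb
      refine ⟨u - b, ⟨?_, ?_⟩, fun _ i j hj => by rw [map_sub, hb' i j hj, sub_self]⟩
      · exact Submodule.sub_mem _ hu (hW.mono (Nat.le_succ _) hb1)
      · intro h
        exact hu' (by simpa using Submodule.add_mem _ h hb1)
    · exact ⟨u, ⟨hu, hu'⟩, fun h => absurd h hr⟩
  choose v hv1 hv2 using hv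
  refine ⟨fun i j r => γ i j (v r), ?_, ?_⟩
  · intro i j
    refine (Set.finite_lt_nat (3 * g + s * (j + 1))).subset fun r hr => ?_
    by_contra hlt
    simp only [Set.mem_ofPred_eq, not_lt] at hlt hr
    refine hr (hv2 r (by omega) i j ?_)
    rw [Nat.lt_iff_add_one_le, Nat.le_div_iff_mul_le (by omega), mul_comm]
    omega
  · intro m d hm y
    obtain ⟨b, hb, hb'⟩ := hsurj m d hm y
    obtain ⟨a, ha⟩ := hW.exists_sum_eq hv1 m hb
    refine ⟨fun r => if r < Nat.count (IsPoleNumber W) m then a r else 0, fun i j hj => ?_⟩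
    rw [← hb' i j hj, ha, map_sum, ← sum_subset (range_subset_range.2 (Nat.count_le (IsPoleNumber W)))
      (fun r _ hr => by simp only [if_neg (mem_range.not.1 hr), mul_zero])]
    refine sum_congr rfl fun r hr => ?_
    simp only [if_pos (mem_range.1 hr), map_smul, smul_eq_mul, mul_comm]

end IsPoleFiltration

/-- The first `n` steps of the Garcia-Stichtenoth tower, inside some field. -/
structure IsTower {L : Type*} [Field L] (q n : ℕ) (x : ℕ → L) : Prop where
  two_le : 2 ≤ q
  add_pow : ∀ a b : L, (a + b) ^ q = a ^ q + b ^ q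
  ne_zero : ∀ i < n, x i ≠ 0
  tr_ne_zero : ∀ i < n, x i ^ q + x i ≠ 0
  rel : ∀ i, i + 1 < n → (x (i + 1) ^ q + x (i + 1)) * (x i ^ q + x i) = x i ^ (q + 1)

/-- A function which is close to `1` at the places of type `κ` and close to `0` at the places
of the other types. -/
def towerIdem {L : Type*} [Field L] (q : ℕ) (x : ℕ → L) (κ : ℕ) : L :=
  -x κ ^ (q - 1) * ∏ l ∈ range κ, (1 + x l ^ (q - 1))

/-- The generator `x i` with most of its finite poles removed. -/
def towerGen {L : Type*} [Field L] (q n : ℕ) (x : ℕ → L) (i : ℕ) : L :=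
  x i - ∑ κ ∈ range i with i ≤ 2 * κ,
    towerIdem q x κ ^ q ^ (2 * n + 2) * x κ ^ (q + 1) / x (2 * κ - i)

theorem pow_mul_pow_div_le_one {Γ : Type*} [LinearOrderedCommGroupWithZero Γ] {q n : ℕ}
    (hq : 2 ≤ q) {γ e b c : Γ} (hγ0 : γ ≠ 0) (hγ : γ ≤ 1) (he : e ^ q ^ n ≤ γ)
    (hb : b * γ ^ q ^ n ≤ 1) (hc : γ ^ q ^ n ≤ c) :
    e ^ q ^ (2 * n + 2) * b ^ (q + 1) / c ≤ 1 := by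
  have hg0 : 0 < γ ^ q ^ n := pow_pos (zero_lt_iff.2 hγ0) _
  have hg1 : γ ^ q ^ n ≤ 1 := pow_le_one₀ zero_le hγ
  have hc0 : 0 < c := hg0.trans_le hc
  rw [div_le_one₀ hc0]
  have h1 : e ^ q ^ (2 * n + 2) ≤ (γ ^ q ^ n) ^ (q + 2) := by
    calc e ^ q ^ (2 * n + 2) = ((e ^ q ^ n) ^ q ^ n) ^ q ^ 2 := by
          rw [← pow_mul, ← pow_mul, ← pow_add, ← pow_add]
          ring_nf
      _ ≤ (γ ^ q ^ n) ^ q ^ 2 := by gcongr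
      _ ≤ _ := pow_le_pow_right_of_le_one' hg1 (by nlinarith)
  calc e ^ q ^ (2 * n + 2) * b ^ (q + 1) ≤ (γ ^ q ^ n) ^ (q + 2) * b ^ (q + 1) := by gcongr
    _ = (b * γ ^ q ^ n) ^ (q + 1) * γ ^ q ^ n := by
      rw [mul_pow, mul_assoc, ← pow_succ, mul_comm]
    _ ≤ 1 * c := by gcongr; exact pow_le_one₀ zero_le hb
    _ = c := one_mul c

namespace Valuation

variable {L Γ : Type*} [Field L] [LinearOrderedCommGroupWithZero Γ] (v : Valuation L Γ) {q : ℕ}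

theorem map_tr_of_lt_one (hq : 2 ≤ q) {a : L} (ha : v a < 1) : v (a ^ q + a) = v a := by
  by_cases h0 : a = 0
  · simp [h0, show q ≠ 0 by omega]
  · apply v.map_add_eq_of_lt_right
    rw [map_pow]
    exact pow_lt_self_of_lt_one₀ (zero_lt_iff.2 ((v.ne_zero_iff).2 h0)) ha (by omega)

theorem map_tr_of_one_lt (hq : 2 ≤ q) {a : L} (ha : 1 < v a) : v (a ^ q + a) = v a ^ q := by
  rw [← map_pow]
  apply v.map_add_eq_of_lt_left
  rw [map_pow]
  exact lt_self_pow₀ ha (by omega)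

theorem le_one_of_tr_le_one (hq : 2 ≤ q) {a : L} (ha : v (a ^ q + a) ≤ 1) : v a ≤ 1 := by
  by_contra! h
  rw [v.map_tr_of_one_lt hq h] at ha
  exact absurd ha (not_le.2 (one_lt_pow₀ h (by omega)))

end Valuation

namespace IsTower

variable {L Γ : Type*} [Field L] [LinearOrderedCommGroupWithZero Γ] {q n : ℕ} {x : ℕ → L}

theorem neg_pow (hx : IsTower q n x) (a : L) : (-a) ^ q = -a ^ q := by
  have h := hx.add_pow a (-a)
  rw [add_neg_cancel, zero_pow (by have := hx.two_le; omega)] at h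
  exact (neg_eq_of_add_eq_zero_right h.symm).symm

theorem sub_pow (hx : IsTower q n x) (a b : L) : (a - b) ^ q = a ^ q - b ^ q := by
  rw [sub_eq_add_neg, hx.add_pow, hx.neg_pow, sub_eq_add_neg]

theorem sub_one_pow (hx : IsTower q n x) (a : L) (N : ℕ) :
    (a - 1) ^ q ^ N = a ^ q ^ N - 1 := by
  induction N with
  | zero => simp
  | succ N ih => rw [pow_succ, pow_mul, ih, hx.sub_pow, one_pow, pow_mul]

theorem one_add_pow_mul (hx : IsTower q n x) (i : ℕ) :
    (1 + x i ^ (q - 1)) * x i = x i ^ q + x i := by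
  rw [add_mul, one_mul, pow_sub_one_mul (by have := hx.two_le; omega), add_comm]

theorem map_rel (hx : IsTower q n x) (v : Valuation L Γ) {i : ℕ} (hi : i + 1 < n) :
    v (x (i + 1) ^ q + x (i + 1)) * v (x i ^ q + x i) = v (x i) ^ (q + 1) := by
  rw [← map_mul, hx.rel i hi, map_pow]

/-- A correction term of `towerGen` is integral wherever its idempotent is small. -/
theorem map_correction_le (hx : IsTower q n x) (v : Valuation L Γ) {γ : Γ} (hγ0 : γ ≠ 0)
    (hγ : γ ≤ 1) (h1 : ∀ i < n, v (x i) * γ ^ q ^ n ≤ 1) (h2 : ∀ i < n, γ ^ q ^ n ≤ v (x i))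
    {κ l : ℕ} (hκ : κ < n) (hl : l < n) {η : L} (hη : v η ^ q ^ n ≤ γ) :
    v (η ^ q ^ (2 * n + 2) * x κ ^ (q + 1) / x l) ≤ 1 := by
  rw [map_div₀, map_mul, map_pow, map_pow]
  exact pow_mul_pow_div_le_one hx.two_le hγ0 hγ hη (h1 κ hκ) (h2 l hl)

theorem map_towerGen_le (hx : IsTower q n x) (v : Valuation L Γ) {γ : Γ} (hγ0 : γ ≠ 0)
    (hγ : γ ≤ 1) (h1 : ∀ i < n, v (x i) * γ ^ q ^ n ≤ 1) (h2 : ∀ i < n, γ ^ q ^ n ≤ v (x i))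
    {i : ℕ} (hi : i < n) (hη : ∀ κ < i, i ≤ 2 * κ → v (towerIdem q x κ) ^ q ^ n ≤ γ) :
    v (towerGen q n x i) ≤ max (v (x i)) 1 := by
  refine (v.map_sub _ _).trans (max_le_max le_rfl ?_)
  refine v.map_sum_le fun κ hκ => ?_
  rw [mem_filter, mem_range] at hκ
  exact hx.map_correction_le v hγ0 hγ h1 h2 (by omega) (by omega) (hη κ hκ.1 hκ.2)

theorem map_prod_le_of_le_one (hx : IsTower q n x) (v : Valuation L Γ) {γ : Γ} (hγ0 : γ ≠ 0)
    (hγ : γ ≤ 1) (h1 : ∀ i < n, v (x i) ≤ 1) (h2 : ∀ i < n, γ ^ q ^ n ≤ v (x i))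
    (hη : ∀ κ < n, v (towerIdem q x κ) ^ q ^ n ≤ γ) (e : ℕ → ℕ) :
    v (∏ i ∈ range (n - 1), towerGen q n x (i + 1) ^ e i) ≤ 1 := by
  rw [map_prod]
  refine prod_le_one' fun i hi => ?_
  rw [mem_range] at hi
  rw [map_pow]
  refine pow_le_one₀ zero_le ?_
  refine (hx.map_towerGen_le v hγ0 hγ (fun i hi => mul_le_one' (h1 i hi)
    (pow_le_one₀ zero_le hγ)) h2 (by omega) fun κ hκ _ => hη κ (by omega)).trans ?_
  exact max_le (h1 _ (by omega)) le_rfl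

theorem map_eq_one_of_tr (hx : IsTower q n x) (v : Valuation L Γ)
    (h : v (x 0 ^ q + x 0) = 1) : ∀ i < n, v (x i) = 1 ∧ v (x i ^ q + x i) = 1 := by
  have key : ∀ a : L, v (a ^ q + a) = 1 → v a = 1 := by
    intro a ha
    refine le_antisymm (v.le_one_of_tr_le_one hx.two_le ha.le) ?_
    by_contra! hlt
    rw [v.map_tr_of_lt_one hx.two_le hlt] at ha
    exact hlt.ne ha
  intro i
  induction i with
  | zero => exact fun _ => ⟨key _ h, h⟩
  | succ i ih =>
    intro hi
    have h1 := hx.map_rel v hi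
    obtain ⟨h2, h3⟩ := ih (by omega)
    rw [h2, h3, mul_one, one_pow] at h1
    exact ⟨key _ h1, h1⟩

theorem map_of_forall_lt (hx : IsTower q n x) (v : Valuation L Γ) {k : ℕ}
    (h : ∀ i < k, v (x i) < 1) :
    ∀ i ≤ k, i < n → v (x i ^ q + x i) = v (x 0 ^ q + x 0) ^ q ^ i := by
  intro i
  induction i with
  | zero => simp
  | succ i ih =>
    intro hik hi
    have h1 := ih (by omega) (by omega)
    have h2 := v.map_tr_of_lt_one hx.two_le (h i (by omega))
    have h3 := hx.map_rel v hi
    have h0 : v (x i) ≠ 0 := v.ne_zero_iff.2 (hx.ne_zero i (by omega))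
    rw [h2, pow_succ] at h3
    rw [mul_right_cancel₀ h0 h3, ← h2, h1, ← pow_mul, pow_succ]

end IsTower

/-- The valuation `v` lies over a finite zero of `x 0 ^ q + x 0` at which `x k` is the first
unit among the `x i`. -/
structure IsZeroOfType {L Γ : Type*} [Field L] [LinearOrderedCommGroupWithZero Γ] (q n : ℕ)
    (x : ℕ → L) (v : Valuation L Γ) (γ : Γ) (k : ℕ) : Prop extends IsTower q n x where
  lt : k < n
  γ_ne_zero : γ ≠ 0
  γ_lt_one : γ < 1
  map_of_lt : ∀ i < k, v (x i) = γ ^ q ^ i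
  map_self : v (x k) = 1
  map_tr : v (x k ^ q + x k) = γ ^ q ^ k

namespace IsZeroOfType

variable {L Γ : Type*} [Field L] [LinearOrderedCommGroupWithZero Γ] {q n : ℕ} {x : ℕ → L}
  {v : Valuation L Γ} {γ : Γ} {k : ℕ}

theorem pow_lt_one (h : IsZeroOfType q n x v γ k) (j : ℕ) : γ ^ q ^ j < 1 :=
  pow_lt_one₀ zero_le h.γ_lt_one (pow_pos (by have := h.two_le; omega) _).ne'

theorem pow_le_self (h : IsZeroOfType q n x v γ k) (j : ℕ) : γ ^ q ^ j ≤ γ :=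
  pow_le_of_le_one zero_le h.γ_lt_one.le (pow_pos (by have := h.two_le; omega) _).ne'

theorem pow_anti (h : IsZeroOfType q n x v γ k) {i j : ℕ} (hij : i ≤ j) :
    γ ^ q ^ j ≤ γ ^ q ^ i :=
  pow_le_pow_right_of_le_one' h.γ_lt_one.le
    (Nat.pow_le_pow_right (by have := h.two_le; omega) hij)

theorem one_lt_and_pow_mul_eq_one (h : IsZeroOfType q n x v γ k) (j : ℕ) (hj : k + (j + 1) < n) :
    1 < v (x (k + (j + 1))) ∧ v (x (k + (j + 1))) ^ q ^ (j + 1) * γ ^ q ^ k = 1 := by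
  have key : ∀ a : L, 1 < v (a ^ q + a) → 1 < v a ∧ v (a ^ q + a) = v a ^ q := by
    intro a ha
    have h1 : 1 < v a := by
      by_contra! hle
      refine absurd ha (not_lt.2 ((v.map_add _ _).trans (max_le ?_ hle)))
      rw [map_pow]
      exact pow_le_one₀ zero_le hle
    exact ⟨h1, v.map_tr_of_one_lt h.two_le h1⟩
  induction j with
  | zero =>
    have h1 := h.map_rel v hj
    rw [h.map_self, h.map_tr, one_pow] at h1
    obtain ⟨h2, h3⟩ := key (x (k + 1)) (by
      by_contra! hle
      exact absurd h1 (mul_lt_one_of_nonneg_of_lt_one_right hle zero_le (h.pow_lt_one k)).ne)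
    rw [h3] at h1
    simpa using ⟨h2, h1⟩
  | succ j ih =>
    obtain ⟨h1, h2⟩ := ih (by omega)
    have h3 := h.map_rel v (i := k + (j + 1)) hj
    rw [v.map_tr_of_one_lt h.two_le h1, pow_succ', mul_left_inj' (pow_ne_zero _ (by
      rintro h0; rw [h0] at h1; exact absurd h1 (by simp)))] at h3
    obtain ⟨h4, h5⟩ := key (x (k + (j + 1 + 1))) (by rw [← add_assoc k]; rw [h3]; exact h1)
    refine ⟨h4, ?_⟩
    rw [pow_succ', pow_mul, ← h5, ← add_assoc k, h3]
    exact h2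

theorem pow_succ_eq (h : IsZeroOfType q n x v γ k) {i : ℕ} (hk : k < i) (hi : i + 1 < n) :
    v (x (i + 1)) ^ q = v (x i) := by
  obtain ⟨j, rfl⟩ : ∃ j, i = k + (j + 1) := ⟨i - k - 1, by omega⟩
  obtain ⟨h1, -⟩ := h.one_lt_and_pow_mul_eq_one j (by omega)
  obtain ⟨h2, -⟩ := h.one_lt_and_pow_mul_eq_one (j + 1) (by omega)
  have h3 := h.map_rel v hi
  rw [v.map_tr_of_one_lt h.two_le h1, pow_succ', mul_left_inj' (pow_ne_zero _ (by
      rintro h0; rw [h0] at h1; exact absurd h1 (by simp)))] at h3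
  exact (v.map_tr_of_one_lt h.two_le h2).symm.trans h3

theorem one_lt (h : IsZeroOfType q n x v γ k) {i : ℕ} (hk : k < i) (hi : i < n) :
    1 < v (x i) := by
  obtain ⟨j, rfl⟩ : ∃ j, i = k + (j + 1) := ⟨i - k - 1, by omega⟩
  exact (h.one_lt_and_pow_mul_eq_one j hi).1

theorem map_mul_le (h : IsZeroOfType q n x v γ k) {i : ℕ} (hi : i < n) :
    v (x i) * γ ^ q ^ n ≤ 1 := by
  rcases lt_trichotomy i k with hik | rfl | hik
  · rw [h.map_of_lt i hik]
    exact mul_le_one' (h.pow_lt_one _).le (h.pow_lt_one _).le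
  · rw [h.map_self, one_mul]
    exact (h.pow_lt_one _).le
  · obtain ⟨j, rfl⟩ : ∃ j, i = k + (j + 1) := ⟨i - k - 1, by omega⟩
    obtain ⟨h1, h2⟩ := h.one_lt_and_pow_mul_eq_one j (by omega)
    rw [← h2]
    exact mul_le_mul' (le_self_pow₀ h1.le (pow_pos (by have := h.two_le; omega) _).ne')
      (h.pow_anti h.lt.le)

theorem le_map (h : IsZeroOfType q n x v γ k) {i : ℕ} (hi : i < n) : γ ^ q ^ n ≤ v (x i) := by
  rcases lt_trichotomy i k with hik | rfl | hik
  · rw [h.map_of_lt i hik]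
    exact h.pow_anti hi.le
  · rw [h.map_self]
    exact (h.pow_lt_one _).le
  · exact (h.pow_lt_one _).le.trans (h.one_lt hik hi).le

theorem map_one_add_pow_of_lt (h : IsZeroOfType q n x v γ k) {i : ℕ} (hi : i < k) :
    v (1 + x i ^ (q - 1)) = 1 := by
  refine v.map_one_add_of_lt ?_
  rw [map_pow, h.map_of_lt i hi]
  exact pow_lt_one₀ zero_le (h.pow_lt_one i) (by have := h.two_le; omega)

theorem map_one_add_pow_self (h : IsZeroOfType q n x v γ k) :
    v (1 + x k ^ (q - 1)) = γ ^ q ^ k := by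
  have := congrArg v (h.one_add_pow_mul k)
  rwa [map_mul, h.map_self, mul_one, h.map_tr] at this

theorem map_one_add_pow_of_gt (h : IsZeroOfType q n x v γ k) {i : ℕ} (hk : k < i) (hi : i < n) :
    v (1 + x i ^ (q - 1)) = v (x i) ^ (q - 1) := by
  rw [v.map_add_eq_of_lt_right, map_pow]
  rw [map_pow, map_one]
  exact one_lt_pow₀ (h.one_lt hk hi) (by have := h.two_le; omega)

theorem map_towerIdem_of_lt (h : IsZeroOfType q n x v γ k) {κ : ℕ} (hκ : κ < k) :
    v (towerIdem q x κ) ^ q ^ n ≤ γ := by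
  have h2 := h.two_le
  rw [towerIdem, map_mul, Valuation.map_neg, map_pow, h.map_of_lt κ hκ, map_prod,
    prod_eq_one fun l hl => h.map_one_add_pow_of_lt ((mem_range.1 hl).trans hκ), mul_one,
    ← pow_mul, ← pow_mul]
  have h3 : 0 < q - 1 := by omega
  have h4 : 0 < q := by omega
  exact pow_le_of_le_one zero_le h.γ_lt_one.le (by positivity)

theorem prod_mul_eq_one (h : IsZeroOfType q n x v γ k) (j : ℕ) (hj : k + j + 1 < n) :
    v (∏ l ∈ range (k + j + 1), (1 + x l ^ (q - 1))) * v (x (k + j + 1)) ^ q = 1 := by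
  induction j with
  | zero =>
    rw [map_prod, add_zero, prod_range_succ, prod_eq_one fun l hl =>
      h.map_one_add_pow_of_lt (mem_range.1 hl), one_mul, h.map_one_add_pow_self, mul_comm]
    simpa using (h.one_lt_and_pow_mul_eq_one 0 hj).2
  | succ j ih =>
    rw [prod_range_succ, map_mul, ← add_assoc k j 1,
      h.map_one_add_pow_of_gt (by omega) (by omega), h.pow_succ_eq (by omega) (by omega),
      mul_assoc, pow_sub_one_mul (by have := h.two_le; omega)]
    exact ih (by omega)

theorem map_towerIdem_of_gt (h : IsZeroOfType q n x v γ k) {κ : ℕ} (hκ : k < κ) (hn : κ < n) :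
    v (towerIdem q x κ) ^ q ^ n ≤ γ := by
  have hq := h.two_le
  obtain ⟨j, rfl⟩ : ∃ j, κ = k + j + 1 := ⟨κ - k - 1, by omega⟩
  have h1 : v (towerIdem q x (k + j + 1)) * v (x (k + j + 1)) = 1 := by
    rw [← h.prod_mul_eq_one j hn, towerIdem, map_mul, Valuation.map_neg, map_pow, mul_right_comm,
      pow_sub_one_mul (by omega), mul_comm]
  obtain ⟨h2, h3⟩ := h.one_lt_and_pow_mul_eq_one j hn
  rw [← add_assoc] at h2 h3
  have h4 : 1 ≤ v (x (k + j + 1)) ^ q ^ n * γ := by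
    rw [← h3]
    exact mul_le_mul' (pow_le_pow_right₀ h2.le (Nat.pow_le_pow_right (by omega) (by omega)))
      (h.pow_le_self k)
  calc v (towerIdem q x (k + j + 1)) ^ q ^ n
      ≤ v (towerIdem q x (k + j + 1)) ^ q ^ n * (v (x (k + j + 1)) ^ q ^ n * γ) :=
        le_mul_of_one_le_right' h4
    _ = γ := by rw [← mul_assoc, ← mul_pow, h1, one_pow, one_mul]

theorem map_towerIdem_sub_one (h : IsZeroOfType q n x v γ k) :
    v (towerIdem q x k - 1) ^ q ^ n ≤ γ := by
  have hq := h.two_le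
  have h1 : ∀ m ≤ k, v (∏ l ∈ range m, (1 + x l ^ (q - 1)) - 1) ≤ γ := by
    intro m
    induction m with
    | zero => simp
    | succ m ih =>
      intro hm
      rw [prod_range_succ, mul_add, mul_one, add_sub_right_comm]
      refine (v.map_add _ _).trans (max_le (ih (by omega)) ?_)
      rw [map_mul, map_prod, prod_eq_one fun l hl => h.map_one_add_pow_of_lt
        (by have := mem_range.1 hl; omega), one_mul, map_pow, h.map_of_lt m (by omega), ← pow_mul]
      exact pow_le_of_le_one zero_le h.γ_lt_one.le
        (Nat.mul_pos (pow_pos (by omega) _) (by omega)).ne'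
  have h2 : v (towerIdem q x k - 1) ≤ γ := by
    have : towerIdem q x k - 1 = -x k ^ (q - 1) * (∏ l ∈ range k, (1 + x l ^ (q - 1)) - 1) -
        (1 + x k ^ (q - 1)) := by rw [towerIdem]; ring
    rw [this]
    refine (v.map_sub _ _).trans (max_le ?_ ?_)
    · rw [map_mul, Valuation.map_neg, map_pow, h.map_self, one_pow, one_mul]
      exact h1 k le_rfl
    · rw [h.map_one_add_pow_self]
      exact h.pow_le_self k
  exact (pow_le_pow_left₀ zero_le h2 _).trans (h.pow_le_self n)

theorem map_pow_sub_le (h : IsZeroOfType q n x v γ k) :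
    v ((x k ^ (q + 1)) - (x k ^ (q + 1)) ^ q) ≤ γ ^ q ^ k := by
  set T := x k ^ q + x k with hT
  have h1 : x k ^ q = T - x k := by rw [hT]; ring
  have h2 : x k ^ (q + 1) - (x k ^ (q + 1)) ^ q = x k ^ q * (T - T ^ q) := by
    have h3 : (x k ^ (q + 1)) ^ q = (T - x k) * (T ^ q - T + x k) := by
      rw [pow_succ, mul_pow, h1, h.sub_pow, h1]
      ring
    rw [h3, pow_succ, h1]
    ring
  rw [h2, map_mul, map_pow, h.map_self, one_pow, one_mul]
  refine (v.map_sub _ _).trans ?_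
  rw [map_pow, h.map_tr]
  exact max_le le_rfl (pow_le_of_le_one zero_le (h.pow_lt_one k).le
    (by have := h.two_le; omega))

theorem sq_div_le {z : L} (hq : 2 ≤ q) (hz : 1 < v z) : v (z ^ 2 / (z ^ q + z)) ≤ 1 := by
  rw [map_div₀, map_pow, v.map_tr_of_one_lt hq hz]
  exact div_le_one_of_le₀ (pow_le_pow_right₀ hz.le hq) zero_le

/-- Beyond `k` the tower mirrors the part before `k`, up to integral functions. -/
theorem map_sub_div_le (h : IsZeroOfType q n x v γ k) (j : ℕ) (hj : j + 1 ≤ k)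
    (hn : k + j + 1 < n) :
    v (x (k + j + 1) - x k ^ (q + 1) / x (k - (j + 1))) ≤ 1 := by
  have hq := h.two_le
  have hne : ∀ i < n, x i ≠ 0 := h.ne_zero
  have htr : ∀ i < n, x i ^ q + x i ≠ 0 := h.tr_ne_zero
  -- the tower relation at `k - (j + 1)`, in terms of the reciprocal
  have hinv : ∀ i, i + 1 < n → (1 / x i) ^ q + 1 / x i = 1 / (x (i + 1) ^ q + x (i + 1)) := by
    intro i hi
    rw [eq_div_iff (htr _ hi)]
    have h1 := h.rel i hi
    have h2 := hne i (by omega)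
    have h3 : (1 / x i) ^ q + 1 / x i = (x i ^ q + x i) / x i ^ (q + 1) := by
      rw [one_div, inv_pow, pow_succ]
      field_simp
      ring
    rw [h3, div_mul_eq_mul_div, mul_comm, h1, div_self (pow_ne_zero _ h2)]
  have hz : ∀ i, i < k → v ((x k ^ (q + 1) - (x k ^ (q + 1)) ^ q) * (1 / x i) ^ q) ≤ 1 := by
    intro i hi
    have h0 : 0 < γ ^ q ^ (i + 1) := pow_pos (zero_lt_iff.2 h.γ_ne_zero) _
    rw [map_mul, map_pow v (1 / x i), map_div₀, map_one, h.map_of_lt i hi, one_div, inv_pow,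
      ← pow_mul γ, ← pow_succ, ← div_eq_mul_inv, div_le_one₀ h0]
    exact h.map_pow_sub_le.trans (h.pow_anti hi)
  induction j with
  | zero =>
    apply v.le_one_of_tr_le_one hq
    have h1 := hz (k - 1) (by omega)
    have h2 := hinv (k - 1) (by omega)
    rw [Nat.sub_add_cancel hj] at h2
    have h3 : x (k + 1) ^ q + x (k + 1) =
        x k ^ (q + 1) * ((1 / x (k - 1)) ^ q + 1 / x (k - 1)) := by
      rw [h2, mul_one_div, eq_div_iff (htr k h.lt)]
      exact h.rel k hn
    convert h1 using 2
    simp only [add_zero, zero_add]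
    rw [h.sub_pow, sub_add_sub_comm, h3, div_eq_mul_one_div (x k ^ (q + 1)), mul_pow _ (1 / _) q]
    ring
  | succ j ih =>
    apply v.le_one_of_tr_le_one hq
    have ih := ih (by omega) (by omega)
    set u := x (k + j + 1) with hu
    set w := x (k - (j + 1)) with hw
    set w' := x (k - (j + 1 + 1)) with hw'
    have hwne : w ≠ 0 := hne _ (by omega)
    have hune : u ≠ 0 := hne _ (by omega)
    have h1 := hz (k - (j + 1 + 1)) (by omega)
    have h2 := hinv (k - (j + 1 + 1)) (by omega)
    rw [show k - (j + 1 + 1) + 1 = k - (j + 1) by omega, ← hw, ← hw'] at h2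
    rw [← hw'] at h1
    have hzne : (1 / w) ^ q + 1 / w ≠ 0 := by
      have := htr (k - (j + 1)) (by omega)
      rw [← hw] at this
      have h5 : (1 / w) ^ q + 1 / w = (w ^ q + w) / w ^ (q + 1) := by
        rw [one_div, inv_pow, pow_succ]
        field_simp
        ring
      rw [h5]
      exact div_ne_zero this (pow_ne_zero _ hwne)
    have h3 : (1 / w') ^ q + 1 / w' = 1 / w - (1 / w) ^ 2 / ((1 / w) ^ q + 1 / w) := by
      have h5 : (1 / w) ^ q + 1 / w = (w ^ q + w) / w ^ (q + 1) := by
        rw [one_div, inv_pow, pow_succ]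
        field_simp
        ring
      have h6 : w ^ q + w ≠ 0 := htr (k - (j + 1)) (by omega)
      rw [h2, h5]
      field_simp
      rw [pow_succ]
      field_simp
      ring
    have h4 : x (k + (j + 1) + 1) ^ q + x (k + (j + 1) + 1) = u - u ^ 2 / (u ^ q + u) := by
      have h6 : u ^ q + u ≠ 0 := htr (k + j + 1) (by omega)
      have hr : (x (k + (j + 1) + 1) ^ q + x (k + (j + 1) + 1)) * (u ^ q + u) = u ^ (q + 1) :=
        h.rel (k + j + 1) hn
      apply mul_right_cancel₀ h6
      rw [hr, sub_mul, div_mul_cancel₀ _ h6, pow_succ]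
      ring
    have hw1 : 1 < v (1 / w) := by
      rw [map_div₀, map_one, hw, h.map_of_lt _ (by omega), one_lt_div₀
        (pow_pos (zero_lt_iff.2 h.γ_ne_zero) _)]
      exact h.pow_lt_one _
    have h7 : v (u ^ 2 / (u ^ q + u)) ≤ 1 := sq_div_le hq (h.one_lt (by omega) (by omega))
    have h8 : v ((1 / w) ^ 2 / ((1 / w) ^ q + 1 / w)) ≤ 1 := sq_div_le hq hw1
    have h9 : (x (k + (j + 1) + 1) - x k ^ (q + 1) / w') ^ q +
        (x (k + (j + 1) + 1) - x k ^ (q + 1) / w') =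
        (u - x k ^ (q + 1) / w) - u ^ 2 / (u ^ q + u) +
          x k ^ (q + 1) * ((1 / w) ^ 2 / ((1 / w) ^ q + 1 / w)) +
          (x k ^ (q + 1) - (x k ^ (q + 1)) ^ q) * (1 / w') ^ q := by
      rw [h.sub_pow, sub_add_sub_comm, h4, div_eq_mul_one_div (x k ^ (q + 1)) w', mul_pow _ (1 / _) q,
        div_eq_mul_one_div (x k ^ (q + 1)) w]
      linear_combination (-x k ^ (q + 1)) * h3
    rw [h9]
    refine (v.map_add _ _).trans (max_le ((v.map_add _ _).trans (max_le
      ((v.map_sub _ _).trans (max_le ih h7)) ?_)) h1)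
    rw [map_mul, map_pow, h.map_self, one_pow, one_mul]
    exact h8

theorem map_towerGen_le_one (h : IsZeroOfType q n x v γ k) {i : ℕ} (hi : i ≤ 2 * k) (hn : i < n) :
    v (towerGen q n x i) ≤ 1 := by
  have hcorr : ∀ κ < n, κ ≠ k → ∀ l < n,
      v (towerIdem q x κ ^ q ^ (2 * n + 2) * x κ ^ (q + 1) / x l) ≤ 1 := by
    intro κ hκ hne l hl
    refine h.map_correction_le v h.γ_ne_zero h.γ_lt_one.le (fun i hi => h.map_mul_le hi)
      (fun i hi => h.le_map hi) hκ hl ?_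
    rcases lt_or_gt_of_ne hne with h1 | h1
    · exact h.map_towerIdem_of_lt h1
    · exact h.map_towerIdem_of_gt h1 hκ
  by_cases hik : i ≤ k
  · refine (v.map_sub _ _).trans (max_le ?_ (v.map_sum_le fun κ hκ => ?_))
    · rcases hik.lt_or_eq with h1 | rfl
      · rw [h.map_of_lt i h1]
        exact (h.pow_lt_one i).le
      · exact h.map_self.le
    · rw [mem_filter, mem_range] at hκ
      exact hcorr κ (by omega) (by omega) _ (by omega)
  · obtain ⟨j, rfl⟩ : ∃ j, i = k + j + 1 := ⟨i - k - 1, by omega⟩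
    have hmem : k ∈ {κ ∈ range (k + j + 1) | k + j + 1 ≤ 2 * κ} := by
      rw [mem_filter, mem_range]
      omega
    have h1 := h.map_sub_div_le j (by omega) hn
    have h2 := h.map_correction_le v h.γ_ne_zero h.γ_lt_one.le (fun i hi => h.map_mul_le hi)
      (fun i hi => h.le_map hi) h.lt (l := k - (j + 1)) (by omega) h.map_towerIdem_sub_one
    rw [h.sub_one_pow] at h2
    have h3 : towerGen q n x (k + j + 1) = (x (k + j + 1) - x k ^ (q + 1) / x (k - (j + 1))) -
        (towerIdem q x k ^ q ^ (2 * n + 2) - 1) * x k ^ (q + 1) / x (k - (j + 1)) -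
        ∑ κ ∈ {κ ∈ range (k + j + 1) | k + j + 1 ≤ 2 * κ}.erase k,
          towerIdem q x κ ^ q ^ (2 * n + 2) * x κ ^ (q + 1) / x (2 * κ - (k + j + 1)) := by
      rw [towerGen, ← add_sum_erase _ _ hmem, show 2 * k - (k + j + 1) = k - (j + 1) by omega]
      ring
    rw [h3]
    refine (v.map_sub _ _).trans (max_le ((v.map_sub _ _).trans (max_le h1 h2))
      (v.map_sum_le fun κ hκ => ?_))
    rw [mem_erase, mem_filter, mem_range] at hκ
    exact hcorr κ (by omega) hκ.1 _ (by omega)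

theorem map_towerGen_le_map (h : IsZeroOfType q n x v γ k) {i : ℕ} (hi : 2 * k < i) (hn : i < n) :
    v (towerGen q n x i) ≤ v (x i) := by
  refine (h.map_towerGen_le v h.γ_ne_zero h.γ_lt_one.le (fun i hi => h.map_mul_le hi)
      (fun i hi => h.le_map hi) hn fun κ hκ hκi =>
      h.map_towerIdem_of_gt (by omega) (by omega)).trans ?_
  exact max_le le_rfl (h.one_lt (by omega) hn).le

theorem mul_map_prod_le (h : IsZeroOfType q n x v γ k) {e : ℕ → ℕ} (he : ∀ i, e i < q) :
    γ * v (∏ i ∈ range (n - 1), towerGen q n x (i + 1) ^ e i) ≤ 1 := by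
  have hq := h.two_le
  have h1 : ∀ m ≤ 2 * k, m < n → v (∏ i ∈ range m, towerGen q n x (i + 1) ^ e i) ≤ 1 := by
    intro m hm hmn
    rw [map_prod]
    refine prod_le_one' fun i hi => ?_
    rw [mem_range] at hi
    rw [map_pow]
    exact pow_le_one₀ zero_le (h.map_towerGen_le_one (by omega) (by omega))
  have h2 : ∀ m, 2 * k + 1 + m < n →
      γ * v (∏ i ∈ range (2 * k + 1 + m), towerGen q n x (i + 1) ^ e i) *
        v (x (2 * k + 1 + m)) ≤ 1 := by
    have hstep : ∀ i, 2 * k < i → i < n → v (towerGen q n x i) ^ e (i - 1) * v (x i) ≤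
        v (x i) ^ q := by
      intro i hi hn
      calc v (towerGen q n x i) ^ e (i - 1) * v (x i) ≤ v (x i) ^ e (i - 1) * v (x i) := by
            gcongr
            exact h.map_towerGen_le_map hi hn
        _ = v (x i) ^ (e (i - 1) + 1) := (pow_succ _ _).symm
        _ ≤ _ := pow_le_pow_right₀ (h.one_lt (by omega) hn).le (he _)
    intro m
    induction m with
    | zero =>
      intro hn
      have h3 : v (x (2 * k + 1)) ^ q * γ ≤ 1 := by
        have h4 := (h.one_lt_and_pow_mul_eq_one k (by omega)).2
        rw [← add_assoc, ← two_mul, pow_succ', pow_mul, ← mul_pow] at h4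
        by_contra! hlt
        exact absurd h4 (one_lt_pow₀ hlt (pow_pos (by omega) _).ne').ne'
      rw [add_zero, prod_range_succ, map_mul, map_pow, mul_assoc, mul_assoc]
      calc γ * (v (∏ i ∈ range (2 * k), towerGen q n x (i + 1) ^ e i) *
            (v (towerGen q n x (2 * k + 1)) ^ e (2 * k) * v (x (2 * k + 1))))
          ≤ γ * (1 * v (x (2 * k + 1)) ^ q) := by
            gcongr
            · exact h1 _ le_rfl (by omega)
            · exact hstep (2 * k + 1) (by omega) hn
        _ ≤ 1 := by rwa [one_mul, mul_comm]
    | succ m ih =>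
      intro hn
      have ih := ih (by omega)
      rw [← add_assoc, prod_range_succ, map_mul, map_pow, ← mul_assoc, mul_assoc]
      refine le_trans ?_ ih
      gcongr
      rw [← h.pow_succ_eq (i := 2 * k + 1 + m) (by omega) (by omega)]
      exact hstep (2 * k + 1 + m + 1) (by omega) (by omega)
  by_cases hn : n - 1 ≤ 2 * k
  · exact mul_le_one' h.γ_lt_one.le (h1 _ hn (by have := h.lt; omega))
  · obtain ⟨m, hm⟩ : ∃ m, n - 1 = 2 * k + 1 + m := ⟨n - 1 - (2 * k + 1), by omega⟩
    rw [hm]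
    exact (le_mul_of_one_le_right' (h.one_lt (by omega) (by omega)).le).trans (h2 m (by omega))

end IsZeroOfType

/-- `(x 0 ^ q + x 0) * ∏ U_i ^ e_i` is integral over the polynomials in `x 0`. -/
theorem IsTower.map_mul_prod_le {L Γ : Type*} [Field L] [LinearOrderedCommGroupWithZero Γ]
    {q n : ℕ} {x : ℕ → L} (hx : IsTower q n x) (v : Valuation L Γ) (h0 : v (x 0) ≤ 1)
    (hn : 0 < n) {e : ℕ → ℕ} (he : ∀ i, e i < q) :
    v ((x 0 ^ q + x 0) * ∏ i ∈ range (n - 1), towerGen q n x (i + 1) ^ e i) ≤ 1 := by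
  have hq := hx.two_le
  rw [map_mul]
  set γ := v (x 0 ^ q + x 0) with hγ
  have hγ0 : γ ≠ 0 := v.ne_zero_iff.2 (hx.tr_ne_zero 0 hn)
  have hγ1 : γ ≤ 1 := by
    refine (v.map_add _ _).trans (max_le ?_ h0)
    rw [map_pow]
    exact pow_le_one₀ zero_le h0
  rcases hγ1.lt_or_eq with hlt | heq
  · by_cases hall : ∀ i < n, v (x i) < 1
    · have h1 : ∀ i < n, v (x i) = γ ^ q ^ i := by
        intro i hi
        rw [← v.map_tr_of_lt_one hq (hall i hi)]
        exact hx.map_of_forall_lt v (k := i) (fun j hj => hall j (by omega)) i le_rfl hi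
      have hpos : ∀ i, 0 < q ^ i := fun i => pow_pos (by omega) i
      refine mul_le_one' hγ1 (hx.map_prod_le_of_le_one v hγ0 hγ1 (fun i hi => (hall i hi).le) ?_ ?_ e)
      · intro i hi
        rw [h1 i hi]
        exact pow_le_pow_right_of_le_one' hγ1 (Nat.pow_le_pow_right (by omega) hi.le)
      · intro κ hκ
        have h2 : v (towerIdem q x κ) ≤ γ := by
          rw [towerIdem, map_mul, Valuation.map_neg, map_pow, h1 κ hκ, map_prod,
            prod_eq_one, mul_one, ← pow_mul]
          · have h3 : 0 < q - 1 := by omega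
            exact pow_le_of_le_one zero_le hγ1 (Nat.mul_pos (hpos κ) h3).ne'
          · intro l hl
            rw [mem_range] at hl
            refine v.map_one_add_of_lt ?_
            rw [map_pow]
            exact pow_lt_one₀ zero_le (hall l (by omega)) (by omega)
        exact (pow_le_pow_left₀ zero_le h2 _).trans (pow_le_of_le_one zero_le hγ1 (hpos n).ne')
    · push Not at hall
      classical
      obtain ⟨hk, hk1⟩ := Nat.find_spec hall
      set k := Nat.find hall with hkdef
      have hmin : ∀ i < k, v (x i) < 1 := by
        intro i hi
        by_contra! h1
        exact Nat.find_min hall hi ⟨by omega, h1⟩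
      have htr := hx.map_of_forall_lt v hmin
      have h2 : IsZeroOfType q n x v γ k :=
        { toIsTower := hx
          lt := hk
          γ_ne_zero := hγ0
          γ_lt_one := hlt
          map_of_lt := fun i hi => by
            rw [← v.map_tr_of_lt_one hq (hmin i hi)]
            exact htr i hi.le (by omega)
          map_self := by
            refine le_antisymm (v.le_one_of_tr_le_one hq ?_) hk1
            rw [htr k le_rfl hk]
            exact pow_le_one₀ zero_le hγ1
          map_tr := htr k le_rfl hk }
      exact h2.mul_map_prod_le he
  · have h1 := hx.map_eq_one_of_tr v heq
    rw [heq, one_mul]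
    refine hx.map_prod_le_of_le_one v hγ0 hγ1 (fun i hi => (h1 i hi).1.le) ?_ ?_ e
    · intro i hi
      rw [(h1 i hi).1]
      exact pow_le_one₀ zero_le hγ1
    · intro κ hκ
      have h2 : v (towerIdem q x κ) = 1 := by
        rw [towerIdem, map_mul, Valuation.map_neg, map_pow, (h1 κ hκ).1, map_prod,
          prod_eq_one, mul_one, one_pow]
        intro l hl
        rw [mem_range] at hl
        have h3 := congrArg v (hx.one_add_pow_mul l)
        rwa [map_mul, (h1 l (by omega)).1, (h1 l (by omega)).2, mul_one] at h3
      rw [h2, one_pow, heq]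

theorem isIntegral_of_forall_valuation_le_one {L : Type*} [Field L] (R : Subring L) {f : L}
    (h : ∀ A : ValuationSubring L, (∀ r ∈ R, A.valuation r ≤ 1) → A.valuation f ≤ 1) :
    IsIntegral R f := by
  have h1 := iInf_valuationSubring_superset (s := (R : Set L))
  rw [Subring.closure_eq] at h1
  have h2 : f ∈ (integralClosure R L).toSubring := by
    rw [← h1, Subring.mem_iInf]
    rintro ⟨A, hA⟩
    exact (A.valuation_le_one_iff f).1 (h A fun r hr => (A.valuation_le_one_iff r).2 (hA hr))
  exact h2

theorem IsTower.isIntegral_mul_prod {k L : Type*} [Field k] [Field L] [Algebra k L] {q n : ℕ}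
    {x : ℕ → L} (hx : IsTower q n x) (hn : 0 < n) {e : ℕ → ℕ} (he : ∀ i, e i < q) :
    IsIntegral (Algebra.adjoin k {x 0})
      ((x 0 ^ q + x 0) * ∏ i ∈ range (n - 1), towerGen q n x (i + 1) ^ e i) := by
  refine isIntegral_of_forall_valuation_le_one (Algebra.adjoin k {x 0}).toSubring fun A hA => ?_
  exact hx.map_mul_prod_le A.valuation (hA _ (Algebra.self_mem_adjoin_singleton k _)) hn he

/-- The Artin-Schreier type polynomial `X ^ q + X - c`. -/
noncomputable def trPoly {R : Type*} [CommRing R] (q : ℕ) (c : R) : Polynomial R :=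
  Polynomial.X ^ q + (Polynomial.X - Polynomial.C c)

theorem aeval_trPoly {R : Type*} [CommRing R] {q : ℕ} {A : Type*} [CommRing A] [Algebra R A]
    (c : R) (y : A) :
    Polynomial.aeval y (trPoly q c) = y ^ q + y - algebraMap R A c := by
  simp [trPoly, add_sub_assoc]

section

variable {R : Type*} [CommRing R] [Nontrivial R] {q : ℕ}

theorem trPoly_degree_lt (hq : 2 ≤ q) (c : R) :
    (Polynomial.X - Polynomial.C c).degree < (q : WithBot ℕ) := by
  rw [Polynomial.degree_X_sub_C]
  exact_mod_cast hq

theorem trPoly_monic (hq : 2 ≤ q) (c : R) : (trPoly q c).Monic :=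
  Polynomial.monic_X_pow_add (trPoly_degree_lt hq c)

theorem trPoly_natDegree (hq : 2 ≤ q) (c : R) : (trPoly q c).natDegree = q := by
  apply Polynomial.natDegree_eq_of_degree_eq_some
  rw [trPoly, Polynomial.degree_add_eq_left_of_degree_lt, Polynomial.degree_X_pow]
  rw [Polynomial.degree_X_pow]
  exact trPoly_degree_lt hq c

theorem natDegree_modByMonic_trPoly_lt (hq : 2 ≤ q) (c : R) (P : Polynomial R) :
    (P %ₘ trPoly q c).natDegree < q := by
  conv_rhs => rw [← trPoly_natDegree hq c]
  refine Polynomial.natDegree_modByMonic_lt P (trPoly_monic hq c) fun h => ?_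
  have := trPoly_natDegree hq c
  rw [h, Polynomial.natDegree_one] at this
  omega

theorem aeval_modByMonic_trPoly (hq : 2 ≤ q) {A : Type*} [CommRing A] [Algebra R A] {c : R} {y : A}
    (h : y ^ q + y = algebraMap R A c) (P : Polynomial R) :
    Polynomial.aeval y P = ∑ e ∈ range q, (P %ₘ trPoly q c).coeff e • y ^ e := by
  rw [← Polynomial.aeval_eq_sum_range' (natDegree_modByMonic_trPoly_lt hq c P)]
  conv_lhs => rw [← Polynomial.modByMonic_add_div P (trPoly q c)]
  rw [map_add, map_mul, aeval_trPoly, h, sub_self, zero_mul, add_zero]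

end

/-- The algebra generated by `x 0, ..., x i` and the inverse of `x 0 ^ q + x 0`. -/
noncomputable def towerAlg (k : Type*) {L : Type*} [Field k] [Field L] [Algebra k L] (q : ℕ)
    (x : ℕ → L) : ℕ → Subalgebra k L
  | 0 => Algebra.adjoin k {x 0, (x 0 ^ q + x 0)⁻¹}
  | i + 1 => (Algebra.adjoin (towerAlg k q x i) {x (i + 1)}).restrictScalars k

section

variable {k L : Type*} [Field k] [Field L] [Algebra k L] {q n : ℕ} {x : ℕ → L}

theorem towerAlg_le_succ (i : ℕ) : towerAlg k q x i ≤ towerAlg k q x (i + 1) := by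
  intro f hf
  exact (Algebra.adjoin (towerAlg k q x i) {x (i + 1)}).algebraMap_mem ⟨f, hf⟩

theorem towerAlg_mono : Monotone (towerAlg k q x) := monotone_nat_of_le_succ towerAlg_le_succ

theorem mem_towerAlg {i l : ℕ} (h : i ≤ l) : x i ∈ towerAlg k q x l := by
  refine towerAlg_mono h ?_
  cases i with
  | zero => exact Algebra.subset_adjoin (by simp)
  | succ i => exact Algebra.self_mem_adjoin_singleton (towerAlg k q x i) _

theorem inv_mem_towerAlg (l : ℕ) : (x 0 ^ q + x 0)⁻¹ ∈ towerAlg k q x l :=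
  towerAlg_mono (Nat.zero_le l) (Algebra.subset_adjoin (by simp))

namespace IsTower

theorem tr_inv_mem (hx : IsTower q n x) (i : ℕ) (hi : i < n) :
    (x i ^ q + x i)⁻¹ ∈ towerAlg k q x i ∧ (x i)⁻¹ ∈ towerAlg k q x i := by
  have key : ∀ i < n, (x i ^ q + x i)⁻¹ ∈ towerAlg k q x i → (x i)⁻¹ ∈ towerAlg k q x i := by
    intro i hi h
    have : (x i)⁻¹ = (1 + x i ^ (q - 1)) * (x i ^ q + x i)⁻¹ := by
      rw [eq_mul_inv_iff_mul_eq₀ (hx.tr_ne_zero i hi), ← hx.one_add_pow_mul]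
      field_simp [hx.ne_zero i hi]
    rw [this]
    exact mul_mem (add_mem (one_mem _) (pow_mem (mem_towerAlg le_rfl) _)) h
  induction i with
  | zero => exact ⟨inv_mem_towerAlg 0, key 0 hi (inv_mem_towerAlg 0)⟩
  | succ i ih =>
    have h1 := ih (by omega)
    suffices h : (x (i + 1) ^ q + x (i + 1))⁻¹ ∈ towerAlg k q x (i + 1) from ⟨h, key _ hi h⟩
    have : (x (i + 1) ^ q + x (i + 1))⁻¹ = (x i ^ q + x i) * (x i)⁻¹ ^ (q + 1) := by
      rw [inv_pow, ← hx.rel i hi, mul_inv]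
      field_simp [hx.tr_ne_zero i (by omega)]
    rw [this]
    have hm : x i ∈ towerAlg k q x (i + 1) := mem_towerAlg (by omega)
    exact mul_mem (add_mem (pow_mem hm _) hm) (pow_mem (towerAlg_le_succ i h1.2) _)

/-- The constant term of the equation of `x (i + 1)` over the previous step. -/
theorem exists_rel (hx : IsTower q n x) {i : ℕ} (hi : i + 1 < n) :
    x (i + 1) ^ q + x (i + 1) = x i ^ (q + 1) * (x i ^ q + x i)⁻¹ := by
  rw [eq_mul_inv_iff_mul_eq₀ (hx.tr_ne_zero i (by omega)), hx.rel i hi]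

theorem towerGen_sub_mem (hx : IsTower q n x) {i : ℕ} (hi : i < n) :
    towerGen q n x (i + 1) - x (i + 1) ∈ towerAlg k q x i := by
  rw [towerGen, sub_sub_cancel_left]
  refine neg_mem (sum_mem fun κ hκ => ?_)
  rw [mem_filter, mem_range] at hκ
  rw [div_eq_mul_inv]
  refine mul_mem (mul_mem (pow_mem ?_ _) (pow_mem (mem_towerAlg (by omega)) _)) ?_
  · refine mul_mem (neg_mem (pow_mem (mem_towerAlg (by omega)) _)) (prod_mem fun l hl => ?_)
    rw [mem_range] at hl
    exact add_mem (one_mem _) (pow_mem (mem_towerAlg (by omega)) _)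
  · exact towerAlg_mono (show 2 * κ - (i + 1) ≤ i by omega) (hx.tr_inv_mem _ (by omega)).2

theorem rel_const_mem (hx : IsTower q n x) {i : ℕ} (hi : i < n) :
    x i ^ (q + 1) * (x i ^ q + x i)⁻¹ ∈ towerAlg k q x i :=
  mul_mem (pow_mem (mem_towerAlg le_rfl) _) (hx.tr_inv_mem i hi).1

/-- Elements of a step of the tower as polynomials of degree less than `q` in the last generator. -/
theorem exists_eq_sum (hx : IsTower q n x) {i : ℕ} (hi : i + 1 < n) {f : L}
    (hf : f ∈ towerAlg k q x (i + 1)) :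
    ∃ c : ℕ → L, (∀ e, c e ∈ towerAlg k q x i) ∧ f = ∑ e ∈ range q, c e * x (i + 1) ^ e := by
  have hf' : f ∈ Algebra.adjoin (towerAlg k q x i) {x (i + 1)} := hf
  rw [Algebra.adjoin_singleton_eq_range_aeval] at hf'
  obtain ⟨P, rfl⟩ := hf'
  exact ⟨_, fun e => Subtype.property _,
    aeval_modByMonic_trPoly hx.two_le (c := ⟨_, hx.rel_const_mem (by omega)⟩) (hx.exists_rel hi) P⟩

end IsTower
end

/-- The coefficientwise algebra structure, preferred over the one through power series. -/
noncomputable instance laurentAlgebra (k : Type*) [Field k] : Algebra k (LaurentSeries k) :=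
  HahnSeries.instAlgebra

namespace HahnSeries

variable {k ι : Type*} [Field k]

theorem order_smul {c : k} (hc : c ≠ 0) (f : LaurentSeries k) : order (c • f) = order f := by
  by_cases hf : f = 0
  · rw [hf, smul_zero]
  · rw [← C_mul_eq_smul, order_mul ((map_ne_zero_iff C C_injective).2 hc) hf, order_C, zero_add]

theorem order_add_of_lt {f g : LaurentSeries k} (hf : f ≠ 0) (hg : g ≠ 0)
    (h : order f < order g) : order (f + g) = order f := by
  have h1 : (f + g).orderTop = f.orderTop := by
    apply orderTop_add_eq_left
    rw [← order_eq_orderTop_of_ne_zero hf, ← order_eq_orderTop_of_ne_zero hg]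
    exact_mod_cast h
  have h2 : f + g ≠ 0 := by
    rw [← orderTop_ne_top, h1]
    exact orderTop_ne_top.2 hf
  rw [← order_eq_orderTop_of_ne_zero hf, ← order_eq_orderTop_of_ne_zero h2] at h1
  exact_mod_cast h1

/-- A sum of nonzero series with pairwise distinct orders does not cancel. -/
theorem order_sum_of_injOn {s : Finset ι} (hs : s.Nonempty) {f : ι → LaurentSeries k}
    (h0 : ∀ j ∈ s, f j ≠ 0) (hinj : Set.InjOn (fun j => order (f j)) s) :
    ∑ j ∈ s, f j ≠ 0 ∧ ∃ j ∈ s, order (∑ j ∈ s, f j) = order (f j) := by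
  obtain ⟨j, hj, hmin⟩ := s.exists_min_image (fun j => order (f j)) hs
  have hc : (∑ j ∈ s, f j).coeff (order (f j)) = (f j).coeff (order (f j)) := by
    rw [coeff_sum]
    refine sum_eq_single_of_mem j hj fun b hb hbj => coeff_eq_zero_of_lt_order ?_
    exact lt_of_le_of_ne (hmin b hb) fun h => hbj (hinj hb hj h.symm)
  have hc0 : (∑ j ∈ s, f j).coeff (order (f j)) ≠ 0 := by
    rw [hc]
    exact fun h => h0 j hj (coeff_order_eq_zero.1 h)
  have hne : ∑ j ∈ s, f j ≠ 0 := fun h => hc0 (by rw [h]; rfl)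
  refine ⟨hne, j, hj, le_antisymm (order_le_of_coeff_ne_zero hc0) ?_⟩
  rw [le_order_iff_forall hne]
  intro b hb
  rw [coeff_sum]
  exact sum_eq_zero fun a ha => coeff_eq_zero_of_lt_order (hb.trans_le (hmin a ha))

theorem order_sum_mul_pow {y : LaurentSeries k} {u q : ℕ} (hu : 0 < u) (hy0 : y ≠ 0)
    (hy : order y = -(u : ℤ)) {f : ℕ → LaurentSeries k}
    (hf : ∀ e < q, f e ≠ 0 → ((q * u : ℕ) : ℤ) ∣ order (f e)) (h : ∃ e < q, f e ≠ 0) :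
    ∑ e ∈ range q, f e * y ^ e ≠ 0 ∧
      ∃ e < q, f e ≠ 0 ∧ order (∑ e ∈ range q, f e * y ^ e) = order (f e) - e * u := by
  classical
  have hsum : ∑ e ∈ range q, f e * y ^ e = ∑ e ∈ range q with f e ≠ 0, f e * y ^ e := by
    rw [sum_filter]
    refine sum_congr rfl fun e _ => ?_
    by_cases h : f e = 0 <;> simp [h]
  have hord : ∀ e, f e ≠ 0 → order (f e * y ^ e) = order (f e) - e * u := by
    intro e he
    rw [order_mul he (pow_ne_zero _ hy0), order_pow, hy]
    simp [sub_eq_add_neg]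
  rw [hsum]
  suffices h : _ ∧ ∃ e ∈ {e ∈ range q | f e ≠ 0}, _ = order (f e * y ^ e) by
    obtain ⟨h1, e, he, h2⟩ := h
    rw [mem_filter, mem_range] at he
    exact ⟨h1, e, he.1, he.2, h2.trans (hord e he.2)⟩
  refine order_sum_of_injOn ?_ ?_ ?_
  · obtain ⟨e, he, he'⟩ := h
    exact ⟨e, by simp [he, he']⟩
  · intro e he
    rw [mem_filter] at he
    exact mul_ne_zero he.2 (pow_ne_zero _ hy0)
  · intro a ha b hb hab
    simp only [coe_filter, mem_range, Set.mem_ofPred_eq] at ha hb hab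
    rw [hord a ha.2, hord b hb.2] at hab
    obtain ⟨A, hA⟩ := hf a ha.1 ha.2
    obtain ⟨B, hB⟩ := hf b hb.1 hb.2
    rw [hA, hB] at hab
    have h3 : (q : ℤ) * A - a = q * B - b := by
      have : (u : ℤ) ≠ 0 := by exact_mod_cast hu.ne'
      apply mul_right_cancel₀ this
      push_cast at hab
      linarith
    have h4 : (q : ℤ) ∣ (a : ℤ) - b := ⟨A - B, by linarith⟩
    have h5 : (a : ℤ) - b = 0 := by
      refine Int.eq_zero_of_abs_lt_dvd h4 ?_
      rw [abs_lt]
      constructor <;> omega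
    omega

end HahnSeries

/-- The tower inside the field of Laurent series at its totally ramified pole. -/
structure IsLaurentTower {k : Type*} [Field k] (q n : ℕ) (x : ℕ → LaurentSeries k) : Prop
    extends IsTower q n x where
  order_eq : ∀ i < n, HahnSeries.order (x i) = -((q ^ (n - 1 - i) : ℕ) : ℤ)

theorem exists_pow_mul_mem_adjoin {k L : Type*} [Field k] [Field L] [Algebra k L] {q : ℕ}
    {x : ℕ → L} (h0 : x 0 ^ q + x 0 ≠ 0) {f : L} (hf : f ∈ towerAlg k q x 0) :
    ∃ N : ℕ, (x 0 ^ q + x 0) ^ N * f ∈ Algebra.adjoin k {x 0} := by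
  have hx0 : x 0 ∈ Algebra.adjoin k {x 0} := Algebra.self_mem_adjoin_singleton k _
  have hh : x 0 ^ q + x 0 ∈ Algebra.adjoin k {x 0} := add_mem (pow_mem hx0 _) hx0
  induction hf using Algebra.adjoin_induction with
  | mem y hy =>
    rcases hy with rfl | rfl
    · exact ⟨0, by simp⟩
    · exact ⟨1, by rw [pow_one, mul_inv_cancel₀ h0]; exact one_mem _⟩
  | algebraMap r => exact ⟨0, by rw [pow_zero, one_mul]; exact Subalgebra.algebraMap_mem _ r⟩
  | add a b _ _ iha ihb =>
    obtain ⟨M, hM⟩ := iha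
    obtain ⟨N, hN⟩ := ihb
    refine ⟨M + N, ?_⟩
    have : (x 0 ^ q + x 0) ^ (M + N) * (a + b) =
        (x 0 ^ q + x 0) ^ N * ((x 0 ^ q + x 0) ^ M * a) +
          (x 0 ^ q + x 0) ^ M * ((x 0 ^ q + x 0) ^ N * b) := by ring
    rw [this]
    exact add_mem (mul_mem (pow_mem hh _) hM) (mul_mem (pow_mem hh _) hN)
  | mul a b _ _ iha ihb =>
    obtain ⟨M, hM⟩ := iha
    obtain ⟨N, hN⟩ := ihb
    refine ⟨M + N, ?_⟩
    have : (x 0 ^ q + x 0) ^ (M + N) * (a * b) =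
        ((x 0 ^ q + x 0) ^ M * a) * ((x 0 ^ q + x 0) ^ N * b) := by ring
    rw [this]
    exact mul_mem hM hN

namespace IsLaurentTower

open HahnSeries

variable {k : Type*} [Field k] {q n : ℕ} {x : ℕ → LaurentSeries k}

theorem order_tr (hx : IsLaurentTower q n x) (hn : 0 < n) :
    order (x 0 ^ q + x 0) = -((q ^ n : ℕ) : ℤ) := by
  have hq := hx.two_le
  have h0 := hx.ne_zero 0 hn
  have h1 : order (x 0) = -((q ^ (n - 1) : ℕ) : ℤ) := by simpa using hx.order_eq 0 hn
  have h2 : order (x 0 ^ q) = -((q ^ n : ℕ) : ℤ) := by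
    rw [order_pow, h1, nsmul_eq_mul, mul_neg, ← Nat.cast_mul, ← pow_succ', Nat.sub_add_cancel hn]
  rw [order_add_of_lt (pow_ne_zero _ h0) h0, h2]
  rw [h1, h2, neg_lt_neg_iff]
  exact_mod_cast Nat.pow_lt_pow_right hq (by omega)

theorem aeval_ne_zero_and_dvd_order (hx : IsLaurentTower q n x) (hn : 0 < n) {P : Polynomial k}
    (hP : P ≠ 0) : Polynomial.aeval (x 0) P ≠ 0 ∧
      ((q ^ (n - 1) : ℕ) : ℤ) ∣ order (Polynomial.aeval (x 0) P) := by
  have hq := hx.two_le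
  have h1 : order (x 0) = -((q ^ (n - 1) : ℕ) : ℤ) := by simpa using hx.order_eq 0 hn
  rw [Polynomial.aeval_def, Polynomial.eval₂_eq_sum, Polynomial.sum]
  simp_rw [← Algebra.smul_def]
  have hord : ∀ j ∈ P.support, order (P.coeff j • x 0 ^ j) = -(j * (q ^ (n - 1) : ℕ) : ℤ) := by
    intro j hj
    rw [order_smul (Polynomial.mem_support_iff.1 hj), order_pow, h1, nsmul_eq_mul, mul_neg]
  obtain ⟨h0, j, hj, h2⟩ := order_sum_of_injOn (Polynomial.support_nonempty.2 hP)
    (f := fun j => P.coeff j • x 0 ^ j)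
    (fun j hj => smul_ne_zero (Polynomial.mem_support_iff.1 hj) (pow_ne_zero _ (hx.ne_zero 0 hn)))
    (by
      intro a ha b hb hab
      simp only [hord a ha, hord b hb, neg_inj] at hab
      have : q ^ (n - 1) ≠ 0 := by positivity
      exact_mod_cast mul_right_cancel₀ (by exact_mod_cast this) hab)
  refine ⟨h0, dvd_trans ?_ (dvd_of_eq (h2.trans (hord j hj)).symm)⟩
  exact dvd_neg.2 (dvd_mul_left _ _)

theorem order_adjoin (hx : IsLaurentTower q n x) (hn : 0 < n) {f : LaurentSeries k} (hf0 : f ≠ 0)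
    (hf : f ∈ Algebra.adjoin k {x 0}) : ((q ^ (n - 1) : ℕ) : ℤ) ∣ order f := by
  rw [Algebra.adjoin_singleton_eq_range_aeval] at hf
  obtain ⟨P, rfl⟩ := hf
  exact (hx.aeval_ne_zero_and_dvd_order hn fun h => hf0 (by rw [h]; simp)).2

theorem dvd_order (hx : IsLaurentTower q n x) {i : ℕ} (hi : i < n) {f : LaurentSeries k}
    (hf0 : f ≠ 0) (hf : f ∈ towerAlg k q x i) : ((q ^ (n - 1 - i) : ℕ) : ℤ) ∣ order f := by
  have hq := hx.two_le
  induction i generalizing f with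
  | zero =>
    have h0 := hx.tr_ne_zero 0 hi
    obtain ⟨N, hN⟩ := exists_pow_mul_mem_adjoin h0 hf
    have h1 := hx.order_adjoin hi (mul_ne_zero (pow_ne_zero _ h0) hf0) hN
    rw [order_mul (pow_ne_zero _ h0) hf0, order_pow, hx.order_tr hi] at h1
    refine (dvd_add_right ?_).1 h1
    rw [nsmul_eq_mul]
    refine dvd_mul_of_dvd_right (dvd_neg.2 ?_) _
    exact_mod_cast pow_dvd_pow q (by omega)
  | succ i ih =>
    obtain ⟨c, hc, rfl⟩ := hx.exists_eq_sum hi hf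
    have h1 : q * q ^ (n - 1 - (i + 1)) = q ^ (n - 1 - i) := by
      rw [← pow_succ']; congr 1; omega
    obtain ⟨-, e, he, hce, h2⟩ := order_sum_mul_pow (f := c) (q := q) (u := q ^ (n - 1 - (i + 1)))
      (by positivity) (hx.ne_zero _ hi) (hx.order_eq _ hi)
      (fun e _ hce => by rw [h1]; exact ih (by omega) hce (hc e)) (by
        by_contra! h
        exact hf0 (sum_eq_zero fun e he => by rw [h e (mem_range.1 he), zero_mul]))
    rw [h2]
    refine dvd_sub ((Int.natCast_dvd_natCast.2 ?_).trans (ih (by omega) hce (hc e)))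
      (dvd_mul_left _ _)
    exact pow_dvd_pow q (by omega)

/-- The powers of a generator are independent over the previous step. -/
theorem eq_zero_of_sum_eq_zero (hx : IsLaurentTower q n x) {i : ℕ} (hi : i + 1 < n)
    {c : ℕ → LaurentSeries k} (hc : ∀ e, c e ∈ towerAlg k q x i)
    (h : ∑ e ∈ range q, c e * x (i + 1) ^ e = 0) : ∀ e < q, c e = 0 := by
  have hq := hx.two_le
  by_contra! hne
  have h1 : q * q ^ (n - 1 - (i + 1)) = q ^ (n - 1 - i) := by
    rw [← pow_succ']; congr 1; omega
  exact (order_sum_mul_pow (f := c) (q := q) (u := q ^ (n - 1 - (i + 1)))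
    (by positivity) (hx.ne_zero _ hi) (hx.order_eq _ hi)
    (fun e _ hce => by rw [h1]; exact hx.dvd_order (by omega) hce (hc e)) hne).1 h

end IsLaurentTower

/-- The monomials in `x 1, ..., x (n - 1)` with exponents less than `q`, enumerated by the
base `q` digits of the exponents. -/
def towerMon {L : Type*} [Field L] (q n : ℕ) (x : ℕ → L) (a : ℕ) : L :=
  ∏ i ∈ range (n - 1), x (i + 1) ^ (a / q ^ i % q)

/-- The span of the first `a` monomials over the bottom step of the tower. -/
noncomputable def towerSpan (k : Type*) {L : Type*} [Field k] [Field L] [Algebra k L] (q n : ℕ)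
    (x : ℕ → L) (a : ℕ) : Submodule (towerAlg k q x 0) L :=
  Submodule.span _ (towerMon q n x '' Set.Iio a)

section

variable {k L : Type*} [Field k] [Field L] [Algebra k L] {q n : ℕ} {x : ℕ → L}

theorem towerMon_zero : towerMon q n x 0 = 1 := by simp [towerMon]

theorem towerMon_mul_add {i e a : ℕ} (hi : i + 1 < n) (he : e < q) (ha : a < q ^ i) :
    towerMon q n x (e * q ^ i + a) = x (i + 1) ^ e * towerMon q n x a := by
  have hq : 0 < q := by omega
  have h1 : x (i + 1) ^ e = ∏ l ∈ range (n - 1), if l = i then x (i + 1) ^ e else 1 := by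
    rw [prod_ite_eq' (range (n - 1)) i, if_pos (by rw [mem_range]; omega)]
  rw [h1, towerMon, towerMon, ← prod_mul_distrib]
  refine prod_congr rfl fun l _ => ?_
  rcases lt_trichotomy l i with hl | rfl | hl
  · rw [if_neg hl.ne, one_mul]
    congr 1
    obtain ⟨d, rfl⟩ := Nat.exists_eq_add_of_lt hl
    rw [show e * q ^ (l + d + 1) + a = a + q ^ l * (q * (e * q ^ d)) by ring,
      Nat.add_mul_div_left _ _ (by positivity), Nat.add_mul_mod_self_left]
  · rw [if_pos rfl, Nat.div_eq_of_lt ha, Nat.zero_mod, pow_zero, mul_one, mul_comm e,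
      Nat.mul_add_div (by positivity), Nat.div_eq_of_lt ha, add_zero, Nat.mod_eq_of_lt he]
  · rw [if_neg hl.ne', one_mul]
    have h2 : q ^ (i + 1) ≤ q ^ l := Nat.pow_le_pow_right hq hl
    have h3 : e * q ^ i + a < q ^ (i + 1) := by
      have : (e + 1) * q ^ i ≤ q * q ^ i := Nat.mul_le_mul_right _ he
      rw [pow_succ']
      linarith
    have h4 : q ^ i ≤ q ^ l := Nat.pow_le_pow_right hq hl.le
    rw [Nat.div_eq_of_lt (h3.trans_le h2), Nat.div_eq_of_lt (ha.trans_le h4)]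

theorem towerSpan_mono {a b : ℕ} (h : a ≤ b) : towerSpan k q n x a ≤ towerSpan k q n x b :=
  Submodule.span_mono (Set.image_mono (Set.Iio_subset_Iio h))

theorem towerMon_mem {a b : ℕ} (h : a < b) : towerMon q n x a ∈ towerSpan k q n x b :=
  Submodule.subset_span ⟨a, h, rfl⟩

theorem pow_mul_mem_towerSpan {i e a : ℕ} (hi : i + 1 < n) (he : e < q) (ha : a ≤ q ^ i) {f : L}
    (hf : f ∈ towerSpan k q n x a) : x (i + 1) ^ e * f ∈ towerSpan k q n x (e * q ^ i + a) := by
  induction hf using Submodule.span_induction with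
  | mem y hy =>
    obtain ⟨b, hb, rfl⟩ := hy
    rw [Set.mem_Iio] at hb
    rw [← towerMon_mul_add hi he (hb.trans_le ha)]
    exact towerMon_mem (by omega)
  | zero => rw [mul_zero]; exact zero_mem _
  | add y z _ _ hy hz => rw [mul_add]; exact add_mem hy hz
  | smul c y _ hy => rw [mul_smul_comm]; exact Submodule.smul_mem _ _ hy

theorem sum_mem_towerSpan {i e : ℕ} (hi : i + 1 < n) (he : e ≤ q) {c : ℕ → L}
    (hc : ∀ l < e, c l ∈ towerSpan k q n x (q ^ i)) :
    ∑ l ∈ range e, c l * x (i + 1) ^ l ∈ towerSpan k q n x (e * q ^ i) := by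
  refine sum_mem fun l hl => ?_
  rw [mem_range] at hl
  rw [mul_comm (c l)]
  refine towerSpan_mono ?_ (pow_mul_mem_towerSpan hi (hl.trans_le he) le_rfl (hc l hl))
  rw [← Nat.succ_mul]
  exact Nat.mul_le_mul_right _ hl

namespace IsTower

theorem mem_towerSpan (hx : IsTower q n x) {i : ℕ} (hi : i < n) {f : L}
    (hf : f ∈ towerAlg k q x i) : f ∈ towerSpan k q n x (q ^ i) := by
  induction i generalizing f with
  | zero =>
    have : f = (⟨f, hf⟩ : towerAlg k q x 0) • towerMon q n x 0 := by
      rw [towerMon_zero]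
      exact (mul_one f).symm
    rw [this]
    exact Submodule.smul_mem _ _ (towerMon_mem (by simp))
  | succ i ih =>
    obtain ⟨c, hc, rfl⟩ := hx.exists_eq_sum hi hf
    rw [pow_succ']
    exact sum_mem_towerSpan hi le_rfl fun e _ => ih (by omega) (hc e)

/-- The modified monomials are a unitriangular transform of the monomials. -/
theorem towerMon_towerGen_sub_mem (hx : IsTower q n x) {i : ℕ} (hi : i < n) {a : ℕ}
    (ha : a < q ^ i) :
    towerMon q n (towerGen q n x) a ∈ towerAlg k q x i ∧
      towerMon q n (towerGen q n x) a - towerMon q n x a ∈ towerSpan k q n x a := by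
  have hq := hx.two_le
  induction i generalizing a with
  | zero =>
    obtain rfl : a = 0 := by simpa using ha
    rw [towerMon_zero, towerMon_zero, sub_self]
    exact ⟨one_mem _, zero_mem _⟩
  | succ i ih =>
    obtain ⟨e, b, he, hb, rfl⟩ : ∃ e b, e < q ∧ b < q ^ i ∧ a = e * q ^ i + b := by
      refine ⟨a / q ^ i, a % q ^ i, ?_, Nat.mod_lt _ (by positivity), (Nat.div_add_mod' _ _).symm⟩
      rw [Nat.div_lt_iff_lt_mul (by positivity), ← pow_succ']
      exact ha
    obtain ⟨h1, h2⟩ := ih (by omega) hb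
    have hδ : towerGen q n x (i + 1) - x (i + 1) ∈ towerAlg k q x i :=
      hx.towerGen_sub_mem (by omega)
    set δ := towerGen q n x (i + 1) - x (i + 1) with hδ'
    have hgen : towerGen q n x (i + 1) = x (i + 1) + δ := by rw [hδ']; ring
    rw [towerMon_mul_add hi he hb, towerMon_mul_add hi he hb]
    constructor
    · refine mul_mem (pow_mem ?_ _) (towerAlg_le_succ i h1)
      rw [hgen]
      exact add_mem (mem_towerAlg le_rfl) (towerAlg_le_succ i hδ)
    · have h3 : towerGen q n x (i + 1) ^ e * towerMon q n (towerGen q n x) b -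
          x (i + 1) ^ e * towerMon q n x b =
          ∑ l ∈ range e, (δ ^ (e - l) * (e.choose l : L) * towerMon q n (towerGen q n x) b) *
            x (i + 1) ^ l +
          x (i + 1) ^ e * (towerMon q n (towerGen q n x) b - towerMon q n x b) := by
        rw [hgen, _root_.add_pow, sum_range_succ, add_mul, sum_mul]
        simp only [Nat.sub_self, pow_zero, Nat.choose_self, Nat.cast_one, mul_one]
        rw [mul_sub, add_sub_assoc]
        congr 1
        exact sum_congr rfl fun l _ => by ring
      rw [h3]
      refine add_mem (towerSpan_mono (Nat.le_add_right _ _)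
        (sum_mem_towerSpan hi he.le fun l _ => hx.mem_towerSpan (by omega) ?_))
        (pow_mul_mem_towerSpan hi he hb.le h2)
      exact mul_mem (mul_mem (pow_mem hδ _) (natCast_mem _ _)) h1

end IsTower
end

theorem Submodule.finrank_le_finrank_inf_add {k V : Type*} [Field k] [AddCommGroup V] [Module k V]
    (T A Q : Submodule k V) [FiniteDimensional k T] [FiniteDimensional k Q] (h : T ≤ A ⊔ Q) :
    Module.finrank k T ≤ Module.finrank k (T ⊓ A : Submodule k V) + Module.finrank k Q := by
  let f : T →ₗ[k] V ⧸ A := A.mkQ.domRestrict T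
  have h1 := LinearMap.finrank_range_add_finrank_ker f
  have h2 : Module.finrank k (LinearMap.ker f) ≤ Module.finrank k (T ⊓ A : Submodule k V) := by
    have hle : (LinearMap.ker f).map T.subtype ≤ T ⊓ A := by
      rintro _ ⟨y, hy, rfl⟩
      exact ⟨y.2, (Submodule.Quotient.mk_eq_zero A).1 (LinearMap.mem_ker.1 hy)⟩
    rw [← Submodule.finrank_map_subtype_eq T (LinearMap.ker f)]
    exact Submodule.finrank_mono hle
  have h3 : Module.finrank k (LinearMap.range f) ≤ Module.finrank k Q := by
    have hle : LinearMap.range f ≤ Q.map A.mkQ := by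
      rintro _ ⟨y, rfl⟩
      obtain ⟨a, ha, b, hb, hab⟩ := Submodule.mem_sup.1 (h y.2)
      refine ⟨b, hb, ?_⟩
      change A.mkQ b = A.mkQ y
      rw [← hab, map_add, show A.mkQ a = 0 from (Submodule.Quotient.mk_eq_zero A).2 ha, zero_add]
    exact (Submodule.finrank_mono hle).trans (Submodule.finrank_map_le _ _)
  omega

open Classical in
theorem IsPoleFiltration.finrank_le_count {k B : Type*} [Field k] [CommRing B] [Algebra k B]
    {W : ℕ → Submodule k B} (hW : IsPoleFiltration W) (m : ℕ) :
    FiniteDimensional k (W m) ∧ Module.finrank k (W m) ≤ Nat.count (IsPoleNumber W) m := by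
  induction m with
  | zero =>
    rw [hW.zero]
    exact ⟨inferInstance, by simp⟩
  | succ m ih =>
    obtain ⟨h1, h2⟩ := ih
    by_cases hp : IsPoleNumber W m
    · rw [Nat.count_succ, if_pos hp]
      obtain ⟨g, hg, hg'⟩ := hp
      have h3 : W (m + 1) ≤ W m ⊔ Submodule.span k {g} := by
        intro f hf
        obtain ⟨c, hc⟩ := hW.leaf m f g hf hg hg'
        rw [← sub_add_cancel f (c • g)]
        exact Submodule.add_mem_sup hc (Submodule.smul_mem _ _ (Submodule.mem_span_singleton_self g))
      refine ⟨Submodule.finiteDimensional_of_le h3, ?_⟩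
      refine (Submodule.finrank_mono h3).trans
        ((Submodule.finrank_add_le_finrank_add_finrank _ _).trans ?_)
      exact add_le_add h2 ((finrank_span_le_card _).trans (by simp))
    · rw [Nat.count_succ, if_neg hp]
      have h3 : W (m + 1) ≤ W m := fun f hf => by
        by_contra h
        exact hp ⟨f, hf, h⟩
      exact ⟨Submodule.finiteDimensional_of_le h3, (Submodule.finrank_mono h3).trans h2⟩

namespace HahnSeries

variable {k : Type*} [Field k]

/-- The series with poles of order less than `n`. -/
def poleSubmodule (k : Type*) [Field k] (n : ℕ) : Submodule k (LaurentSeries k) where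
  carrier := {f | ∀ z : ℤ, z ≤ -(n : ℤ) → f.coeff z = 0}
  add_mem' hf hg z hz := by rw [coeff_add, hf z hz, hg z hz, add_zero]
  zero_mem' _ _ := rfl
  smul_mem' c f hf z hz := by rw [coeff_smul, hf z hz, smul_zero]

theorem mem_poleSubmodule {n : ℕ} {f : LaurentSeries k} (hf : f ≠ 0) :
    f ∈ poleSubmodule k n ↔ -(n : ℤ) < order f := by
  refine ⟨fun h => ?_, fun h z hz => coeff_eq_zero_of_lt_order (hz.trans_lt h)⟩
  by_contra! h'
  exact hf (coeff_order_eq_zero.1 (h _ h'))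

theorem poleSubmodule_mono : Monotone (poleSubmodule k) :=
  fun a b hab f hf z hz => hf z (hz.trans (by simpa using hab))

theorem order_eq_of_mem {n : ℕ} {f : LaurentSeries k} (h : f ∈ poleSubmodule k (n + 1))
    (h' : f ∉ poleSubmodule k n) : f ≠ 0 ∧ order f = -(n : ℤ) := by
  have h0 : f ≠ 0 := fun h0 => h' (h0 ▸ zero_mem _)
  rw [mem_poleSubmodule h0] at h h'
  exact ⟨h0, by push_cast at h; omega⟩

theorem isPoleFiltration (B : Subalgebra k (LaurentSeries k))
    (hB : ∀ f ∈ B, f ≠ 0 → order f ≤ 0) :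
    IsPoleFiltration fun n => (poleSubmodule k n).comap B.val.toLinearMap where
  zero := by
    rw [eq_bot_iff]
    rintro ⟨f, hf⟩ h
    have h : f ∈ poleSubmodule k 0 := h
    by_contra h0
    have h0 : f ≠ 0 := fun h => h0 (Subtype.ext h)
    rw [mem_poleSubmodule h0] at h
    have := hB f hf h0
    simp only [Nat.cast_zero, neg_zero] at h
    omega
  mono a b hab := Submodule.comap_mono (poleSubmodule_mono hab)
  exhaustive f := by
    by_cases h0 : (f : LaurentSeries k) = 0
    · exact ⟨0, by
        change (f : LaurentSeries k) ∈ poleSubmodule k 0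
        rw [h0]; exact zero_mem _⟩
    · refine ⟨(order (f : LaurentSeries k)).natAbs + 1, ?_⟩
      change (f : LaurentSeries k) ∈ poleSubmodule k _
      rw [mem_poleSubmodule h0]
      omega
  leaf n f g hf hg hg' := by
    obtain ⟨h0, h1⟩ := order_eq_of_mem (f := (g : LaurentSeries k)) (n := n) hg hg'
    refine ⟨(f : LaurentSeries k).coeff (-n) / (g : LaurentSeries k).coeff (-n), ?_⟩
    intro z hz
    rcases eq_or_lt_of_le hz with rfl | hz
    · change ((f : LaurentSeries k) - _ • (g : LaurentSeries k)).coeff _ = 0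
      rw [coeff_sub, coeff_smul, smul_eq_mul, div_mul_cancel₀, sub_self]
      rw [← h1]
      exact fun h => h0 (coeff_order_eq_zero.1 h)
    · exact Submodule.sub_mem (poleSubmodule k (n + 1)) hf (Submodule.smul_mem _ _ hg) z
        (by push_cast; omega)
  mul a b f g hf hf' hg hg' := by
    obtain ⟨h0, h1⟩ := order_eq_of_mem (f := (f : LaurentSeries k)) (n := a) hf hf'
    obtain ⟨h2, h3⟩ := order_eq_of_mem (f := (g : LaurentSeries k)) (n := b) hg hg'
    have h4 := order_mul h0 h2
    constructor
    · change (f * g : LaurentSeries k) ∈ poleSubmodule k _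
      rw [mem_poleSubmodule (mul_ne_zero h0 h2), h4, h1, h3]
      push_cast; omega
    · change (f * g : LaurentSeries k) ∉ poleSubmodule k _
      rw [mem_poleSubmodule (mul_ne_zero h0 h2), h4, h1, h3]
      push_cast; omega

/-- Families of series with pole orders `0, 1, 2, ...`. -/
theorem order_of_mem_span {t : ℕ → LaurentSeries k} (h0 : ∀ r, t r ≠ 0)
    (ht : ∀ r, order (t r) = -(r : ℤ)) (c : ℕ →₀ k) (hc : c ≠ 0) :
    Finsupp.linearCombination k t c ≠ 0 ∧
      ∃ r ∈ c.support, order (Finsupp.linearCombination k t c) = -(r : ℤ) := by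
  have hord : ∀ r ∈ c.support, order (c r • t r) = -(r : ℤ) := fun r hr => by
    rw [order_smul (Finsupp.mem_support_iff.1 hr), ht]
  obtain ⟨h1, r, hr, h2⟩ := order_sum_of_injOn (Finsupp.support_nonempty_iff.2 hc)
    (f := fun r => c r • t r) (fun r hr => smul_ne_zero (Finsupp.mem_support_iff.1 hr) (h0 r))
    (fun a ha b hb hab => by
      simp only [hord a ha, hord b hb, neg_inj] at hab
      exact_mod_cast hab)
  exact ⟨h1, r, hr, h2.trans (hord r hr)⟩

theorem linearIndependent_of_order {t : ℕ → LaurentSeries k} (h0 : ∀ r, t r ≠ 0)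
    (ht : ∀ r, order (t r) = -(r : ℤ)) : LinearIndependent k t := by
  rw [linearIndependent_iff]
  intro c hc
  by_contra h
  exact (order_of_mem_span h0 ht c h).1 hc

end HahnSeries

/-- The span over the polynomials in `x 0` of the first `a` elements of a sequence. -/
def polySpan (k : Type*) {L : Type*} [Field k] [Field L] [Algebra k L] (y : L) (u : ℕ → L)
    (a : ℕ) : Submodule k L :=
  Submodule.span k ((fun p : ℕ × ℕ => y ^ p.1 * u p.2) '' {p | p.2 < a})

section

variable {k L : Type*} [Field k] [Field L] [Algebra k L] {q n : ℕ} {x u : ℕ → L} {y : L}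

theorem mul_mem_polySpan {a : ℕ} {r f : L} (hr : r ∈ Algebra.adjoin k {y})
    (hf : f ∈ polySpan k y u a) : r * f ∈ polySpan k y u a := by
  induction hr using Algebra.adjoin_induction generalizing f with
  | mem z hz =>
    rw [Set.mem_singleton_iff] at hz
    subst hz
    induction hf using Submodule.span_induction with
    | mem w hw =>
      obtain ⟨⟨j, b⟩, hb, rfl⟩ := hw
      exact Submodule.subset_span ⟨⟨j + 1, b⟩, hb, by simp only; ring⟩
    | zero => rw [mul_zero]; exact zero_mem _
    | add v w _ _ hv hw => rw [mul_add]; exact add_mem hv hw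
    | smul c w _ hw => rw [mul_smul_comm]; exact Submodule.smul_mem _ _ hw
  | algebraMap c => rw [← Algebra.smul_def]; exact Submodule.smul_mem _ _ hf
  | add v w _ _ hv hw => rw [add_mul]; exact add_mem (hv hf) (hw hf)
  | mul v w _ _ hv hw => rw [mul_assoc]; exact hv (hw hf)

theorem mul_mem_polySpan_of_lt {a b : ℕ} {r : L} (hr : r ∈ Algebra.adjoin k {y}) (h : b < a) :
    r * u b ∈ polySpan k y u a :=
  mul_mem_polySpan hr (Submodule.subset_span ⟨⟨0, b⟩, h, by simp⟩)

theorem tr_mem_adjoin : y ^ q + y ∈ Algebra.adjoin k {y} :=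
  have h := Algebra.self_mem_adjoin_singleton k y
  add_mem (pow_mem h _) h

theorem pow_mul_mem_of_le {S : Submodule k L} {h f : L} (hS : ∀ g ∈ S, h * g ∈ S) {M N : ℕ}
    (hMN : M ≤ N) (hf : h ^ M * f ∈ S) : h ^ N * f ∈ S := by
  induction N, hMN using Nat.le_induction with
  | base => exact hf
  | succ N _ ih => rw [pow_succ', mul_assoc]; exact hS _ ih

theorem exists_pow_mul_mem_polySpan (h0 : x 0 ^ q + x 0 ≠ 0) {a : ℕ} {f : L}
    (hf : f ∈ towerSpan k q n x a) :
    ∃ N : ℕ, (x 0 ^ q + x 0) ^ N * f ∈ polySpan k (x 0) (towerMon q n x) a := by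
  induction hf using Submodule.span_induction with
  | mem w hw =>
    obtain ⟨b, hb, rfl⟩ := hw
    exact ⟨0, by rw [pow_zero]; exact mul_mem_polySpan_of_lt (one_mem _) hb⟩
  | zero => exact ⟨0, by rw [mul_zero]; exact zero_mem _⟩
  | add v w _ _ hv hw =>
    obtain ⟨M, hM⟩ := hv
    obtain ⟨N, hN⟩ := hw
    refine ⟨max M N, ?_⟩
    rw [mul_add]
    have hS : ∀ g ∈ polySpan k (x 0) (towerMon q n x) a,
        (x 0 ^ q + x 0) * g ∈ polySpan k (x 0) (towerMon q n x) a :=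
      fun g hg => mul_mem_polySpan tr_mem_adjoin hg
    exact add_mem (pow_mul_mem_of_le hS (le_max_left _ _) hM)
      (pow_mul_mem_of_le hS (le_max_right _ _) hN)
  | smul c w _ hw =>
    obtain ⟨N, hN⟩ := hw
    obtain ⟨M, hM⟩ := exists_pow_mul_mem_adjoin h0 c.2
    refine ⟨M + N, ?_⟩
    have : (x 0 ^ q + x 0) ^ (M + N) * c • w =
        ((x 0 ^ q + x 0) ^ M * c) * ((x 0 ^ q + x 0) ^ N * w) := by
      rw [Subalgebra.smul_def, smul_eq_mul]; ring
    rw [this]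
    exact mul_mem_polySpan hM hN

/-- Finitely many clearing exponents can be chosen uniformly. -/
theorem exists_uniform {S : ℕ → Submodule k L} {h : L} (hS : ∀ a, ∀ g ∈ S a, h * g ∈ S a)
    {w : ℕ → L} {D : ℕ} (hw : ∀ a < D, ∃ N : ℕ, h ^ N * w a ∈ S a) :
    ∃ N : ℕ, ∀ a < D, h ^ N * w a ∈ S a := by
  choose! N hN using hw
  refine ⟨∑ a ∈ range D, N a, fun a ha => pow_mul_mem_of_le (hS a) ?_ (hN a ha)⟩
  exact single_le_sum (f := N) (fun _ _ => Nat.zero_le _) (mem_range.2 ha)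

theorem IsTower.exists_triangular (hx : IsTower q n x) (hn : 0 < n) :
    ∃ N : ℕ, ∀ a < q ^ (n - 1), (x 0 ^ q + x 0) ^ N *
      (towerMon q n (towerGen q n x) a - towerMon q n x a) ∈
        polySpan k (x 0) (towerMon q n x) a :=
  exists_uniform (S := polySpan k (x 0) (towerMon q n x))
    (fun _ _ hg => mul_mem_polySpan tr_mem_adjoin hg) fun _ ha =>
      exists_pow_mul_mem_polySpan (hx.tr_ne_zero 0 hn)
        (hx.towerMon_towerGen_sub_mem (i := n - 1) (by omega) ha).2

/-- Small elements with bounded denominators. -/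
def remainderSpan (k : Type*) {L : Type*} [Field k] [Field L] [Algebra k L] (h y : L) (u : ℕ → L)
    (N M D : ℕ) : Submodule k L :=
  Submodule.span k (Set.range fun p : Fin M × Fin D => h⁻¹ ^ N * (y ^ (p.1 : ℕ) * u p.2))

theorem finrank_remainderSpan_le (h y : L) (u : ℕ → L) (N M D : ℕ) :
    FiniteDimensional k (remainderSpan k h y u N M D) ∧
      Module.finrank k (remainderSpan k h y u N M D) ≤ M * D := by
  refine ⟨FiniteDimensional.span_of_finite k (Set.finite_range _), ?_⟩
  refine (finrank_range_le_card _).trans ?_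
  simp

theorem polySpan_le_sup {h : L} (hq : 2 ≤ q) (hh : h = y ^ q + y) (h0 : h ≠ 0) {v : ℕ → L}
    {N D : ℕ} (hv : ∀ a < D, h ^ N * (v a - u a) ∈ polySpan k y u a) {a : ℕ} (ha : a ≤ D) {f : L}
    (hf : f ∈ polySpan k y u a) :
    h⁻¹ ^ N * f ∈ polySpan k y v D ⊔ remainderSpan k h y u N (q * N) D := by
  induction a generalizing f with
  | zero =>
    have : polySpan k y u 0 = ⊥ := by simp [polySpan]
    rw [this, Submodule.mem_bot] at hf
    rw [hf, mul_zero]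
    exact zero_mem _
  | succ a ih =>
    induction hf using Submodule.span_induction with
    | zero => rw [mul_zero]; exact zero_mem _
    | add v w _ _ hv hw => rw [mul_add]; exact add_mem hv hw
    | smul c w _ hw => rw [mul_smul_comm]; exact Submodule.smul_mem _ _ hw
    | mem w hw =>
      obtain ⟨⟨j, b⟩, hb, rfl⟩ := hw
      change b < a + 1 at hb
      rcases Nat.lt_succ_iff_lt_or_eq.1 hb with hb | rfl
      · exact ih (by omega) (Submodule.subset_span ⟨⟨j, b⟩, hb, rfl⟩)
      let H : Polynomial k := trPoly q 0 ^ N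
      have hH : H.Monic := (trPoly_monic hq 0).pow N
      have hHd : H.natDegree = q * N := by
        rw [Polynomial.natDegree_pow, trPoly_natDegree hq, mul_comm]
      have hHy : Polynomial.aeval y H = h ^ N := by
        rw [map_pow, aeval_trPoly, map_zero, sub_zero, hh]
      let R := Polynomial.X ^ j %ₘ H
      let Q := Polynomial.X ^ j /ₘ H
      have hy : y ^ j = Polynomial.aeval y R + h ^ N * Polynomial.aeval y Q := by
        rw [← hHy, ← map_mul, ← map_add, Polynomial.modByMonic_add_div, map_pow,
          Polynomial.aeval_X]
      have hQ : Polynomial.aeval y Q ∈ Algebra.adjoin k {y} :=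
        Polynomial.aeval_mem_adjoin_singleton k y
      have hi : h⁻¹ ^ N * h ^ N = 1 := by rw [← mul_pow, inv_mul_cancel₀ h0, one_pow]
      have h1 : h⁻¹ ^ N * (y ^ j * u b) = h⁻¹ ^ N * (Polynomial.aeval y R * u b) +
          Polynomial.aeval y Q * v b -
          h⁻¹ ^ N * (Polynomial.aeval y Q * (h ^ N * (v b - u b))) := by
        rw [hy]
        linear_combination (Polynomial.aeval y Q * v b) * hi
      change h⁻¹ ^ N * (y ^ j * u b) ∈ _
      rw [h1]
      refine sub_mem (add_mem (Submodule.mem_sup_right ?_) (Submodule.mem_sup_left ?_)) ?_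
      · have hR : R.degree < (q * N : ℕ) := by
          rw [← hHd, ← Polynomial.degree_eq_natDegree hH.ne_zero]
          exact Polynomial.degree_modByMonic_lt _ hH
        rw [Polynomial.aeval_eq_sum_range' (n := q * N + 1) 
          (Nat.lt_succ_of_le (Polynomial.natDegree_le_of_degree_le hR.le)), sum_mul, mul_sum]
        refine sum_mem fun l hl => ?_
        by_cases hlN : l < q * N
        · rw [smul_mul_assoc, mul_smul_comm]
          refine Submodule.smul_mem _ _ (Submodule.subset_span ?_)
          exact ⟨(⟨l, hlN⟩, ⟨b, by omega⟩), rfl⟩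
        · rw [Polynomial.coeff_eq_zero_of_degree_lt (hR.trans_le (by exact_mod_cast not_lt.1 hlN))]
          simp
      · exact mul_mem_polySpan_of_lt hQ (by omega)
      · exact ih (by omega) (mul_mem_polySpan hQ (hv b (by omega)))

end

/-- The ring of functions attached to the tower. -/
noncomputable def towerRing (k : Type*) {L : Type*} [Field k] [Field L] [Algebra k L] (q n : ℕ)
    (x : ℕ → L) : Subalgebra k L :=
  Algebra.adjoin k (insert (x 0) ((fun a => (x 0 ^ q + x 0) * towerMon q n (towerGen q n x) a) ''
    Set.Iio (q ^ (n - 1))))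

section

variable {k L : Type*} [Field k] [Field L] [Algebra k L] {q n : ℕ} {x : ℕ → L}

theorem gen_mem_towerRing : x 0 ∈ towerRing k q n x :=
  Algebra.subset_adjoin (Set.mem_insert _ _)

theorem mul_towerMon_mem_towerRing {a : ℕ} (ha : a < q ^ (n - 1)) :
    (x 0 ^ q + x 0) * towerMon q n (towerGen q n x) a ∈ towerRing k q n x :=
  Algebra.subset_adjoin (Set.mem_insert_of_mem _ ⟨a, ha, rfl⟩)

theorem isNoetherianRing_towerRing : IsNoetherianRing (towerRing k q n x) := by
  have : (towerRing k q n x).FG := Subalgebra.fg_def.2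
    ⟨_, ((Set.finite_Iio _).image _).insert _, rfl⟩
  have := (towerRing k q n x).fg_iff_finiteType.1 this
  exact Algebra.FiniteType.isNoetherianRing k _

theorem mul_mem_towerRing {f : L}
    (hf : f ∈ polySpan k (x 0) (towerMon q n (towerGen q n x)) (q ^ (n - 1))) :
    (x 0 ^ q + x 0) * f ∈ towerRing k q n x := by
  induction hf using Submodule.span_induction with
  | mem w hw =>
    obtain ⟨⟨j, b⟩, hb, rfl⟩ := hw
    simp only
    rw [mul_left_comm]
    exact mul_mem (pow_mem gen_mem_towerRing _) (mul_towerMon_mem_towerRing hb)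
  | zero => rw [mul_zero]; exact zero_mem _
  | add v w _ _ hv hw => rw [mul_add]; exact add_mem hv hw
  | smul c w _ hw => rw [mul_smul_comm]; exact Subalgebra.smul_mem _ hw _

theorem IsTower.towerRing_le (hx : IsTower q n x) (hn : 0 < n) :
    towerRing k q n x ≤ towerAlg k q x (n - 1) := by
  refine Algebra.adjoin_le (Set.insert_subset (mem_towerAlg (Nat.zero_le _)) ?_)
  rintro _ ⟨a, ha, rfl⟩
  have h : x 0 ∈ towerAlg k q x (n - 1) := mem_towerAlg (Nat.zero_le _)
  exact mul_mem (add_mem (pow_mem h _) h)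
    (hx.towerMon_towerGen_sub_mem (i := n - 1) (by omega) ha).1

theorem IsTower.isIntegral_of_mem_towerRing (hx : IsTower q n x) (hn : 0 < n) {f : L}
    (hf : f ∈ towerRing k q n x) : IsIntegral (Algebra.adjoin k {x 0}) f := by
  have hq := hx.two_le
  induction hf using Algebra.adjoin_induction with
  | mem w hw =>
    rcases hw with rfl | ⟨a, ha, rfl⟩
    · exact isIntegral_algebraMap (x := (⟨x 0, Algebra.self_mem_adjoin_singleton k _⟩ :
        Algebra.adjoin k {x 0}))
    · exact hx.isIntegral_mul_prod hn (e := fun i => a / q ^ i % q)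
        fun i => Nat.mod_lt _ (by omega)
  | algebraMap c => exact isIntegral_algebraMap (x := algebraMap k (Algebra.adjoin k {x 0}) c)
  | add v w _ _ hv hw => exact hv.add hw
  | mul v w _ _ hv hw => exact hv.mul hw

/-- The powers of an integral element have a common denominator. -/
theorem IsTower.exists_pow_mul_pow_mem (hx : IsTower q n x) (hn : 0 < n) {f : L}
    (hf : f ∈ towerAlg k q x (n - 1)) (hi : IsIntegral (Algebra.adjoin k {x 0}) f) :
    ∃ N : ℕ, ∀ j, (x 0 ^ q + x 0) ^ N * f ^ j ∈
      polySpan k (x 0) (towerMon q n x) (q ^ (n - 1)) := by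
  obtain ⟨P, hP, hPf⟩ := hi
  obtain ⟨N, hN⟩ := exists_uniform (D := P.natDegree) (w := fun l => f ^ l)
    (S := fun _ => polySpan k (x 0) (towerMon q n x) (q ^ (n - 1)))
    (fun _ _ hg => mul_mem_polySpan tr_mem_adjoin hg) fun l _ =>
      exists_pow_mul_mem_polySpan (hx.tr_ne_zero 0 hn)
        (hx.mem_towerSpan (i := n - 1) (by omega) (pow_mem hf l))
  refine ⟨N, fun j => ?_⟩
  induction j using Nat.strong_induction_on with
  | _ j ih =>
    by_cases hj : j < P.natDegree
    · exact hN j hj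
    rw [not_lt] at hj
    rw [Polynomial.eval₂_eq_sum_range, sum_range_succ, hP.coeff_natDegree, map_one, one_mul] at hPf
    have h1 : (x 0 ^ q + x 0) ^ N * f ^ j = -∑ l ∈ range P.natDegree,
        (P.coeff l : L) * ((x 0 ^ q + x 0) ^ N * f ^ (j - P.natDegree + l)) := by
      have h2 : ∑ l ∈ range P.natDegree, (P.coeff l : L) * ((x 0 ^ q + x 0) ^ N *
          f ^ (j - P.natDegree + l)) = (x 0 ^ q + x 0) ^ N * f ^ (j - P.natDegree) *
          ∑ l ∈ range P.natDegree, (P.coeff l : L) * f ^ l := by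
        rw [mul_sum]
        exact sum_congr rfl fun l _ => by rw [pow_add]; ring
      rw [h2, show ∑ l ∈ range P.natDegree, (P.coeff l : L) * f ^ l = -f ^ P.natDegree from
        eq_neg_of_add_eq_zero_left hPf]
      conv_lhs => rw [← Nat.sub_add_cancel hj, pow_add]
      ring
    rw [h1]
    refine neg_mem (sum_mem fun l hl => mul_mem_polySpan (P.coeff l).2 (ih _ ?_))
    rw [mem_range] at hl
    omega

end

namespace IsLaurentTower

open HahnSeries

variable {k : Type*} [Field k] {q n : ℕ} {x : ℕ → LaurentSeries k}

theorem towerMon_ne_zero (hx : IsLaurentTower q n x) (a : ℕ) : towerMon q n x a ≠ 0 :=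
  prod_ne_zero_iff.2 fun i hi => pow_ne_zero _ (hx.ne_zero _ (by rw [mem_range] at hi; omega))

theorem exists_towerMon_order (hx : IsLaurentTower q n x) {i : ℕ} (hi : i < n) {r : ℕ}
    (hr : r < q ^ i) :
    ∃ a < q ^ i, order (towerMon q n x a) = -((r * q ^ (n - 1 - i) : ℕ) : ℤ) := by
  have hq := hx.two_le
  induction i generalizing r with
  | zero =>
    obtain rfl : r = 0 := by simpa using hr
    exact ⟨0, by simp, by simp [towerMon_zero]⟩
  | succ i ih =>
    obtain ⟨a, ha, h1⟩ := ih (by omega) (r := r / q) (by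
      rw [Nat.div_lt_iff_lt_mul (by omega), ← pow_succ]; exact hr)
    have he : r % q < q := Nat.mod_lt _ (by omega)
    refine ⟨r % q * q ^ i + a, ?_, ?_⟩
    · have : (r % q + 1) * q ^ i ≤ q * q ^ i := Nat.mul_le_mul_right _ he
      rw [pow_succ']
      linarith
    · rw [towerMon_mul_add hi he ha, order_mul (pow_ne_zero _ (hx.ne_zero _ hi))
        (hx.towerMon_ne_zero a), h1, order_pow, hx.order_eq _ hi]
      have h2 : q ^ (n - 1 - i) = q * q ^ (n - 1 - (i + 1)) := by
        rw [← pow_succ']; congr 1; omega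
      have h3 := Nat.div_add_mod r q
      rw [h2]
      generalize r / q = d at *
      generalize r % q = e at *
      subst h3
      push_cast
      rw [nsmul_eq_mul]
      ring

/-- A basis with distinct pole orders of the module generated by the monomials. -/
theorem exists_basis (hx : IsLaurentTower q n x) (hn : 0 < n) :
    ∃ t : ℕ → LaurentSeries k, (∀ r, t r ≠ 0) ∧ (∀ r, order (t r) = -(r : ℤ)) ∧
      (∀ r, t r ∈ polySpan k (x 0) (towerMon q n x) (q ^ (n - 1))) ∧
      polySpan k (x 0) (towerMon q n x) (q ^ (n - 1)) ≤ Submodule.span k (Set.range t) := by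
  have hq := hx.two_le
  have hD : 0 < q ^ (n - 1) := by positivity
  have h := fun r (hr : r < q ^ (n - 1)) => hx.exists_towerMon_order (i := n - 1) (by omega) hr
  simp only [Nat.sub_self, pow_zero, mul_one] at h
  choose! b hb hbo using h
  have hsurj : ∀ a < q ^ (n - 1), ∃ r < q ^ (n - 1), b r = a := by
    have h1 : Set.InjOn b (range (q ^ (n - 1))) := by
      intro r hr s hs hrs
      simp only [coe_range, Set.mem_Iio] at hr hs
      have h2 := hbo r hr
      rw [hrs, hbo s hs] at h2
      omega
    have h3 := surjOn_of_injOn_of_card_le (s := range (q ^ (n - 1))) (t := range (q ^ (n - 1))) b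
      (fun r hr => by simpa using hb r (by simpa using hr)) h1 le_rfl
    intro a ha
    obtain ⟨r, hr, rfl⟩ := h3 (by simpa using ha : a ∈ (range (q ^ (n - 1)) : Set ℕ))
    exact ⟨r, by simpa using hr, rfl⟩
  refine ⟨fun r => x 0 ^ (r / q ^ (n - 1)) * towerMon q n x (b (r % q ^ (n - 1))), ?_, ?_, ?_, ?_⟩
  · exact fun r => mul_ne_zero (pow_ne_zero _ (hx.ne_zero 0 hn)) (hx.towerMon_ne_zero _)
  · intro r
    rw [order_mul (pow_ne_zero _ (hx.ne_zero 0 hn)) (hx.towerMon_ne_zero _),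
      hbo _ (Nat.mod_lt _ hD), order_pow, hx.order_eq 0 hn, Nat.sub_zero, nsmul_eq_mul]
    have h3 : ((q ^ (n - 1) * (r / q ^ (n - 1)) + r % q ^ (n - 1) : ℕ) : ℤ) = r := by
      rw [Nat.div_add_mod]
    rw [Nat.cast_add, Nat.cast_mul] at h3
    linear_combination -h3
  · exact fun r => Submodule.subset_span ⟨(_, _), hb _ (Nat.mod_lt _ hD), rfl⟩
  · refine Submodule.span_le.2 ?_
    rintro _ ⟨⟨j, a⟩, ha, rfl⟩
    obtain ⟨r, hr, rfl⟩ := hsurj a ha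
    refine Submodule.subset_span ⟨q ^ (n - 1) * j + r, ?_⟩
    simp only
    rw [Nat.mul_add_div hD, Nat.div_eq_of_lt hr, add_zero, Nat.mul_add_mod, Nat.mod_eq_of_lt hr]

theorem order_nonpos_of_mem_polySpan (hx : IsLaurentTower q n x) (hn : 0 < n)
    {f : LaurentSeries k} (hf0 : f ≠ 0)
    (hf : f ∈ polySpan k (x 0) (towerMon q n x) (q ^ (n - 1))) : order f ≤ 0 := by
  obtain ⟨t, h0, ht, -, hspan⟩ := hx.exists_basis hn
  obtain ⟨c, rfl⟩ := (Finsupp.mem_span_range_iff_exists_finsupp).1 (hspan hf)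
  have hc : c ≠ 0 := fun h => hf0 (by rw [h, Finsupp.sum_zero_index])
  obtain ⟨-, r, -, h1⟩ := order_of_mem_span h0 ht c hc
  rw [Finsupp.linearCombination_apply] at h1
  rw [h1]
  omega

theorem order_nonpos (hx : IsLaurentTower q n x) (hn : 0 < n) {f : LaurentSeries k} (hf0 : f ≠ 0)
    (hf : f ∈ towerRing k q n x) : order f ≤ 0 := by
  obtain ⟨N, hN⟩ := hx.exists_pow_mul_pow_mem hn (hx.towerRing_le hn hf)
    (hx.isIntegral_of_mem_towerRing hn hf)
  have h0 := hx.tr_ne_zero 0 hn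
  by_contra! h
  have h1 := hx.order_nonpos_of_mem_polySpan hn
    (mul_ne_zero (pow_ne_zero N h0) (pow_ne_zero (N * q ^ n + 1) hf0)) (hN _)
  rw [order_mul (pow_ne_zero N h0) (pow_ne_zero _ hf0), order_pow, order_pow, hx.order_tr hn,
    nsmul_eq_mul, nsmul_eq_mul] at h1
  push_cast at h1
  have h2 : (0 : ℤ) ≤ N * q ^ n := by positivity
  nlinarith

end IsLaurentTower

namespace IsLaurentTower

open HahnSeries

variable {k : Type*} [Field k] {q n : ℕ} {x : ℕ → LaurentSeries k}

/-- The filtration of the ring of functions by pole order. -/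
noncomputable def poleFiltration (k : Type*) [Field k] (q n : ℕ) (x : ℕ → LaurentSeries k) (m : ℕ) :
    Submodule k (towerRing k q n x) :=
  (poleSubmodule k m).comap (towerRing k q n x).val.toLinearMap

theorem isPoleFiltration (hx : IsLaurentTower q n x) (hn : 0 < n) :
    IsPoleFiltration (poleFiltration k q n x) :=
  HahnSeries.isPoleFiltration _ fun _ hf hf0 => hx.order_nonpos hn hf0 hf

theorem exists_submodule (hx : IsLaurentTower q n x) (hn : 0 < n) (M : ℕ) :
    ∃ S : Submodule k (LaurentSeries k), M + 1 ≤ Module.finrank k S ∧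
      ∀ f ∈ S, f ∈ poleSubmodule k (M + 1) ∧
        f ∈ polySpan k (x 0) (towerMon q n (towerGen q n x)) (q ^ (n - 1)) := by
  have h0 := hx.tr_ne_zero 0 hn
  obtain ⟨N, hN⟩ := hx.exists_triangular (k := k) hn
  obtain ⟨t, ht0, ht, htm, -⟩ := hx.exists_basis hn
  set h := x 0 ^ q + x 0 with hh
  have hi0 : h⁻¹ ^ N ≠ 0 := pow_ne_zero _ (inv_ne_zero h0)
  have hio : order (h⁻¹ ^ N) = N * (q ^ n : ℕ) := by
    have h1 := order_mul hi0 (pow_ne_zero N h0)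
    rw [← mul_pow, inv_mul_cancel₀ h0, one_pow, order_one, order_pow h, hx.order_tr hn,
      nsmul_eq_mul] at h1
    linarith
  let w : Fin (M + 1 + N * q ^ n) → LaurentSeries k := fun r => h⁻¹ ^ N * t r
  let T := Submodule.span k (Set.range w)
  have hwi : LinearIndependent k w :=
    ((linearIndependent_of_order ht0 ht).comp _ Fin.val_injective).map'
      (LinearMap.mulLeft k (h⁻¹ ^ N)) (LinearMap.ker_eq_bot.2 (mul_right_injective₀ hi0))
  have hT : Module.finrank k T = M + 1 + N * q ^ n := by
    rw [finrank_span_eq_card hwi, Fintype.card_fin]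
  have : FiniteDimensional k T := FiniteDimensional.span_of_finite k (Set.finite_range _)
  obtain ⟨h1, h2⟩ := finrank_remainderSpan_le (k := k) h (x 0) (towerMon q n x) N (q * N)
    (q ^ (n - 1))
  refine ⟨T ⊓ polySpan k (x 0) (towerMon q n (towerGen q n x)) (q ^ (n - 1)), ?_,
    fun f hf => ⟨?_, hf.2⟩⟩
  · have h3 := Submodule.finrank_le_finrank_inf_add T
      (polySpan k (x 0) (towerMon q n (towerGen q n x)) (q ^ (n - 1)))
      (remainderSpan k h (x 0) (towerMon q n x) N (q * N) (q ^ (n - 1))) (by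
        refine Submodule.span_le.2 ?_
        rintro _ ⟨r, rfl⟩
        exact polySpan_le_sup hx.two_le hh h0 hN le_rfl (htm r))
    have h4 : q * N * q ^ (n - 1) = N * q ^ n := by
      conv_rhs => rw [← Nat.sub_add_cancel hn, pow_succ]
      ring
    rw [hT] at h3
    omega
  · have hTp : T ≤ poleSubmodule k (M + 1) := by
      refine Submodule.span_le.2 ?_
      rintro _ ⟨r, rfl⟩
      refine (mem_poleSubmodule (mul_ne_zero hi0 (ht0 _))).2 ?_
      rw [order_mul hi0 (ht0 _), hio, ht]
      have := r.2
      zify at this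
      push_cast
      linarith
    exact hTp hf.1

open Classical in
theorem le_count (hx : IsLaurentTower q n x) (hn : 0 < n) (m : ℕ) :
    m ≤ Nat.count (IsPoleNumber (poleFiltration k q n x)) m + q ^ n := by
  rcases le_or_gt m (q ^ n) with hm | hm
  · omega
  obtain ⟨M, rfl⟩ : ∃ M, m = M + 1 + q ^ n := ⟨m - 1 - q ^ n, by omega⟩
  have h0 := hx.tr_ne_zero 0 hn
  obtain ⟨S, hS, hSm⟩ := hx.exists_submodule hn M
  obtain ⟨h1, h2⟩ := (hx.isPoleFiltration hn).finrank_le_count (M + 1 + q ^ n)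
  have h3 : S.map (LinearMap.mulLeft k (x 0 ^ q + x 0)) ≤
      (poleFiltration k q n x (M + 1 + q ^ n)).map (towerRing k q n x).val.toLinearMap := by
    rintro _ ⟨f, hf, rfl⟩
    obtain ⟨h4, h5⟩ := hSm f hf
    refine ⟨⟨_, mul_mem_towerRing h5⟩, ?_, rfl⟩
    change (x 0 ^ q + x 0) * f ∈ poleSubmodule k _
    by_cases hf0 : f = 0
    · rw [hf0, mul_zero]; exact zero_mem _
    rw [mem_poleSubmodule hf0] at h4
    rw [mem_poleSubmodule (mul_ne_zero h0 hf0), order_mul h0 hf0, hx.order_tr hn]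
    push_cast at h4 ⊢
    linarith
  have h4 := Submodule.finrank_mono h3
  rw [← (Submodule.equivMapOfInjective (LinearMap.mulLeft k (x 0 ^ q + x 0))
      (mul_right_injective₀ h0) S).finrank_eq,
    ← (Submodule.equivMapOfInjective (towerRing k q n x).val.toLinearMap
      Subtype.val_injective _).finrank_eq] at h4
  omega

end IsLaurentTower

theorem exists_algHom_of_le_range {k A L E : Type*} [Field k] [CommRing A] [Algebra k A]
    [CommRing L] [Algebra k L] [CommRing E] [Algebra k E] (f : A →ₐ[k] L) (g : A →ₐ[k] E)
    (H : ∀ a, f a = 0 → g a = 0) {T : Subalgebra k L} (hT : T ≤ f.range) :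
    ∃ ψ : T →ₐ[k] E, ∀ a (h : f a ∈ T), ψ ⟨f a, h⟩ = g a := by
  have hs : Function.Surjective f.rangeRestrict := f.rangeRestrict_surjective
  have hk : RingHom.ker f.rangeRestrict.toRingHom ≤ RingHom.ker g.toRingHom := fun a ha =>
    H a (congrArg Subtype.val ((RingHom.mem_ker).1 ha))
  exact ⟨(AlgHom.liftOfSurjective f.rangeRestrict hs g hk).comp (Subalgebra.inclusion hT),
    fun a h => AlgHom.liftOfSurjective_apply f.rangeRestrict hs g hk a⟩

/-- Extension of a homomorphism along an Artin-Schreier type extension. -/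
theorem exists_algHom_adjoin {k L E : Type*} [Field k] [CommRing L] [Algebra k L] [CommRing E]
    [Algebra k E] {q : ℕ} (hq : 2 ≤ q) {T : Subalgebra k L} [Nontrivial T] {y : L} {c : T}
    (hy : y ^ q + y = c)
    (hind : ∀ a : ℕ → L, (∀ e, a e ∈ T) → ∑ e ∈ range q, a e * y ^ e = 0 → ∀ e < q, a e = 0)
    (φ : T →ₐ[k] E) {b : E} (hb : b ^ q + b = φ c) :
    ∃ ψ : (Algebra.adjoin T {y}).restrictScalars k →ₐ[k] E,
      (∀ (a : T) (h : (a : L) ∈ (Algebra.adjoin T {y}).restrictScalars k), ψ ⟨a, h⟩ = φ a) ∧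
        ∀ h, ψ ⟨y, h⟩ = b := by
  obtain ⟨ψ, hψ⟩ := exists_algHom_of_le_range (T := (Algebra.adjoin T {y}).restrictScalars k)
    ((Polynomial.aeval y).restrictScalars k : Polynomial T →ₐ[k] L)
    (Polynomial.aevalTower φ b) (by
      intro P hP
      have h1 : ∑ e ∈ range q, ((P %ₘ trPoly q c).coeff e : L) * y ^ e = 0 :=
        (aeval_modByMonic_trPoly hq (c := c) (y := y) hy P).symm.trans hP
      have h2 := hind _ (fun e => Subtype.property _) h1
      have h3 : P %ₘ trPoly q c = 0 := by
        ext e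
        by_cases he : e < q
        · simpa using h2 e he
        · rw [Polynomial.coeff_eq_zero_of_natDegree_lt
            ((natDegree_modByMonic_trPoly_lt hq c P).trans_le (not_lt.1 he))]
          simp
      rw [← Polynomial.modByMonic_add_div P (trPoly q c), h3, zero_add, map_mul]
      simp [trPoly, ← hb])
    (by
      rw [Algebra.adjoin_singleton_eq_range_aeval]
      rintro _ ⟨P, rfl⟩
      exact ⟨P, rfl⟩)
  refine ⟨ψ, fun a h => ?_, fun h => ?_⟩
  · have := hψ (Polynomial.C a)
    simp only [AlgHom.coe_restrictScalars', Polynomial.aeval_C, Polynomial.aevalTower_C] at this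
    exact this h
  · have := hψ Polynomial.X
    simp only [AlgHom.coe_restrictScalars', Polynomial.aeval_X, Polynomial.aevalTower_X] at this
    exact this h

theorem isUnit_aeval_trPoly_pow {k E : Type*} [Field k] [Field E] [Algebra k E] {q : ℕ} {z : E}
    (hz : z ^ q + z ≠ 0) (s : Submonoid.powers (trPoly q (0 : k))) :
    IsUnit (Polynomial.aeval z (s : Polynomial k)) := by
  obtain ⟨_, N, rfl⟩ := s
  rw [isUnit_iff_ne_zero]
  simp only [map_pow]
  apply pow_ne_zero
  simpa [aeval_trPoly] using hz

theorem exists_algHom_towerAlg_zero {k L : Type*} [Field k] [Field L] [Algebra k L] {q : ℕ}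
    {x : ℕ → L} (h0 : x 0 ^ q + x 0 ≠ 0)
    (hind : ∀ P : Polynomial k, P ≠ 0 → Polynomial.aeval (x 0) P ≠ 0) {a : k}
    (ha : a ^ q + a ≠ 0) :
    ∃ ψ : towerAlg k q x 0 →ₐ[k] k, ∀ h, ψ ⟨x 0, h⟩ = a := by
  set h : Polynomial k := trPoly q 0
  let f : Localization (Submonoid.powers h) →ₐ[k] L := IsLocalization.liftAlgHom
    (M := Submonoid.powers h) (f := Polynomial.aeval (x 0)) (isUnit_aeval_trPoly_pow h0)
  let g : Localization (Submonoid.powers h) →ₐ[k] k := IsLocalization.liftAlgHom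
    (M := Submonoid.powers h) (f := Polynomial.aeval a) (isUnit_aeval_trPoly_pow ha)
  have hf : ∀ P : Polynomial k, f (algebraMap _ _ P) = Polynomial.aeval (x 0) P := fun P =>
    IsLocalization.lift_eq _ P
  have hg : ∀ P : Polynomial k, g (algebraMap _ _ P) = Polynomial.aeval a P := fun P =>
    IsLocalization.lift_eq _ P
  have hX : f (algebraMap (Polynomial k) _ Polynomial.X) = x 0 := by rw [hf, Polynomial.aeval_X]
  obtain ⟨ψ, hψ⟩ := exists_algHom_of_le_range (T := towerAlg k q x 0) f g (by
      intro z hz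
      obtain ⟨⟨P, s⟩, hs⟩ := IsLocalization.surj (Submonoid.powers h) z
      simp only at hs
      have h1 := congrArg f hs
      rw [map_mul, hz, zero_mul, hf] at h1
      have h2 : P = 0 := by
        by_contra hP
        exact hind P hP h1.symm
      have h3 := congrArg g hs
      rw [map_mul, h2, map_zero, map_zero, hg] at h3
      exact (mul_eq_zero.1 h3).resolve_right (isUnit_aeval_trPoly_pow ha s).ne_zero)
    (by
      refine Algebra.adjoin_le ?_
      rintro _ (rfl | rfl)
      · exact ⟨_, hX⟩
      · refine ⟨IsLocalization.mk' _ 1 (⟨h, Submonoid.mem_powers h⟩ : Submonoid.powers h), ?_⟩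
        have h1 : f (algebraMap (Polynomial k) _ h) = x 0 ^ q + x 0 := by
          rw [hf]
          simp [h, aeval_trPoly]
        refine eq_inv_of_mul_eq_one_left ?_
        have h2 := congrArg f (IsLocalization.mk'_spec (Localization (Submonoid.powers h)) 1
          (⟨h, Submonoid.mem_powers h⟩ : Submonoid.powers h))
        rw [map_mul, h1, map_one, map_one] at h2
        exact h2)
  refine ⟨ψ, fun hm => ?_⟩
  have := hψ (algebraMap (Polynomial k) _ Polynomial.X)
  simp only [hX, hg, Polynomial.aeval_X] at this
  exact this hm

section

variable {k : Type*} [Field k] [Finite k] {q : ℕ}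

theorem exists_injective_pow_add_eq (hq : 2 ≤ q) (hcard : Nat.card k = q ^ 2)
    (hadd : ∀ a b : k, (a + b) ^ q = a ^ q + b ^ q) :
    (∀ c : k, c ^ q = c → ∃ b : Fin q → k, Function.Injective b ∧ ∀ e, b e ^ q + b e = c) ∧
      ∃ a : Fin (q ^ 2 - q) → k, Function.Injective a ∧ ∀ e, a e ^ q + a e ≠ 0 := by
  let tr : k →+ k :=
    { toFun := fun a => a ^ q + a
      map_zero' := by simp [show q ≠ 0 by omega]
      map_add' := fun a b => by rw [hadd]; ring }
  have htr : ∀ a, tr a = a ^ q + a := fun _ => rfl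
  have : Fintype k := Fintype.ofFinite k
  have hfrob : ∀ a : k, (a ^ q) ^ q = a := fun a => by
    rw [← pow_mul, ← sq, ← hcard, Nat.card_eq_fintype_card, FiniteField.pow_card]
  have hpoly : ∀ P : Polynomial k, P.Monic → P.natDegree = q → ∀ S : Set k,
      (∀ a ∈ S, P.eval a = 0) → Nat.card S ≤ q := by
    intro P hP hd S hS
    have h1 : S ⊆ P.rootSet k := fun a ha => by
      rw [Polynomial.mem_rootSet]
      exact ⟨hP.ne_zero, by simpa using hS a ha⟩
    rw [← hd, Nat.card_coe_set_eq]
    exact (Set.ncard_le_ncard h1 (Set.toFinite _)).trans (P.ncard_rootSet_le k)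
  have hdeg : (-(Polynomial.X : Polynomial k)).degree < (q : WithBot ℕ) := by
    rw [Polynomial.degree_neg, Polynomial.degree_X]
    exact_mod_cast hq
  let Q : Polynomial k := Polynomial.X ^ q + -Polynomial.X
  have hQ : Q.Monic := Polynomial.monic_X_pow_add hdeg
  have hQd : Q.natDegree = q := by
    apply Polynomial.natDegree_eq_of_degree_eq_some
    rw [Polynomial.degree_add_eq_left_of_degree_lt, Polynomial.degree_X_pow]
    rwa [Polynomial.degree_X_pow]
  have hker : Nat.card tr.ker ≤ q := by
    refine hpoly (trPoly q 0) (trPoly_monic hq 0) (trPoly_natDegree hq 0) tr.ker fun a ha => ?_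
    have : a ^ q + a = 0 := ha
    simpa [trPoly] using this
  let Fix : Set k := {c | c ^ q = c}
  have hfix : Nat.card Fix ≤ q := by
    refine hpoly Q hQ hQd Fix fun a ha => ?_
    have : a ^ q = a := ha
    simp [Q, this]
  have hsub : (tr.range : Set k) ⊆ Fix := by
    rintro _ ⟨a, rfl⟩
    change (tr a) ^ q = tr a
    rw [htr, hadd, hfrob, add_comm]
  have hrange : Nat.card tr.range ≤ Nat.card Fix := Nat.card_mono (Set.toFinite _) hsub
  have hmul : Nat.card tr.ker * Nat.card tr.range = q ^ 2 := by
    rw [← hcard, ← AddSubgroup.index_ker, AddSubgroup.card_mul_index]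
  have hkq : Nat.card tr.ker = q := by nlinarith
  have hrq : Nat.card tr.range = q := by nlinarith
  have heq : (tr.range : Set k) = Fix := by
    apply Set.eq_of_subset_of_ncard_le hsub _ (Set.toFinite _)
    rw [← Nat.card_coe_set_eq, ← Nat.card_coe_set_eq]
    exact hfix.trans hrq.ge
  constructor
  · intro c hc
    have : c ∈ (tr.range : Set k) := heq ▸ hc
    obtain ⟨b, hb⟩ := this
    let e := (Finite.equivFinOfCardEq hkq).symm
    refine ⟨fun i => b + e i, fun i j hij => e.injective (Subtype.ext (add_left_cancel hij)),
      fun i => ?_⟩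
    have h1 : tr (e i) = 0 := (e i).2
    rw [← htr, map_add, h1, hb, add_zero]
  · have h1 : Nat.card ((tr.ker : Set k)ᶜ : Set k) = q ^ 2 - q := by
      rw [Nat.card_coe_set_eq, Set.ncard_compl, hcard, ← Nat.card_coe_set_eq]
      exact congrArg _ hkq
    let e := (Finite.equivFinOfCardEq h1).symm
    exact ⟨fun i => e i, Subtype.val_injective.comp e.injective, fun i h => (e i).2 h⟩

theorem IsTower.exists_injective_algHom {L : Type*} [Field L] [Algebra k L] {n : ℕ} {x : ℕ → L}
    (hx : IsTower q n x) (hcard : Nat.card k = q ^ 2)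
    (hadd : ∀ a b : k, (a + b) ^ q = a ^ q + b ^ q)
    (hind₀ : ∀ P : Polynomial k, P ≠ 0 → Polynomial.aeval (x 0) P ≠ 0)
    (hind : ∀ i, i + 1 < n → ∀ c : ℕ → L, (∀ e, c e ∈ towerAlg k q x i) →
      ∑ e ∈ range q, c e * x (i + 1) ^ e = 0 → ∀ e < q, c e = 0) {i : ℕ} (hi : i < n) :
    ∃ φ : Fin ((q ^ 2 - q) * q ^ i) → (towerAlg k q x i →ₐ[k] k), Function.Injective φ := by
  have hq := hx.two_le
  obtain ⟨hb, a, ha, ha'⟩ := exists_injective_pow_add_eq hq hcard hadd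
  induction i with
  | zero =>
    choose ψ hψ using fun e => exists_algHom_towerAlg_zero (hx.tr_ne_zero 0 hi) hind₀ (ha' e)
    refine ⟨fun e => ψ (finCongr (by simp) e), fun e e' h => ?_⟩
    have h1 := DFunLike.congr_fun h ⟨x 0, mem_towerAlg le_rfl⟩
    simp only [hψ] at h1
    exact (finCongr _).injective (ha h1)
  | succ i ih =>
    obtain ⟨φ, hφ⟩ := ih (by omega)
    set c : towerAlg k q x i := ⟨_, hx.rel_const_mem (by omega)⟩ with hc
    have hfix : ∀ p, φ p c ^ q = φ p c := by
      intro p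
      have : Fintype k := Fintype.ofFinite k
      set y : towerAlg k q x i := ⟨x i, mem_towerAlg le_rfl⟩
      have h1 : c * (y ^ q + y) = y ^ (q + 1) := by
        apply Subtype.ext
        change x i ^ (q + 1) * (x i ^ q + x i)⁻¹ * (x i ^ q + x i) = x i ^ (q + 1)
        rw [mul_assoc, inv_mul_cancel₀ (hx.tr_ne_zero i (by omega)), mul_one]
      have h2 : (⟨_, (hx.tr_inv_mem i (by omega)).1⟩ : towerAlg k q x i) * (y ^ q + y) = 1 :=
        Subtype.ext (inv_mul_cancel₀ (hx.tr_ne_zero i (by omega)))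
      replace h1 := congrArg (φ p) h1
      replace h2 := congrArg (φ p) h2
      simp only [map_mul, map_add, map_pow, map_one] at h1 h2
      have h3 : φ p y ^ q + φ p y ≠ 0 := right_ne_zero_of_mul_eq_one h2
      have hfrob : (φ p y ^ q) ^ q = φ p y := by
        rw [← pow_mul, ← sq, ← hcard, Nat.card_eq_fintype_card, FiniteField.pow_card]
      have h4 := congrArg (· ^ q) h1
      simp only [mul_pow, hadd, hfrob] at h4
      apply mul_right_cancel₀ h3
      rw [h1, add_comm, h4, ← pow_mul, mul_comm (q + 1), pow_mul, pow_succ, hfrob]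
      ring
    choose b hbi hbe using fun p => hb (φ p c) (hfix p)
    choose ψ hψ hψ' using fun p e => exists_algHom_adjoin hq (hx.exists_rel hi)
      (hind i hi) (φ p) (hbe p e)
    let e : Fin ((q ^ 2 - q) * q ^ (i + 1)) ≃ Fin ((q ^ 2 - q) * q ^ i) × Fin q :=
      (finCongr (by rw [pow_succ q i, mul_assoc])).trans finProdFinEquiv.symm
    refine ⟨fun p => ψ (e p).1 (e p).2, fun p p' h => e.injective ?_⟩
    have h1 : (e p).1 = (e p').1 := by
      apply hφ
      ext f
      have := DFunLike.congr_fun h ⟨f, towerAlg_le_succ i f.2⟩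
      exact (hψ _ _ f _).symm.trans (this.trans (hψ _ _ f _))
    refine Prod.ext h1 (hbi (e p).1 ?_)
    have := DFunLike.congr_fun h ⟨x (i + 1), mem_towerAlg le_rfl⟩
    refine (hψ' _ _ _).symm.trans (this.trans ((hψ' _ _ _).trans ?_))
    rw [h1]

end

namespace IsTower

variable {k L : Type*} [Field k] [Field L] [Algebra k L] {q n : ℕ} {x : ℕ → L}

/-- Homomorphisms on the last step of the tower are determined on the ring of functions. -/
theorem algHom_ext (hx : IsTower q n x) (hn : 0 < n) {φ ψ : towerAlg k q x (n - 1) →ₐ[k] k}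
    (h : ∀ f (hf : f ∈ towerRing k q n x),
      φ ⟨f, hx.towerRing_le hn hf⟩ = ψ ⟨f, hx.towerRing_le hn hf⟩) : φ = ψ := by
  set E : Subalgebra k L := (AlgHom.equalizer φ ψ).map (towerAlg k q x (n - 1)).val with hE
  have hmem : ∀ f (hf : f ∈ towerAlg k q x (n - 1)), φ ⟨f, hf⟩ = ψ ⟨f, hf⟩ → f ∈ E :=
    fun f hf he => ⟨⟨f, hf⟩, he, rfl⟩
  have hB : towerRing k q n x ≤ E := fun f hf => hmem f _ (h f hf)
  have hx0 : x 0 ∈ E := hB gen_mem_towerRing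
  have h0 := hx.tr_ne_zero 0 hn
  have hinv : (x 0 ^ q + x 0)⁻¹ ∈ E := by
    obtain ⟨f, hf, hf'⟩ : x 0 ^ q + x 0 ∈ E := add_mem (pow_mem hx0 _) hx0
    have he : φ f = ψ f := hf
    have hf'' : (f : L) = x 0 ^ q + x 0 := hf'
    refine hmem _ (inv_mem_towerAlg _) ?_
    have h1 : f * ⟨(x 0 ^ q + x 0)⁻¹, inv_mem_towerAlg _⟩ = 1 := by
      apply Subtype.ext
      change (f : L) * _ = 1
      rw [hf'', mul_inv_cancel₀ h0]
    have h2 := congrArg φ h1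
    have h3 := congrArg ψ h1
    rw [map_mul, map_one] at h2 h3
    rw [he] at h2
    exact mul_left_cancel₀ (left_ne_zero_of_mul_eq_one h2) (h2.trans h3.symm)
  have hle : ∀ i < n, towerAlg k q x i ≤ E := by
    intro i hi
    induction i with
    | zero =>
      refine Algebra.adjoin_le ?_
      rintro _ (rfl | rfl)
      · exact hx0
      · exact hinv
    | succ i ih =>
      have ih := ih (by omega)
      have hq := hx.two_le
      have h1 : towerMon q n (towerGen q n x) (q ^ i) ∈ E := by
        have := mul_mem hinv (hB (mul_towerMon_mem_towerRing
          (Nat.pow_lt_pow_right hq (show i < n - 1 by omega))))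
        rwa [inv_mul_cancel_left₀ h0] at this
      have h2 := towerMon_mul_add (n := n) (x := towerGen q n x) hi (e := 1) (a := 0) hq
        (pow_pos (by omega) i)
      rw [one_mul, add_zero, towerMon_zero, mul_one, pow_one] at h2
      rw [h2] at h1
      have h3 : x (i + 1) ∈ E := by
        have := sub_mem h1 (ih (hx.towerGen_sub_mem (k := k) (by omega)))
        rwa [sub_sub_cancel] at this
      intro f hf
      obtain ⟨c, hc, rfl⟩ := hx.exists_eq_sum hi hf
      exact sum_mem fun e _ => mul_mem (ih (hc e)) (pow_mem h3 _)
  ext f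
  obtain ⟨g, hg, hg'⟩ := hle (n - 1) (by omega) f.2
  have : g = f := Subtype.ext hg'
  exact this ▸ hg

end IsTower

theorem IsLaurentTower.exists_isDigitalSeq {k : Type*} [Field k] [Finite k] {q n s : ℕ}
    {x : ℕ → LaurentSeries k} (hx : IsLaurentTower q n x) (hn : 0 < n) (hcard : Nat.card k = q ^ 2)
    (hadd : ∀ a b : k, (a + b) ^ q = a ^ q + b ^ q) (hs : 1 ≤ s)
    (hsn : s ≤ (q ^ 2 - q) * q ^ (n - 1)) :
    ∃ c : Fin s → ℕ → ℕ → k, IsDigitalSeq (3 * q ^ n) c := by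
  classical
  obtain ⟨φ, hφ⟩ := hx.toIsTower.exists_injective_algHom hcard hadd
    (fun P hP => (hx.aeval_ne_zero_and_dvd_order hn hP).1)
    (fun i hi c hc h => hx.eq_zero_of_sum_eq_zero hi hc h) (show n - 1 < n by omega)
  have := isNoetherianRing_towerRing (k := k) (q := q) (n := n) (x := x)
  refine (hx.isPoleFiltration hn).exists_isDigitalSeq (g := q ^ n) (fun m => ?_) hs
    (fun i => (φ (Fin.castLE hsn i)).comp (Subalgebra.inclusion (hx.toIsTower.towerRing_le hn)))
    fun i j hij => ?_
  · convert hx.le_count hn m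
  · refine Fin.castLE_injective hsn (hφ (hx.toIsTower.algHom_ext hn fun f hf => ?_))
    exact DFunLike.congr_fun hij ⟨f, hf⟩

theorem exists_pow_add_eq_of_henselianRing {R : Type*} [CommRing R] [Nontrivial R] {I : Ideal R}
    [HenselianRing R I] {q : ℕ} (hq : 2 ≤ q) {c : R} (hc : c ∈ I) : ∃ z ∈ I, z ^ q + z = c := by
  have h0 : (0 : R) ^ (q - 1) = 0 := zero_pow (by omega)
  obtain ⟨z, hz, hzI⟩ := HenselianRing.is_henselian (I := I) (trPoly q c) (trPoly_monic hq c) 0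
    (by simpa [trPoly, show q ≠ 0 by omega] using hc)
    (by simp [trPoly, Polynomial.derivative_X_pow, h0])
  refine ⟨z, by simpa using hzI, ?_⟩
  have h1 := aeval_trPoly (q := q) c z
  rw [Polynomial.coe_aeval_eq_eval, show (trPoly q c).eval z = 0 from hz] at h1
  exact (sub_eq_zero.1 h1.symm)

namespace LaurentSeries

open HahnSeries

variable {k : Type*} [Field k] {q : ℕ}

theorem order_coe_pos {z : PowerSeries k} (hz : z ∈ Ideal.span {(PowerSeries.X : PowerSeries k)})
    (h0 : (z : LaurentSeries k) ≠ 0) : 0 < order (z : LaurentSeries k) := by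
  refine Int.lt_iff_add_one_le.2 ((le_order_iff_forall h0).2 fun j hj => ?_)
  rw [PowerSeries.coeff_coe]
  split_ifs with hj'
  · rfl
  · have : j = 0 := by omega
    rw [this, Int.natAbs_zero, PowerSeries.coeff_zero_eq_constantCoeff_apply]
    exact PowerSeries.X_dvd_iff.1 (Ideal.mem_span_singleton.1 hz)

theorem exists_tower_step (hq : 2 ≤ q) {u : PowerSeries k}
    (hu : u ∈ Ideal.span {(PowerSeries.X : PowerSeries k)}) :
    ∃ z ∈ Ideal.span {(PowerSeries.X : PowerSeries k)},
      (z ^ q + z) * (1 + u ^ (q - 1)) = u ^ q := by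
  have hunit : IsUnit (1 + u ^ (q - 1)) := by
    rw [PowerSeries.isUnit_iff_constantCoeff, map_add, map_one, map_pow,
      PowerSeries.X_dvd_iff.1 (Ideal.mem_span_singleton.1 hu), zero_pow (by omega), add_zero]
    exact isUnit_one
  obtain ⟨v, hv⟩ := hunit.exists_left_inv
  obtain ⟨z, hz, hz'⟩ := exists_pow_add_eq_of_henselianRing hq
    (Ideal.mul_mem_right v _ (Ideal.pow_mem_of_mem _ hu q (by omega)))
  exact ⟨z, hz, by rw [hz', mul_assoc, hv, mul_one]⟩

theorem order_pow_add {z : LaurentSeries k} (hq : 2 ≤ q) (hz0 : z ≠ 0) (hz : 0 < order z) :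
    order (z ^ q + z) = order z := by
  rw [add_comm]
  refine order_add_of_lt hz0 (pow_ne_zero _ hz0) ?_
  rw [order_pow, nsmul_eq_mul]
  have : (2 : ℤ) ≤ q := by exact_mod_cast hq
  nlinarith

theorem order_one_add_pow {z : LaurentSeries k} (hq : 2 ≤ q) (hz0 : z ≠ 0) (hz : 0 < order z) :
    order (1 + z ^ (q - 1)) = 0 := by
  rw [order_add_of_lt one_ne_zero (pow_ne_zero _ hz0), order_one]
  rw [order_pow, nsmul_eq_mul, order_one]
  have : (0 : ℤ) < (q - 1 : ℕ) := by exact_mod_cast (by omega : 0 < q - 1)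
  positivity

/-- A formal parameter followed by successive solutions of the equation of the tower. -/
theorem exists_tower_seq (k : Type*) [Field k] (hq : 2 ≤ q) : ∃ ζ : ℕ → LaurentSeries k,
    ∀ j, ζ j ≠ 0 ∧ order (ζ j) = (q ^ j : ℕ) ∧
      (ζ (j + 1) ^ q + ζ (j + 1)) * (1 + ζ j ^ (q - 1)) = ζ j ^ q := by
  let I : Ideal (PowerSeries k) := Ideal.span {(PowerSeries.X : PowerSeries k)}
  choose f hf hf' using fun u : I => exists_tower_step hq u.2
  let z : ℕ → I := fun j => (fun u : I => (⟨f u, hf u⟩ : I))^[j]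
    ⟨PowerSeries.X, Ideal.mem_span_singleton_self _⟩
  have hz : ∀ j,
      ((z (j + 1) : PowerSeries k) ^ q + z (j + 1)) * (1 + (z j : PowerSeries k) ^ (q - 1)) = (z j : PowerSeries k) ^ q := by
    intro j
    have : z (j + 1) = ⟨f (z j), hf (z j)⟩ := Function.iterate_succ_apply' _ _ _
    rw [this]
    exact hf' (z j)
  let ζ : ℕ → LaurentSeries k := fun j => ((z j : PowerSeries k) : LaurentSeries k)
  have hζ : ∀ j, (ζ (j + 1) ^ q + ζ (j + 1)) * (1 + ζ j ^ (q - 1)) = ζ j ^ q := by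
    intro j
    have := congrArg (ofPowerSeries ℤ k) (hz j)
    simpa only [map_mul, map_add, map_pow, map_one] using this
  have h : ∀ j, ζ j ≠ 0 ∧ order (ζ j) = (q ^ j : ℕ) := by
    intro j
    induction j with
    | zero =>
      have : ζ 0 = single 1 1 := PowerSeries.coe_X
      rw [this]
      exact ⟨single_ne_zero one_ne_zero, by rw [order_single one_ne_zero]; simp⟩
    | succ j ih =>
      have h0 : ζ (j + 1) ≠ 0 := by
        intro h0
        have := hζ j
        rw [h0, zero_pow (by omega), add_zero, zero_mul] at this
        exact pow_ne_zero q ih.1 this.symm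
      have hp := order_coe_pos (z (j + 1)).2 h0
      have h1 := congrArg order (hζ j)
      have h2 : (ζ (j + 1) ^ q + ζ (j + 1)) * (1 + ζ j ^ (q - 1)) ≠ 0 := by
        rw [hζ j]
        exact pow_ne_zero q ih.1
      rw [order_mul (left_ne_zero_of_mul h2) (right_ne_zero_of_mul h2), order_pow_add hq h0 hp,
        order_one_add_pow hq ih.1 (order_coe_pos (z j).2 ih.1), order_pow, ih.2, add_zero] at h1
      refine ⟨h0, h1.trans ?_⟩
      rw [nsmul_eq_mul, pow_succ', Nat.cast_mul]
  exact ⟨ζ, fun j => ⟨(h j).1, (h j).2, hζ j⟩⟩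

theorem exists_isLaurentTower (k : Type*) [Field k] (hq : 2 ≤ q) (n : ℕ)
    (hadd : ∀ a b : LaurentSeries k, (a + b) ^ q = a ^ q + b ^ q) :
    ∃ x : ℕ → LaurentSeries k, IsLaurentTower q n x := by
  obtain ⟨ζ, hζ⟩ := exists_tower_seq k hq
  have hpos : ∀ j, 0 < order (ζ j) := fun j => by
    rw [(hζ j).2.1]
    exact_mod_cast pow_pos (by omega) j
  have h1 : ∀ j, 1 + ζ j ^ (q - 1) ≠ 0 := by
    intro j h
    have := (hζ j).2.2
    rw [h, mul_zero] at this
    exact pow_ne_zero q (hζ j).1 this.symm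
  have htr : ∀ j, (ζ j)⁻¹ ^ q + (ζ j)⁻¹ = (1 + ζ j ^ (q - 1)) / ζ j ^ q := by
    intro j
    have h0 := (hζ j).1
    obtain ⟨r, rfl⟩ : ∃ r, q = r + 1 := ⟨q - 1, by omega⟩
    rw [Nat.add_sub_cancel, inv_pow]
    field_simp
    ring
  refine ⟨fun i => (ζ (n - 1 - i))⁻¹, ⟨hq, hadd, fun i _ => inv_ne_zero (hζ _).1, fun i _ => ?_,
    fun i hi => ?_⟩, fun i _ => ?_⟩
  · rw [htr]
    exact div_ne_zero (h1 _) (pow_ne_zero _ (hζ _).1)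
  · obtain ⟨j, hj⟩ : ∃ j, n - 1 - i = j + 1 := ⟨n - 1 - i - 1, by omega⟩
    rw [hj, show n - 1 - (i + 1) = j by omega, htr, ← (hζ j).2.2, inv_pow, inv_pow]
    have h0 := (hζ (j + 1)).1
    have h2 : ζ (j + 1) ^ q + ζ (j + 1) ≠ 0 := by
      intro h
      have := (hζ j).2.2
      rw [h, zero_mul] at this
      exact pow_ne_zero q (hζ j).1 this.symm
    have := h1 j
    field_simp
    ring
  · have h2 := order_mul (hζ (n - 1 - i)).1 (inv_ne_zero (hζ (n - 1 - i)).1)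
    rw [mul_inv_cancel₀ (hζ _).1, order_one, (hζ _).2.1] at h2
    linarith

end LaurentSeries

theorem Polynomial.isPoleFiltration_degreeLT (k : Type*) [Field k] :
    IsPoleFiltration (fun n => Polynomial.degreeLT k n) := by
  have key : ∀ (f : Polynomial k) (a : ℕ), f ∈ Polynomial.degreeLT k (a + 1) →
      f ∉ Polynomial.degreeLT k a → f.natDegree = a ∧ f ≠ 0 := by
    intro f a h h'
    have hf : f ≠ 0 := fun h0 => h' (h0 ▸ zero_mem _)
    rw [Polynomial.mem_degreeLT, ← Polynomial.natDegree_lt_iff_degree_lt hf] at h h'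
    exact ⟨by omega, hf⟩
  refine ⟨?_, fun a b hab => Polynomial.degreeLT_mono hab, fun f => ⟨f.natDegree + 1, ?_⟩, ?_, ?_⟩
  · rw [Submodule.eq_bot_iff]
    intro f hf
    rw [Polynomial.mem_degreeLT] at hf
    simpa using hf
  · rw [Polynomial.mem_degreeLT]
    exact Polynomial.degree_le_natDegree.trans_lt (by exact_mod_cast Nat.lt_succ_self _)
  · intro n f g hf hg hg'
    obtain ⟨hd, h0⟩ := key g n hg hg'
    have hl : g.coeff n ≠ 0 := hd ▸ Polynomial.leadingCoeff_ne_zero.2 h0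
    refine ⟨f.coeff n / g.coeff n, ?_⟩
    rw [Polynomial.mem_degreeLT, Polynomial.degree_lt_iff_coeff_zero] at hf hg ⊢
    intro m hm
    rcases hm.eq_or_lt with rfl | hm
    · simp [hl]
    · simp [hf m hm, hg m hm]
  · intro a b f g hf hf' hg hg'
    obtain ⟨hfd, hf0⟩ := key f a hf hf'
    obtain ⟨hgd, hg0⟩ := key g b hg hg'
    have h0 := mul_ne_zero hf0 hg0
    simp only [Polynomial.mem_degreeLT, ← Polynomial.natDegree_lt_iff_degree_lt h0,
      Polynomial.natDegree_mul hf0 hg0, hfd, hgd]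
    omega

theorem exists_isDigitalSeq_zero {k : Type*} [Field k] [Finite k] {s : ℕ} (hs : 1 ≤ s)
    (hsk : s ≤ Nat.card k) : ∃ c : Fin s → ℕ → ℕ → k, IsDigitalSeq 0 c := by
  classical
  let e := (Finite.equivFin k).symm
  refine (Polynomial.isPoleFiltration_degreeLT k).exists_isDigitalSeq (g := 0) (fun m => ?_) hs
    (fun i => Polynomial.aeval (e (Fin.castLE hsk i))) fun i j hij => ?_
  · rw [add_zero, Nat.count_of_forall]
    intro n _
    refine ⟨Polynomial.X ^ n, ?_, ?_⟩
    · rw [Polynomial.mem_degreeLT, Polynomial.degree_X_pow]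
      exact_mod_cast Nat.lt_succ_self n
    · rw [Polynomial.mem_degreeLT, Polynomial.degree_X_pow]
      exact lt_irrefl _
  · refine Fin.castLE_injective hsk (e.injective ?_)
    simpa using DFunLike.congr_fun hij Polynomial.X

theorem exists_isDigitalSeq_of_card_eq_sq {k : Type*} [Field k] [Finite k] {p f q : ℕ}
    [Fact p.Prime] [CharP k p] (hq : q = p ^ f) (hcard : Nat.card k = q ^ 2) {s : ℕ} (hs : 1 ≤ s) :
    ∃ t ≤ 6 * s, ∃ c : Fin s → ℕ → ℕ → k, IsDigitalSeq t c := by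
  have hq2 : 2 ≤ q := by
    have := Finite.one_lt_card (α := k)
    rw [hcard] at this
    by_contra! h
    interval_cases q <;> simp at this
  by_cases hsq : s ≤ q ^ 2
  · obtain ⟨c, hc⟩ := exists_isDigitalSeq_zero hs (hsq.trans hcard.ge)
    exact ⟨0, by omega, c, hc⟩
  have hex : ∃ n, s ≤ (q ^ 2 - q) * q ^ n :=
    ⟨s, (Nat.lt_pow_self hq2).le.trans (Nat.le_mul_of_pos_left _
      (Nat.sub_pos_of_lt (by nlinarith)))⟩
  obtain ⟨n, hn, hn'⟩ : ∃ n, s ≤ (q ^ 2 - q) * q ^ (n + 1) ∧ (q ^ 2 - q) * q ^ n < s := by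
    classical
    have h0 : Nat.find hex ≠ 0 := by
      intro h
      have := Nat.find_spec hex
      rw [h, pow_zero, mul_one] at this
      omega
    refine ⟨Nat.find hex - 1, ?_, not_le.1 (Nat.find_min hex (by omega))⟩
    rw [Nat.sub_add_cancel (by omega)]
    exact Nat.find_spec hex
  have : CharP (LaurentSeries k) p :=
    charP_of_injective_algebraMap (algebraMap k (LaurentSeries k)).injective p
  obtain ⟨x, hx⟩ := LaurentSeries.exists_isLaurentTower k hq2 (n + 2)
    fun a b => hq ▸ add_pow_char_pow a b p f
  obtain ⟨c, hc⟩ := hx.exists_isDigitalSeq (by omega) hcard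
    (fun a b => hq ▸ add_pow_char_pow a b p f) hs hn
  refine ⟨_, ?_, c, hc⟩
  have h1 : q ^ 2 ≤ 2 * (q ^ 2 - q) := by
    have : 2 * q ≤ q ^ 2 := by nlinarith
    omega
  have h2 : q ^ (n + 2) ≤ 2 * ((q ^ 2 - q) * q ^ n) := by
    rw [pow_add, mul_comm, ← mul_assoc]
    exact Nat.mul_le_mul_right _ h1
  omega

/-- There is an absolute constant `C > 0` such that for every finite field `F` (with
`q` elements, `q` a prime power) and every dimension `s ≥ 1` there exist `t ≤ C·s` and
generating matrices `c i` over `F` (rows indexed by `j ∈ ℕ`, columns by `r ∈ ℕ`) such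
that (1) every row of every matrix has only finitely many nonzero entries, and (2) for
every `m > t` and all `d i ≥ 0` with `∑ d i = m - t`, the `(m - t) × m` matrix formed by
the first `d i` rows of each `c i` restricted to the first `m` columns has rank `m - t`;
i.e. there are digital `(t, s)`-sequences in base `q` with finite-row generating
matrices whose quality parameter grows at most linearly in `s`. -/
theorem stmt9 : ∃ C : ℕ, 0 < C ∧
    ∀ (F : Type) [Field F] [Fintype F], ∀ s : ℕ, 1 ≤ s →
      ∃ t : ℕ, t ≤ C * s ∧
        ∃ c : Fin s → ℕ → ℕ → F,
          (∀ i j, {r : ℕ | c i j r ≠ 0}.Finite) ∧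
          (∀ m : ℕ, t < m → ∀ d : Fin s → ℕ, ∑ i, d i = m - t →
            Matrix.rank (Matrix.of fun (p : Σ i : Fin s, Fin (d i)) (r : Fin m) =>
              c p.1 (p.2 : ℕ) (r : ℕ)) = m - t) := by
  refine ⟨13, by norm_num, fun F _ _ s hs => ?_⟩
  obtain ⟨p, hp⟩ := CharP.exists F
  obtain ⟨f, hprime, hf⟩ := FiniteField.card F p
  have : Fact p.Prime := ⟨hprime⟩
  let k := FiniteField.Extension F p 2
  have : CharP k p := charP_of_injective_algebraMap (algebraMap F k).injective p
  have : Finite k := Module.finite_of_finite F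
  obtain ⟨t, ht, c, hc⟩ := exists_isDigitalSeq_of_card_eq_sq (k := k) hf
    (by rw [FiniteField.natCard_extension, Nat.card_eq_fintype_card]) hs
  obtain ⟨c', hc'⟩ := hc.restrictScalars
    (Module.finBasisOfFinrankEq F k (FiniteField.finrank_extension F p 2))
  exact ⟨2 * t + s, by omega, c', hc'.1, fun m hm d hd => hc'.rank_eq hm d hd⟩
end

section
/- Let q ≥ 2 be an integer, s ≥ 1 an integer, g ≥ 0 an integer, and e_1,...,e_s positive integers. Put t = g + Σ_{i=1}^s (e_i − 1) and u = g, and define c_FK = (q^t/s!)·(q^2/(2(q^2−1)))·((q−1)/(2 log q))^s if q is even, c_FK = (q^t/s!)·(1/2)·((q−1)/(2 log q))^s if q is odd, and c_Tez = (q^u/s!)·∏_{i=1}^s (⌊q^{e_i}/2⌋/(e_i log q)). Then c_FK / c_Tez ≥ (1/2)·((q−1)/q)^s·∏_{i=1}^s e_i. -/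
theorem weighted_floor_factor_le {q n : ℕ} (hq : (1 : ℝ) < q) (hn : 1 ≤ n) :
    ((q : ℝ) - 1) / q * n * (((q ^ n / 2 : ℕ) : ℝ) / ((n : ℝ) * Real.log q)) ≤
      (q : ℝ) ^ (n - 1) * (((q : ℝ) - 1) / (2 * Real.log q)) := by
  have hlog : 0 < Real.log q := Real.log_pos hq
  have hq0 : (0 : ℝ) < q := by linarith
  have hn0 : (0 : ℝ) < n := by exact_mod_cast hn
  have hfl : ((q ^ n / 2 : ℕ) : ℝ) ≤ (q : ℝ) ^ (n - 1) * q / 2 := by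
    rw [← pow_succ, Nat.sub_add_cancel hn]
    exact_mod_cast (Nat.cast_div_le : ((q ^ n / 2 : ℕ) : ℝ) ≤ _)
  have hc : 0 ≤ ((q : ℝ) - 1) / (q * Real.log q) :=
    div_nonneg (by linarith) (by positivity)
  calc ((q : ℝ) - 1) / q * n * (((q ^ n / 2 : ℕ) : ℝ) / ((n : ℝ) * Real.log q))
      = ((q : ℝ) - 1) / (q * Real.log q) * ((q ^ n / 2 : ℕ) : ℝ) := by
        field_simp
    _ ≤ ((q : ℝ) - 1) / (q * Real.log q) * ((q : ℝ) ^ (n - 1) * q / 2) :=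
        mul_le_mul_of_nonneg_left hfl hc
    _ = (q : ℝ) ^ (n - 1) * (((q : ℝ) - 1) / (2 * Real.log q)) := by
        field_simp

/-- With `t = g + ∑ i (e i - 1)` and `u = g`, the ratio of the Faure–Kritzer constant
`c_FK` (for a `(t, s)`-sequence in base `q`) to Tezuka's constant `c_Tez` (for a
`(u, e, s)`-sequence in base `q`) satisfies
`c_FK / c_Tez ≥ (1/2) · ((q-1)/q)^s · ∏ i, e i`. -/
theorem stmt11 (q s g : ℕ) (hq : 2 ≤ q) (hs : 1 ≤ s)
    (e : Fin s → ℕ) (he : ∀ i, 1 ≤ e i) :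
    (if Even q then
        ((q : ℝ) ^ (g + ∑ i, (e i - 1)) / (Nat.factorial s : ℝ)) *
          ((q : ℝ) ^ 2 / (2 * ((q : ℝ) ^ 2 - 1))) *
          (((q : ℝ) - 1) / (2 * Real.log q)) ^ s
      else
        ((q : ℝ) ^ (g + ∑ i, (e i - 1)) / (Nat.factorial s : ℝ)) * (1 / 2) *
          (((q : ℝ) - 1) / (2 * Real.log q)) ^ s)
      / (((q : ℝ) ^ g / (Nat.factorial s : ℝ)) *
          ∏ i, ((q ^ e i / 2 : ℕ) : ℝ) / ((e i : ℝ) * Real.log q))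
      ≥ (1 / 2) * (((q : ℝ) - 1) / (q : ℝ)) ^ s * ∏ i, (e i : ℝ) := by
  have hq1 : (1 : ℝ) < q := by exact_mod_cast hq
  have hq0 : (0 : ℝ) < q := by linarith
  have hlog : 0 < Real.log q := Real.log_pos hq1
  have hfloor : ∀ i, 0 < q ^ e i / 2 := fun i =>
    Nat.div_pos (hq.trans (Nat.le_self_pow (by have := he i; omega) q)) two_pos
  have hden : 0 < ∏ i, ((q ^ e i / 2 : ℕ) : ℝ) / ((e i : ℝ) * Real.log q) := by
    refine Finset.prod_pos fun i _ => div_pos (by exact_mod_cast hfloor i) (mul_pos ?_ hlog)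
    exact_mod_cast he i
  have hC : 0 < (q : ℝ) ^ g / (Nat.factorial s : ℝ) := by positivity
  have hprod : (((q : ℝ) - 1) / (q : ℝ)) ^ s * (∏ i, (e i : ℝ)) *
      ∏ i, ((q ^ e i / 2 : ℕ) : ℝ) / ((e i : ℝ) * Real.log q) ≤
      (q : ℝ) ^ (∑ i, (e i - 1)) * (((q : ℝ) - 1) / (2 * Real.log q)) ^ s := by
    have hconst : ∀ x : ℝ, x ^ s = ∏ _i : Fin s, x := fun x => by simp
    rw [hconst, hconst, ← Finset.prod_pow_eq_pow_sum, ← Finset.prod_mul_distrib,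
      ← Finset.prod_mul_distrib, ← Finset.prod_mul_distrib]
    refine Finset.prod_le_prod (fun i _ => ?_)
      fun i _ => weighted_floor_factor_le hq1 (he i)
    have : (0 : ℝ) ≤ q - 1 := by linarith
    positivity
  have hR : 0 ≤ (q : ℝ) ^ (∑ i, (e i - 1)) * (((q : ℝ) - 1) / (2 * Real.log q)) ^ s := by
    have : (0 : ℝ) ≤ q - 1 := by linarith
    positivity
  have heven : (1 / 2 : ℝ) ≤ (q : ℝ) ^ 2 / (2 * ((q : ℝ) ^ 2 - 1)) := by
    rw [div_le_div_iff₀ two_pos (by nlinarith)]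
    linarith
  rw [ge_iff_le, le_div_iff₀ (mul_pos hC hden)]
  have key : (1 / 2) * (((q : ℝ) - 1) / (q : ℝ)) ^ s * (∏ i, (e i : ℝ)) *
      (((q : ℝ) ^ g / (Nat.factorial s : ℝ)) *
        ∏ i, ((q ^ e i / 2 : ℕ) : ℝ) / ((e i : ℝ) * Real.log q)) ≤
      (q : ℝ) ^ g / (Nat.factorial s : ℝ) * (1 / 2) *
        ((q : ℝ) ^ (∑ i, (e i - 1)) * (((q : ℝ) - 1) / (2 * Real.log q)) ^ s) := by
    refine le_trans (le_of_eq ?_)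
      (mul_le_mul_of_nonneg_left hprod (mul_nonneg hC.le one_half_pos.le))
    ring
  refine key.trans ?_
  split_ifs
  · refine (mul_le_mul_of_nonneg_right (mul_le_mul_of_nonneg_left heven hC.le) hR).trans_eq ?_
    rw [pow_add]
    ring
  · rw [pow_add]
    exact le_of_eq (by ring)
end

section
/- Let q ≥ 2 be an integer, s ≥ 1 an integer, g ≥ 0 an integer, and e_1,...,e_s positive integers, and define c_FK and c_Tez as follows: with t = g + Σ_{i=1}^s (e_i − 1) and u = g, set c_FK = (q^t/s!)·(q^2/(2(q^2−1)))·((q−1)/(2 log q))^s if q is even and c_FK = (q^t/s!)·(1/2)·((q−1)/(2 log q))^s if q is odd, and set c_Tez = (q^u/s!)·∏_{i=1}^s (⌊q^{e_i}/2⌋/(e_i log q)). If ∏_{i=1}^s e_i > 2·(q/(q−1))^s, then c_Tez < c_FK. -/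
/-- The product in Tezuka's constant is at most what one gets by dropping the floors. -/
theorem prod_floor_half_pow_div_le {s : ℕ} (q : ℕ) (e : Fin s → ℕ) (he : ∀ i, 1 ≤ e i)
    {L : ℝ} (hL : 0 < L) :
    ∏ i, ((q ^ e i / 2 : ℕ) : ℝ) / ((e i : ℝ) * L) ≤
      (q : ℝ) ^ (∑ i, (e i - 1)) * (((q : ℝ) / (2 * L)) ^ s / ∏ i, (e i : ℝ)) := by
  calc
    _ ≤ ∏ i, (q : ℝ) ^ (e i - 1) * (((q : ℝ) / (2 * L)) / (e i : ℝ)) := by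
      refine Finset.prod_le_prod (fun i _ => by positivity) fun i _ => ?_
      have hei : (0 : ℝ) < e i := by exact_mod_cast he i
      have hfloor : ((q ^ e i / 2 : ℕ) : ℝ) ≤ (q : ℝ) ^ (e i - 1) * q / 2 := by
        rw [← pow_succ, Nat.sub_add_cancel (he i)]
        exact_mod_cast Nat.cast_div_le (α := ℝ) (m := q ^ e i) (n := 2)
      calc
        _ ≤ ((q : ℝ) ^ (e i - 1) * q / 2) / ((e i : ℝ) * L) := by gcongr
        _ = _ := by field_simp
    _ = _ := by
      rw [Finset.prod_mul_distrib, Finset.prod_pow_eq_pow_sum, Finset.prod_div_distrib,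
        Finset.prod_const, Finset.card_univ, Fintype.card_fin]


/-- With `t = g + ∑ i (e i - 1)` and `u = g`, if `∏ i, e i > 2 · (q/(q-1))^s` then
Tezuka's constant `c_Tez` (for a `(u, e, s)`-sequence in base `q`) is strictly smaller
than the Faure–Kritzer constant `c_FK` (for a `(t, s)`-sequence in base `q`). -/
theorem stmt12 (q s g : ℕ) (hq : 2 ≤ q) (hs : 1 ≤ s)
    (e : Fin s → ℕ) (he : ∀ i, 1 ≤ e i)
    (hcond : (∏ i, (e i : ℝ)) > 2 * ((q : ℝ) / ((q : ℝ) - 1)) ^ s) :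
    ((q : ℝ) ^ g / (Nat.factorial s : ℝ)) *
        ∏ i, ((q ^ e i / 2 : ℕ) : ℝ) / ((e i : ℝ) * Real.log q)
      < (if Even q then
          ((q : ℝ) ^ (g + ∑ i, (e i - 1)) / (Nat.factorial s : ℝ)) *
            ((q : ℝ) ^ 2 / (2 * ((q : ℝ) ^ 2 - 1))) *
            (((q : ℝ) - 1) / (2 * Real.log q)) ^ s
        else
          ((q : ℝ) ^ (g + ∑ i, (e i - 1)) / (Nat.factorial s : ℝ)) * (1 / 2) *
            (((q : ℝ) - 1) / (2 * Real.log q)) ^ s) := by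
  have hq1 : (1 : ℝ) < q := by exact_mod_cast hq
  have hL : 0 < Real.log q := Real.log_pos hq1
  have hq0 : (0 : ℝ) < q := by linarith
  have hqm : (0 : ℝ) < (q : ℝ) - 1 := by linarith
  have hP : 0 < ∏ i, (e i : ℝ) := Finset.prod_pos fun i _ => by exact_mod_cast he i
  have hratio : ((q : ℝ) / (2 * Real.log q)) ^ s / ∏ i, (e i : ℝ) <
      1 / 2 * (((q : ℝ) - 1) / (2 * Real.log q)) ^ s := by
    rw [div_lt_iff₀ hP]
    calc
      _ = 1 / 2 * (((q : ℝ) - 1) / (2 * Real.log q)) ^ s *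
          (2 * ((q : ℝ) / ((q : ℝ) - 1)) ^ s) := by
        rw [mul_mul_mul_comm, ← mul_pow]
        field_simp
      _ < _ := by gcongr
  have hodd : ((q : ℝ) ^ g / (Nat.factorial s : ℝ)) *
        ∏ i, ((q ^ e i / 2 : ℕ) : ℝ) / ((e i : ℝ) * Real.log q)
      < ((q : ℝ) ^ (g + ∑ i, (e i - 1)) / (Nat.factorial s : ℝ)) * (1 / 2) *
            (((q : ℝ) - 1) / (2 * Real.log q)) ^ s := by
    calc
      _ ≤ ((q : ℝ) ^ g / (Nat.factorial s : ℝ)) * ((q : ℝ) ^ (∑ i, (e i - 1)) *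
          (((q : ℝ) / (2 * Real.log q)) ^ s / ∏ i, (e i : ℝ))) := by
        gcongr
        exact prod_floor_half_pow_div_le q e he hL
      _ < ((q : ℝ) ^ g / (Nat.factorial s : ℝ)) * ((q : ℝ) ^ (∑ i, (e i - 1)) *
          (1 / 2 * (((q : ℝ) - 1) / (2 * Real.log q)) ^ s)) := by gcongr
      _ = _ := by rw [pow_add]; ring
  split_ifs
  · refine hodd.trans_le ?_
    have hhalf : (1 : ℝ) / 2 ≤ (q : ℝ) ^ 2 / (2 * ((q : ℝ) ^ 2 - 1)) := by
      rw [div_le_div_iff₀ two_pos (by nlinarith)]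
      linarith
    gcongr
  · exact hodd
end

section
/- Let q ≥ 2 be an integer. Let (f_i)_{i≥0} be a nondecreasing sequence of positive integers with f_0 = 1 such that for every j ≥ 1 the counting number T_j := #{ i ≥ 0 : f_i ≤ j } is finite, and assume the asymptotic T_j = (q/(q−1))·(q^j/j) + o(q^j/j) as j → ∞. Then for every real ε with 0 < ε < 1/q there exists s_0 such that for all integers s ≥ s_0 one has ∏_{i=1}^s f_i > (log_q s)^{((1/q) − ε)·s}, where log_q denotes the logarithm to the base q. -/
open Filter

/-- At most `#{i : f i ≤ j}` of the factors of `∏_{i=1}^s f i` are `≤ j`, and the others are at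
least `j + 1`. -/
theorem succ_pow_sub_card_le_prod (f : ℕ → ℕ) (hpos : ∀ i, 1 ≤ f i) (j s : ℕ)
    (hfin : {i : ℕ | f i ≤ j}.Finite) :
    (j + 1) ^ (s - Nat.card {i : ℕ // f i ≤ j}) ≤ ∏ i ∈ Finset.Icc 1 s, f i := by
  have hsmall : ((Finset.Icc 1 s).filter (fun i => f i ≤ j)).card ≤
      Nat.card {i : ℕ // f i ≤ j} := by
    rw [← Set.ncard_coe_finset]
    exact Set.ncard_le_ncard (fun i hi => (Finset.mem_filter.1 (Finset.mem_coe.1 hi)).2) hfin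
  have hsplit := Finset.card_filter_add_card_filter_not (s := Finset.Icc 1 s) (fun i => f i ≤ j)
  rw [Nat.card_Icc] at hsplit
  calc (j + 1) ^ (s - Nat.card {i : ℕ // f i ≤ j})
      ≤ (j + 1) ^ ((Finset.Icc 1 s).filter (fun i => ¬ f i ≤ j)).card :=
        Nat.pow_le_pow_right (Nat.succ_pos j) (by omega)
    _ ≤ ∏ i ∈ (Finset.Icc 1 s).filter (fun i => ¬ f i ≤ j), f i :=
        Finset.pow_card_le_prod _ _ _
          (fun i hi => Nat.lt_of_not_le (Finset.mem_filter.1 hi).2)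
    _ ≤ ∏ i ∈ Finset.Icc 1 s, f i :=
        Finset.prod_le_prod_of_subset_of_one_le' (Finset.filter_subset _ _)
          (fun i _ _ => hpos i)

/-- A function asymptotic to `q / (q - 1) * q ^ j / j` is eventually at most `3 * q ^ j`. -/
theorem eventually_le_three_mul_pow {q : ℝ} (hq : 2 ≤ q) {T : ℕ → ℝ}
    (hT : (fun j : ℕ => T j - q / (q - 1) * q ^ j / (j : ℝ))
        =o[atTop] fun j : ℕ => q ^ j / (j : ℝ)) :
    ∀ᶠ j : ℕ in atTop, T j ≤ 3 * q ^ j := by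
  filter_upwards [hT.bound one_pos, eventually_ge_atTop 1] with j hj hj1
  have hj1' : (1 : ℝ) ≤ j := by exact_mod_cast hj1
  have hnonneg : 0 ≤ q ^ j / (j : ℝ) := by positivity
  rw [one_mul, Real.norm_of_nonneg hnonneg, mul_div_assoc] at hj
  have hratio : q / (q - 1) ≤ 2 := by
    rw [div_le_iff₀ (by linarith)]
    linarith
  have hdiv : q ^ j / (j : ℝ) ≤ q ^ j := div_le_self (by positivity) hj1'
  have hle := (le_abs_self _).trans hj
  have hmul := mul_le_mul_of_nonneg_right hratio hnonneg
  linarith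

/-- The elementary inequality comparing `L ^ (c * s)` with `x ^ n` when `x` is at least `L / 2`
and `n` at least `3 / 4 * s`. -/
theorem rpow_mul_lt_pow {L c s x : ℝ} {n : ℕ} (hL : 16 ≤ L) (hc : c < 1 / 2) (hs : 0 < s)
    (hx : L / 2 ≤ x) (hn : 3 / 4 * s ≤ n) : L ^ (c * s) < x ^ n := by
  have hL0 : 0 < L := by linarith
  have hroot : (2 : ℝ) ≤ L ^ (1 / 4 : ℝ) := by
    calc (2 : ℝ) = ((2 : ℝ) ^ (4 : ℝ)) ^ (1 / 4 : ℝ) := by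
          rw [← Real.rpow_mul (by norm_num)]; norm_num
      _ ≤ L ^ (1 / 4 : ℝ) := Real.rpow_le_rpow (by positivity) (by norm_num; linarith) (by norm_num)
  have hsplit : L ^ (3 / 4 : ℝ) * L ^ (1 / 4 : ℝ) = L := by
    rw [← Real.rpow_add hL0]; norm_num
  have hhalf : L ^ (3 / 4 : ℝ) ≤ L / 2 := by
    have := mul_le_mul_of_nonneg_left hroot (Real.rpow_nonneg hL0.le (3 / 4 : ℝ))
    linarith
  calc L ^ (c * s) < L ^ (3 / 4 * (3 / 4 * s)) :=
        Real.rpow_lt_rpow_of_exponent_lt (by linarith) (by nlinarith)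
    _ = (L ^ (3 / 4 : ℝ)) ^ (3 / 4 * s) := Real.rpow_mul hL0.le _ _
    _ ≤ x ^ (3 / 4 * s) := Real.rpow_le_rpow (by positivity) (hhalf.trans hx) (by positivity)
    _ ≤ x ^ (n : ℝ) := Real.rpow_le_rpow_of_exponent_le (by linarith) hn
    _ = x ^ n := Real.rpow_natCast _ _

/-- Abstract content of Proposition 4: if `(f i)` is a nondecreasing sequence of
positive integers with `f 0 = 1` whose counting function
`T j = #{i : f i ≤ j}` is finite for every `j` and satisfies the Prime Number Theorem
asymptotic `T j = (q/(q-1)) · q^j / j + o(q^j / j)` as `j → ∞`, then for every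
`0 < ε < 1/q` one has `∏_{i=1}^s f i > (log_q s) ^ ((1/q - ε)·s)` for all sufficiently
large `s`. -/
theorem stmt13 (q : ℕ) (hq : 2 ≤ q) (f : ℕ → ℕ) (hmono : Monotone f)
    (hpos : ∀ i, 1 ≤ f i) (hf0 : f 0 = 1)
    (hfin : ∀ j : ℕ, {i : ℕ | f i ≤ j}.Finite)
    (hT : (fun j : ℕ => (Nat.card {i : ℕ // f i ≤ j} : ℝ) -
          (q : ℝ) / ((q : ℝ) - 1) * (q : ℝ) ^ j / (j : ℝ))
        =o[atTop] fun j : ℕ => (q : ℝ) ^ j / (j : ℝ)) :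
    ∀ ε : ℝ, 0 < ε → ε < 1 / (q : ℝ) →
      ∃ s₀ : ℕ, ∀ s : ℕ, s₀ ≤ s →
        (Real.logb q s) ^ ((1 / (q : ℝ) - ε) * (s : ℝ)) <
          ∏ i ∈ Finset.Icc 1 s, (f i : ℝ) := by
  intro ε hε _
  have hq' : (2 : ℝ) ≤ q := by exact_mod_cast hq
  have hc : 1 / (q : ℝ) - ε < 1 / 2 := by
    have := one_div_le_one_div_of_le two_pos hq'
    linarith
  have hlog : Tendsto (fun s : ℕ => Real.logb q s) atTop atTop :=
    (Real.tendsto_logb_atTop (by linarith)).comp tendsto_natCast_atTop_atTop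
  have hfloor : Tendsto (fun s : ℕ => ⌊Real.logb q s / 2⌋₊) atTop atTop :=
    tendsto_nat_floor_atTop.comp (hlog.atTop_div_const two_pos)
  refine eventually_atTop.1 ?_
  filter_upwards [hfloor.eventually (eventually_le_three_mul_pow hq' hT),
    hlog.eventually_ge_atTop 16, eventually_ge_atTop 144] with s hcard hL hs
  have hs' : (144 : ℝ) ≤ s := by exact_mod_cast hs
  set j := ⌊Real.logb q s / 2⌋₊
  have hpow : (q : ℝ) ^ j ≤ √s := by
    calc (q : ℝ) ^ j = (q : ℝ) ^ (j : ℝ) := (Real.rpow_natCast _ _).symm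
      _ ≤ (q : ℝ) ^ (Real.logb q s * (1 / 2)) :=
        Real.rpow_le_rpow_of_exponent_le (by linarith)
          ((Nat.floor_le (by linarith)).trans_eq (by ring))
      _ = √s := by
        rw [Real.rpow_mul (by linarith), Real.rpow_logb (by linarith) (by linarith) (by linarith),
          Real.sqrt_eq_rpow]
  have hsqrt : 12 * √(s : ℝ) ≤ s := by
    have h12 : (12 : ℝ) ≤ √s := Real.le_sqrt_of_sq_le (by linarith)
    nlinarith [Real.mul_self_sqrt (show (0 : ℝ) ≤ s by linarith)]
  have hn : 3 / 4 * (s : ℝ) ≤ ((s - Nat.card {i : ℕ // f i ≤ j} : ℕ) : ℝ) := by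
    have := le_tsub_add (a := Nat.card {i : ℕ // f i ≤ j}) (b := s)
    have : (s : ℝ) ≤ ((s - Nat.card {i : ℕ // f i ≤ j} : ℕ) : ℝ) +
        (Nat.card {i : ℕ // f i ≤ j} : ℝ) := by exact_mod_cast this
    linarith
  calc Real.logb q s ^ ((1 / (q : ℝ) - ε) * (s : ℝ))
      < ((j : ℝ) + 1) ^ (s - Nat.card {i : ℕ // f i ≤ j}) :=
        rpow_mul_lt_pow hL hc (by linarith) (Nat.lt_floor_add_one _).le hn
    _ ≤ ∏ i ∈ Finset.Icc 1 s, (f i : ℝ) := by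
        exact_mod_cast succ_pow_sub_card_le_prod f hpos j s (hfin j)
end
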